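/- Let d ≥ 2 and 1 < p ≤ d/(d−1). There is a constant C = C(d,p) such that the following holds: if E ⊆ (0,∞), if (ω_j)_{j≥0} is a sequence of positive numbers with ∑_{j≥0} ω_j^{−p'} ≤ 1, and if sup_{k∈ℤ} ∑_{j≥0} ω_j^p N(E^{k+j}, 2^k) 2^{−j(d−1)p/p'} ≤ A_0^p for some A_0 > 0, then ‖M_E f‖_{L^p(ℝ^d)} ≤ C A_0 ‖f‖_{L^p(ℝ^d)} for every continuous compactly supported f. -/

import Mathlib

open MeasureTheory Metric Set Filter
open scoped ENNReal NNReal Topology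

noncomputable section

abbrev Ed (d : ℕ) := EuclideanSpace ℝ (Fin d)

/-- The rotation-invariant probability measure on the unit sphere. -/
def sphereProb (d : ℕ) : Measure (sphere (0 : Ed d) 1) :=
  ((volume : Measure (Ed d)).toSphere Set.univ)⁻¹ • (volume : Measure (Ed d)).toSphere

/-- Spherical mean `A_t f`. -/
def sphMean (d : ℕ) (t : ℝ) (f : Ed d → ℂ) (x : Ed d) : ℂ :=
  ∫ y : sphere (0 : Ed d) 1, f (x - t • (y : Ed d)) ∂(sphereProb d)

/-- Spherical maximal function, with values in `ℝ≥0∞`. -/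
def maxFn (d : ℕ) (E : Set ℝ) (f : Ed d → ℂ) (x : Ed d) : ℝ≥0∞ :=
  ⨆ t ∈ E, (‖sphMean d t f x‖₊ : ℝ≥0∞)

/-- `N(S,δ)`: minimal number of intervals of length `δ` needed to cover `S`
(with the value `1` for the empty set). -/
def covN (S : Set ℝ) (δ : ℝ) : ℕ :=
  max 1 (sInf {n : ℕ | ∃ c : Fin n → ℝ, S ⊆ ⋃ i, Set.Icc (c i) (c i + δ)})

def Ek (E : Set ℝ) (k : ℤ) : Set ℝ := E ∩ Set.Ico ((2:ℝ)^k) ((2:ℝ)^(k+1))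

/-- weak type (p,p) for the spherical maximal operator. -/
def WeakTypePP (d : ℕ) (E : Set ℝ) (p : ℝ) : Prop :=
  ∃ C : ℝ, ∀ f : Ed d → ℂ, Continuous f → HasCompactSupport f → ∀ a : ℝ, 0 < a →
    volume {x | ENNReal.ofReal a < maxFn d E f x} ≤
      ENNReal.ofReal (C * a ^ (-p) * ∫ x, ‖f x‖ ^ p)

/-! ### The spherical measure on the ambient space -/

/-- The rotation-invariant probability measure on the unit sphere, as a measure on the space. -/
def sphMeas (d : ℕ) : Measure (Ed d) := (sphereProb d).map Subtype.val

lemma measurableEmbedding_sphere_val (d : ℕ) :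
    MeasurableEmbedding (Subtype.val : sphere (0 : Ed d) 1 → Ed d) :=
  MeasurableEmbedding.subtype_coe isClosed_sphere.measurableSet

lemma sphMean_eq_integral (d : ℕ) (t : ℝ) (f : Ed d → ℂ) (x : Ed d) :
    sphMean d t f x = ∫ y, f (x - t • y) ∂(sphMeas d) := by
  rw [sphMeas, (measurableEmbedding_sphere_val d).integral_map]; rfl

lemma isProbabilityMeasure_sphMeas {d : ℕ} (hd : 2 ≤ d) : IsProbabilityMeasure (sphMeas d) := by
  have : Nontrivial (Ed d) := by
    have : Nonempty (Fin d) := ⟨⟨0, by omega⟩⟩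
    infer_instance
  have h0 : (volume : Measure (Ed d)).toSphere Set.univ ≠ 0 := by
    rw [Ne, Measure.measure_univ_eq_zero]
    exact Measure.toSphere_ne_zero _
  have : IsProbabilityMeasure (sphereProb d) := ⟨by
    rw [sphereProb, Measure.smul_apply, smul_eq_mul, ENNReal.inv_mul_cancel h0
        (measure_ne_top _ _)]⟩
  exact Measure.isProbabilityMeasure_map measurable_subtype_coe.aemeasurable

lemma ae_norm_eq_one_sphMeas (d : ℕ) : ∀ᵐ y ∂(sphMeas d), ‖y‖ = 1 := by
  rw [sphMeas, (measurableEmbedding_sphere_val d).ae_map_iff]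
  exact Filter.Eventually.of_forall fun y => by simp

open scoped Pointwise in
lemma measurePreserving_sphMeas {d : ℕ} (L : Ed d ≃ₗᵢ[ℝ] Ed d) :
    MeasurePreserving L (sphMeas d) (sphMeas d) := by
  refine ⟨L.continuous.measurable, ?_⟩
  ext s hs
  have hval : Measurable (Subtype.val : sphere (0 : Ed d) 1 → Ed d) := measurable_subtype_coe
  rw [Measure.map_apply L.continuous.measurable hs, sphMeas,
    Measure.map_apply hval (L.continuous.measurable hs), Measure.map_apply hval hs, sphereProb]
  simp only [Measure.smul_apply]
  congr 1
  rw [Measure.toSphere_apply' _ (hval (L.continuous.measurable hs)),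
    Measure.toSphere_apply' _ (hval hs)]
  congr 1
  have hpre : Ioo (0 : ℝ) 1 • ((Subtype.val : sphere (0 : Ed d) 1 → Ed d) ''
      (Subtype.val ⁻¹' (L ⁻¹' s))) =
      L.toHomeomorph.toMeasurableEquiv ⁻¹' (Ioo (0 : ℝ) 1 •
        ((Subtype.val : sphere (0 : Ed d) 1 → Ed d) '' (Subtype.val ⁻¹' s))) := by
    ext z
    simp only [Set.mem_smul, mem_image, mem_preimage, Subtype.exists, mem_sphere_iff_norm, sub_zero,
      exists_and_left, exists_prop, exists_eq_right_right]
    constructor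
    · rintro ⟨r, hr, y, ⟨h1, h2⟩, rfl⟩
      exact ⟨r, hr, L y, ⟨h1, by simpa using h2⟩, by simp⟩
    · rintro ⟨r, hr, y, ⟨h1, h2⟩, h3⟩
      refine ⟨r, hr, L.symm y, ⟨by simpa using h1, by simpa using h2⟩, ?_⟩
      apply L.injective
      simpa using h3
  rw [hpre]
  exact MeasurePreserving.measure_preimage_equiv
    (f := L.toHomeomorph.toMeasurableEquiv) (LinearIsometryEquiv.measurePreserving L) _

lemma integral_comp_isometry_sphMeas {d : ℕ} {F : Type*} [NormedAddCommGroup F] [NormedSpace ℝ F]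
    (L : Ed d ≃ₗᵢ[ℝ] Ed d) (g : Ed d → F) :
    ∫ y, g (L y) ∂(sphMeas d) = ∫ y, g y ∂(sphMeas d) :=
  (measurePreserving_sphMeas L).integral_comp L.toHomeomorph.measurableEmbedding g

lemma exists_isometry_map_eq {d : ℕ} {v w : Ed d} (h : ‖v‖ = ‖w‖) :
    ∃ L : Ed d ≃ₗᵢ[ℝ] Ed d, L v = w :=
  ⟨(ℝ ∙ (v - w))ᗮ.reflection, Submodule.reflection_sub h⟩

lemma integral_comp_inner_sphMeas {d : ℕ} (g : ℝ → ℝ) {v w : Ed d} (h : ‖v‖ = ‖w‖) :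
    ∫ y, g (inner ℝ y v) ∂(sphMeas d) = ∫ y, g (inner ℝ y w) ∂(sphMeas d) := by
  obtain ⟨L, hL⟩ := exists_isometry_map_eq h
  rw [← integral_comp_isometry_sphMeas L (fun y => g (inner ℝ y w))]
  simp [← hL]

/-! ### Decay of the Fourier transform of the spherical measure -/

lemma Continuous.integrable_sphMeas {d : ℕ} (hd : 2 ≤ d) {F : Type*} [NormedAddCommGroup F]
    [SecondCountableTopology F] {f : Ed d → F} (hf : Continuous f) :
    Integrable f (sphMeas d) := by
  have := isProbabilityMeasure_sphMeas hd
  obtain ⟨C, hC⟩ := (isCompact_sphere (0 : Ed d) 1).exists_bound_of_continuousOn hf.continuousOn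
  refine Integrable.of_bound hf.aestronglyMeasurable C ?_
  filter_upwards [ae_norm_eq_one_sphMeas d] with y hy
  exact hC y (by simpa using hy)

lemma hasDerivAt_integral_sphMeas {d : ℕ} (hd : 2 ≤ d) {F F' : ℝ → Ed d → ℝ} {B : ℝ}
    (hF : ∀ s, Continuous (F s)) (hF' : ∀ s, Continuous (F' s))
    (hb : ∀ s y, ‖y‖ = 1 → |F' s y| ≤ B)
    (hderiv : ∀ s y, HasDerivAt (fun s => F s y) (F' s y) s) (s : ℝ) :
    HasDerivAt (fun s => ∫ y, F s y ∂(sphMeas d)) (∫ y, F' s y ∂(sphMeas d)) s := by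
  have := isProbabilityMeasure_sphMeas hd
  refine (hasDerivAt_integral_of_dominated_loc_of_deriv_le (bound := fun _ => B) univ_mem
    (Filter.Eventually.of_forall fun s => (hF s).aestronglyMeasurable)
    ((hF s).integrable_sphMeas hd) (hF' s).aestronglyMeasurable ?_ (integrable_const _)
    (Filter.Eventually.of_forall fun y s _ => hderiv s y)).2
  filter_upwards [ae_norm_eq_one_sphMeas d] with y hy s _
  exact hb s y hy

/-- The radial profile of the Fourier transform of the spherical measure. -/
def sphProfile {d : ℕ} (i : Fin d) (r : ℝ) : ℝ := ∫ y : Ed d, Real.cos (r * y i) ∂(sphMeas d)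

/-- The derivative of `sphProfile`. -/
def sphProfileDeriv {d : ℕ} (i : Fin d) (r : ℝ) : ℝ :=
  ∫ y : Ed d, -(y i * Real.sin (r * y i)) ∂(sphMeas d)

/-- The second derivative of `sphProfile`. -/
def sphProfileDeriv₂ {d : ℕ} (i : Fin d) (r : ℝ) : ℝ :=
  ∫ y : Ed d, -(y i * (y i * Real.cos (r * y i))) ∂(sphMeas d)

lemma abs_coord_le_one {d : ℕ} {y : Ed d} (hy : ‖y‖ = 1) (i : Fin d) : |y i| ≤ 1 := by
  have := PiLp.norm_apply_le y i
  rwa [hy, Real.norm_eq_abs] at this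

lemma abs_mul_le_one {a b : ℝ} (ha : |a| ≤ 1) (hb : |b| ≤ 1) : |a * b| ≤ 1 := by
  rw [abs_mul]; exact mul_le_one₀ ha (abs_nonneg _) hb

lemma abs_integral_sphMeas_le_one {d : ℕ} (hd : 2 ≤ d) {f : Ed d → ℝ}
    (hf : ∀ y, ‖y‖ = 1 → |f y| ≤ 1) : |∫ y, f y ∂(sphMeas d)| ≤ 1 := by
  have := isProbabilityMeasure_sphMeas hd
  have h := norm_integral_le_of_norm_le_const (μ := sphMeas d) (f := f) (C := 1) (by
    filter_upwards [ae_norm_eq_one_sphMeas d] with y hy using hf y hy)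
  simpa using h

section

variable {d : ℕ} (hd : 2 ≤ d) (i : Fin d)

include hd in
lemma hasDerivAt_sphProfile (r : ℝ) : HasDerivAt (sphProfile i) (sphProfileDeriv i r) r := by
  refine hasDerivAt_integral_sphMeas hd (B := 1) (F := fun s y => Real.cos (s * y i))
    (F' := fun s y => -(y i * Real.sin (s * y i))) (fun s => by fun_prop) (fun s => by fun_prop)
    ?_ ?_ r
  · intro s y hy
    rw [abs_neg]
    exact abs_mul_le_one (abs_coord_le_one hy i) (Real.abs_sin_le_one _)
  · intro s y
    have := ((hasDerivAt_id s).mul_const (y i)).cos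
    simp only [id, one_mul] at this
    convert this using 1; ring

include hd in
lemma hasDerivAt_sphProfileDeriv (r : ℝ) :
    HasDerivAt (sphProfileDeriv i) (sphProfileDeriv₂ i r) r := by
  refine hasDerivAt_integral_sphMeas hd (B := 1) (F := fun s y => -(y i * Real.sin (s * y i)))
    (F' := fun s y => -(y i * (y i * Real.cos (s * y i)))) (fun s => by fun_prop)
    (fun s => by fun_prop) ?_ ?_ r
  · intro s y hy
    rw [abs_neg]
    exact abs_mul_le_one (abs_coord_le_one hy i)
      (abs_mul_le_one (abs_coord_le_one hy i) (Real.abs_cos_le_one _))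
  · intro s y
    have := (((hasDerivAt_id s).mul_const (y i)).sin.const_mul (y i)).neg
    exact this.congr_deriv (by simp only [id, one_mul]; ring)

include hd in
lemma abs_sphProfile_le_one (r : ℝ) : |sphProfile i r| ≤ 1 :=
  abs_integral_sphMeas_le_one hd fun _ _ => Real.abs_cos_le_one _

include hd in
lemma abs_sphProfileDeriv_le_one (r : ℝ) : |sphProfileDeriv i r| ≤ 1 :=
  abs_integral_sphMeas_le_one hd fun y hy => by
    rw [abs_neg]
    exact abs_mul_le_one (abs_coord_le_one hy i) (Real.abs_sin_le_one _)

lemma integral_cos_inner_sphMeas (v : Ed d) :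
    ∫ y, Real.cos (inner ℝ y v) ∂(sphMeas d) = sphProfile i ‖v‖ := by
  rw [integral_comp_inner_sphMeas Real.cos (w := ‖v‖ • EuclideanSpace.single i (1 : ℝ)) (by
    simp [norm_smul])]
  simp [sphProfile, inner_smul_right, EuclideanSpace.inner_single_right]

lemma integral_sin_inner_sphMeas (v : Ed d) :
    ∫ y, Real.sin (inner ℝ y v) ∂(sphMeas d) = 0 := by
  have h := integral_comp_inner_sphMeas Real.sin (v := -v) (w := v) (by simp)
  simp only [inner_neg_right, Real.sin_neg, integral_neg] at h
  linarith

/-- The Fourier transform of the spherical measure. -/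
lemma integral_fourierChar_sphMeas (hd : 2 ≤ d) (v : Ed d) :
    ∫ y, (Real.fourierChar (-(inner ℝ y v)) : ℂ) ∂(sphMeas d) =
      (sphProfile i (2 * Real.pi * ‖v‖) : ℂ) := by
  have h1 : ∀ y : Ed d, (Real.fourierChar (-(inner ℝ y v)) : ℂ) =
      ((Real.cos (inner ℝ y ((2 * Real.pi) • v)) : ℝ) : ℂ) -
        ((Real.sin (inner ℝ y ((2 * Real.pi) • v)) : ℝ) : ℂ) * Complex.I := by
    intro y
    rw [Real.fourierChar_apply, Complex.exp_mul_I, inner_smul_right]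
    push_cast
    rw [mul_neg, Complex.cos_neg, Complex.sin_neg]
    ring
  simp_rw [h1]
  have hc : Continuous fun y : Ed d => ((Real.cos (inner ℝ y ((2 * Real.pi) • v)) : ℝ) : ℂ) := by
    fun_prop
  have hs : Continuous fun y : Ed d => ((Real.sin (inner ℝ y ((2 * Real.pi) • v)) : ℝ) : ℂ) := by
    fun_prop
  rw [integral_sub (hc.integrable_sphMeas hd) ((hs.integrable_sphMeas hd).mul_const _),
    integral_mul_const, integral_complex_ofReal, integral_complex_ofReal,
    integral_sin_inner_sphMeas, integral_cos_inner_sphMeas i]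
  simp [norm_smul, abs_of_pos Real.pi_pos]

include hd in
lemma integral_sq_coord_cos {k : Fin d} (hk : k ≠ i) {r : ℝ} (hr : 0 < r) :
    ∫ y : Ed d, -(y k * (y k * Real.cos (r * y i))) ∂(sphMeas d) = sphProfileDeriv i r / r := by
  set q : ℝ → ℝ := fun s => √(r ^ 2 + s ^ 2) with hq
  have hqpos : ∀ s, 0 < r ^ 2 + s ^ 2 := fun s => by positivity
  have hprof : ∀ s : ℝ, ∫ y : Ed d, Real.cos (r * y i + s * y k) ∂(sphMeas d) =
      sphProfile i (q s) := by
    intro s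
    have h := integral_cos_inner_sphMeas i
      (r • EuclideanSpace.single i (1 : ℝ) + s • EuclideanSpace.single k (1 : ℝ))
    have hn : ‖r • EuclideanSpace.single i (1 : ℝ) + s • EuclideanSpace.single k
        (1 : ℝ)‖ = q s := by
      rw [← Real.sqrt_sq (norm_nonneg _), norm_add_sq_real]
      simp [norm_smul, inner_smul_left, inner_smul_right, EuclideanSpace.inner_single_right, hk, hq]
    rw [hn] at h
    rw [← h]
    simp [inner_add_right, inner_smul_right, EuclideanSpace.inner_single_right]
  have hd1 : ∀ s, HasDerivAt (fun s => ∫ y : Ed d, Real.cos (r * y i + s * y k) ∂(sphMeas d))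
      (∫ y : Ed d, -(y k * Real.sin (r * y i + s * y k)) ∂(sphMeas d)) s := by
    refine hasDerivAt_integral_sphMeas hd (B := 1) (fun s => by fun_prop) (fun s => by fun_prop)
      ?_ ?_
    · intro s y hy
      rw [abs_neg]
      exact abs_mul_le_one (abs_coord_le_one hy k) (Real.abs_sin_le_one _)
    · intro s y
      have := (((hasDerivAt_id s).mul_const (y k)).const_add (r * y i)).cos
      simp only [id, one_mul] at this
      convert this using 1; ring
  have hq' : ∀ s, HasDerivAt q (s / q s) s := by
    intro s
    have := (((hasDerivAt_id s).pow 2).const_add (r ^ 2)).sqrt (hqpos s).ne'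
    refine this.congr_deriv ?_
    have h0 : √(r ^ 2 + s ^ 2) ≠ 0 := (Real.sqrt_pos.2 (hqpos s)).ne'
    simp only [hq, id, Pi.pow_apply]
    field_simp
    norm_num
  have hd2 : ∀ s, ∫ y : Ed d, -(y k * Real.sin (r * y i + s * y k)) ∂(sphMeas d) =
      sphProfileDeriv i (q s) * (s / q s) := by
    intro s
    refine (hd1 s).unique ?_
    rw [funext hprof]
    exact (hasDerivAt_sphProfile hd i (q s)).comp s (hq' s)
  have hd3 : HasDerivAt (fun s => ∫ y : Ed d, -(y k * Real.sin (r * y i + s * y k)) ∂(sphMeas d))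
      (∫ y : Ed d, -(y k * (y k * Real.cos (r * y i + 0 * y k))) ∂(sphMeas d)) 0 := by
    refine hasDerivAt_integral_sphMeas hd (B := 1)
      (F' := fun s y => -(y k * (y k * Real.cos (r * y i + s * y k))))
      (fun s => by fun_prop) (fun s => by fun_prop) ?_ ?_ 0
    · intro s y hy
      rw [abs_neg]
      exact abs_mul_le_one (abs_coord_le_one hy k)
        (abs_mul_le_one (abs_coord_le_one hy k) (Real.abs_cos_le_one _))
    · intro s y
      have := (((((hasDerivAt_id s).mul_const (y k)).const_add (r * y i)).sin).const_mul (y k)).neg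
      exact this.congr_deriv (by simp only [id, one_mul]; ring)
  have hq0 : q 0 = r := by simp [hq, Real.sqrt_sq hr.le]
  have hd4 : HasDerivAt (fun s => sphProfileDeriv i (q s) * (s / q s))
      (sphProfileDeriv i r / r) 0 := by
    have h1 := (hasDerivAt_sphProfileDeriv hd i (q 0)).comp 0 (hq' 0)
    have h2 := (hasDerivAt_id (0 : ℝ)).div (hq' 0) (by rw [hq0]; exact hr.ne')
    have h3 := h1.mul h2
    refine h3.congr_deriv ?_
    simp [hq0]
    field_simp
  rw [funext hd2] at hd3
  have := hd3.unique hd4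
  simpa using this

include hd in
lemma sphProfile_ode {r : ℝ} (hr : 0 < r) :
    sphProfileDeriv₂ i r = -sphProfile i r - (d - 1) / r * sphProfileDeriv i r := by
  have hsum : ∑ k ∈ Finset.univ.erase i,
      ∫ y : Ed d, -(y k * (y k * Real.cos (r * y i))) ∂(sphMeas d) =
      (d - 1) * (sphProfileDeriv i r / r) := by
    rw [Finset.sum_congr rfl fun k hk => integral_sq_coord_cos hd i (Finset.ne_of_mem_erase hk) hr]
    rw [Finset.sum_const, Finset.card_erase_of_mem (Finset.mem_univ _), Finset.card_univ,
      Fintype.card_fin, nsmul_eq_mul, Nat.cast_sub (by omega)]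
    simp
  have hInt : ∀ k, Integrable (fun y : Ed d => -(y k * (y k * Real.cos (r * y i)))) (sphMeas d) :=
    fun k => Continuous.integrable_sphMeas hd (by fun_prop)
  have hall : ∑ k, ∫ y : Ed d, -(y k * (y k * Real.cos (r * y i))) ∂(sphMeas d) =
      -sphProfile i r := by
    rw [← integral_finsetSum _ fun k _ => hInt k, sphProfile, ← integral_neg]
    refine integral_congr_ae ?_
    filter_upwards [ae_norm_eq_one_sphMeas d] with y hy
    have h1 : ∑ k, y k ^ 2 = 1 := by
      rw [← EuclideanSpace.real_norm_sq_eq, hy, one_pow]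
    rw [Finset.sum_neg_distrib]
    simp only [← mul_assoc, ← sq]
    rw [← Finset.sum_mul, h1, one_mul]
  rw [← Finset.add_sum_erase _ _ (Finset.mem_univ i), hsum] at hall
  have : sphProfileDeriv₂ i r = ∫ y : Ed d, -(y i * (y i * Real.cos (r * y i))) ∂(sphMeas d) := rfl
  rw [this]
  linear_combination hall

end

lemma exists_energy_bound {d : ℕ} (hd : 2 ≤ d) (i : Fin d) :
    ∃ C : ℝ, ∀ r : ℝ, 1 ≤ r → r ^ (d - 1) *
      ((sphProfileDeriv i r + (d - 1) / 2 * sphProfile i r / r) ^ 2 + sphProfile i r ^ 2) ≤ C := by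
  set a : ℝ := ((d : ℝ) - 1) / 2 with ha
  set A : ℝ := |a * (a - 1)| with hA
  set m : ℕ := d - 1 with hm
  have hma : (m : ℝ) = 2 * a := by
    rw [ha, hm, Nat.cast_sub (by omega)]; push_cast; ring
  have hm1 : 1 ≤ m := by omega
  set V : ℝ → ℝ := fun r => sphProfileDeriv i r + a * sphProfile i r / r with hV
  set G : ℝ → ℝ := fun r => r ^ m * (V r ^ 2 + sphProfile i r ^ 2) * Real.exp (A / r) with hG
  have hVd : ∀ r : ℝ, 0 < r → HasDerivAt V (-sphProfile i r - a / r * V r +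
      a * (a - 1) * sphProfile i r / r ^ 2) r := by
    intro r hr
    have h := (hasDerivAt_sphProfileDeriv hd i r).add
      (((hasDerivAt_sphProfile hd i r).const_mul a).div (hasDerivAt_id r) hr.ne')
    refine h.congr_deriv ?_
    rw [sphProfile_ode hd i hr, hV]
    have : (d : ℝ) - 1 = 2 * a := by rw [ha]; ring
    rw [this]
    simp only [id]
    field_simp
    ring
  have hGd : ∀ r : ℝ, 0 < r → HasDerivAt G
      (r ^ m / r ^ 2 * (2 * (a * (a - 1)) * sphProfile i r * V r -
        A * (V r ^ 2 + sphProfile i r ^ 2)) * Real.exp (A / r)) r := by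
    intro r hr
    have h := ((hasDerivAt_pow m r).mul (((hVd r hr).pow 2).add
      ((hasDerivAt_sphProfile hd i r).pow 2))).mul
        (((hasDerivAt_const r A).div (hasDerivAt_id r) hr.ne').exp)
    refine h.congr_deriv ?_
    have hU : sphProfileDeriv i r = V r - a * sphProfile i r / r := by rw [hV]; ring
    rw [hU, hma]
    have hp : r ^ (m - 1) = r ^ m / r := by
      rw [eq_div_iff hr.ne', ← pow_succ, Nat.sub_add_cancel hm1]
    simp only [Pi.mul_apply, Pi.add_apply, Pi.pow_apply, Pi.div_apply, id, hp]
    field_simp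
    simp only [Nat.add_one_sub_one, pow_one, Nat.cast_ofNat]
    ring
  have hanti : AntitoneOn G (Ici 1) := by
    refine antitoneOn_of_deriv_nonpos (convex_Ici 1)
      (fun r hr => (hGd r (by rw [mem_Ici] at hr; linarith)).continuousAt.continuousWithinAt)
      (fun r hr => ((hGd r (zero_lt_one.trans (by rwa [interior_Ici] at hr))).differentiableAt
        |>.differentiableWithinAt)) ?_
    intro r hr
    rw [interior_Ici, mem_Ioi] at hr
    have hr0 : 0 < r := by linarith
    rw [(hGd r hr0).deriv]
    refine mul_nonpos_of_nonpos_of_nonneg (mul_nonpos_of_nonneg_of_nonpos (by positivity) ?_)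
      (Real.exp_pos _).le
    have h1 : 2 * (a * (a - 1)) * sphProfile i r * V r ≤ A * (2 * |sphProfile i r| * |V r|) := by
      calc _ ≤ |2 * (a * (a - 1)) * sphProfile i r * V r| := le_abs_self _
        _ = _ := by rw [hA, abs_mul, abs_mul, abs_mul, abs_two]; ring
    have h2 : 2 * |sphProfile i r| * |V r| ≤ V r ^ 2 + sphProfile i r ^ 2 := by
      nlinarith [sq_nonneg (|sphProfile i r| - |V r|), sq_abs (sphProfile i r), sq_abs (V r)]
    have := mul_le_mul_of_nonneg_left h2 (abs_nonneg (a * (a - 1)))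
    linarith
  refine ⟨G 1, fun r hr => le_trans ?_ (hanti (mem_Ici.2 le_rfl) (mem_Ici.2 hr) hr)⟩
  have hr0 : 0 < r := by linarith
  refine le_mul_of_one_le_right (by positivity) (Real.one_le_exp (by positivity))

lemma exists_sphProfile_decay {d : ℕ} (hd : 2 ≤ d) (i : Fin d) :
    ∃ C : ℝ, 1 ≤ C ∧ (∀ r : ℝ, 0 < r → r ^ (d - 1) * sphProfile i r ^ 2 ≤ C ^ 2) ∧
      ∀ r : ℝ, 0 < r → r ^ (d - 1) * sphProfileDeriv i r ^ 2 ≤ C ^ 2 := by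
  obtain ⟨C, hC⟩ := exists_energy_bound hd i
  set a : ℝ := ((d : ℝ) - 1) / 2 with ha
  have h0 : 0 ≤ C := (by positivity : (0:ℝ) ≤ _).trans (hC 1 le_rfl)
  set D := 1 + C + 2 * (1 + a ^ 2) * C with hD
  have hD1 : 1 ≤ D := by nlinarith [mul_nonneg (by positivity : 0 ≤ 2 * (1 + a ^ 2)) h0]
  have hDD : D ≤ D ^ 2 := by nlinarith
  have hsmall : ∀ (x r : ℝ), |x| ≤ 1 → 0 < r → r ≤ 1 → r ^ (d - 1) * x ^ 2 ≤ D ^ 2 := by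
    intro x r hx hr hr1
    have h1 : r ^ (d - 1) ≤ 1 := pow_le_one₀ hr.le hr1
    have h2 : x ^ 2 ≤ 1 := (sq_le_one_iff_abs_le_one x).2 hx
    calc _ ≤ 1 * 1 := mul_le_mul h1 h2 (sq_nonneg _) zero_le_one
      _ ≤ D ^ 2 := by nlinarith
  refine ⟨D, hD1, fun r hr => ?_, fun r hr => ?_⟩
  · rcases le_total r 1 with h1 | h1
    · exact hsmall _ r (abs_sphProfile_le_one hd i r) hr h1
    · refine le_trans ?_ ((by nlinarith [mul_nonneg (by positivity : 0 ≤ 2 * (1 + a ^ 2)) h0] :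
        C ≤ D).trans hDD)
      refine le_trans ?_ (hC r h1)
      gcongr
      nlinarith [sq_nonneg (sphProfileDeriv i r + a * sphProfile i r / r)]
  · rcases le_total r 1 with h1 | h1
    · exact hsmall _ r (abs_sphProfileDeriv_le_one hd i r) hr h1
    · have hCr := hC r h1
      set U := sphProfile i r
      set V := sphProfileDeriv i r + a * U / r with hV
      have hU : sphProfileDeriv i r = V - a * U / r := by rw [hV]; ring
      have hU2 : (a * U / r) ^ 2 ≤ a ^ 2 * U ^ 2 := by
        rw [div_pow, mul_pow]
        exact div_le_self (by positivity) (one_le_pow₀ h1)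
      have h3 : sphProfileDeriv i r ^ 2 ≤ 2 * (1 + a ^ 2) * (V ^ 2 + U ^ 2) := by
        rw [hU]
        nlinarith [sq_nonneg (V + a * U / r), mul_nonneg (sq_nonneg a) (sq_nonneg V), sq_nonneg U]
      calc r ^ (d - 1) * sphProfileDeriv i r ^ 2 ≤
          r ^ (d - 1) * (2 * (1 + a ^ 2) * (V ^ 2 + U ^ 2)) := by gcongr
        _ = 2 * (1 + a ^ 2) * (r ^ (d - 1) * (V ^ 2 + U ^ 2)) := by ring
        _ ≤ 2 * (1 + a ^ 2) * C := by gcongr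
        _ ≤ D ^ 2 := by linarith

/-- Decay of increments of the profile. -/
lemma sphProfile_sub_sq_le {d : ℕ} (hd : 2 ≤ d) (i : Fin d) {C : ℝ}
    (hC : ∀ r : ℝ, 0 < r → r ^ (d - 1) * sphProfileDeriv i r ^ 2 ≤ C ^ 2) {s t : ℝ} (hs : 0 < s)
    (hst : s ≤ t) :
    s ^ (d - 1) * (sphProfile i t - sphProfile i s) ^ 2 ≤ C ^ 2 * (t - s) ^ 2 := by
  rcases hst.eq_or_lt with rfl | hlt
  · simp
  obtain ⟨c, hc, hcd⟩ := exists_hasDerivAt_eq_slope (sphProfile i) (sphProfileDeriv i) hlt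
    (fun x _ => (hasDerivAt_sphProfile hd i x).continuousAt.continuousWithinAt)
    (fun x _ => hasDerivAt_sphProfile hd i x)
  have h1 : sphProfile i t - sphProfile i s = sphProfileDeriv i c * (t - s) := by
    rw [hcd, div_mul_cancel₀ _ (sub_pos.2 hlt).ne']
  rw [h1, mul_pow, ← mul_assoc]
  gcongr
  refine le_trans ?_ (hC c (hs.trans hc.1))
  gcongr
  exact hc.1.le

section

open scoped FourierTransform Convolution

/-! ### Convolution with smooth compactly supported kernels -/

open scoped ContDiff in
/-- Smooth compactly supported functions. -/
structure IsTest {d : ℕ} (f : Ed d → ℂ) : Prop where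
  contDiff : ContDiff ℝ ∞ f
  compact : HasCompactSupport f

/-- Convolution on `ℝ^d`. -/
def cv {d : ℕ} (K h : Ed d → ℂ) (x : Ed d) : ℂ := ∫ z, K (x - z) * h z

lemma cv_eq_convolution {d : ℕ} (K h : Ed d → ℂ) :
    cv K h = h ⋆[ContinuousLinearMap.mul ℝ ℂ, volume] K := by
  ext x
  simp only [cv, convolution, ContinuousLinearMap.mul_apply']
  exact integral_congr_ae (.of_forall fun z => mul_comm _ _)

namespace IsTest
variable {d : ℕ} {f g h : Ed d → ℂ}

lemma continuous (hf : IsTest f) : Continuous f := hf.contDiff.continuous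

lemma integrable (hf : IsTest f) : Integrable f :=
  hf.continuous.integrable_of_hasCompactSupport hf.compact

lemma add (hf : IsTest f) (hg : IsTest g) : IsTest (f + g) :=
  ⟨hf.contDiff.add hg.contDiff, hf.compact.add hg.compact⟩

lemma neg (hf : IsTest f) : IsTest (-f) :=
  ⟨hf.contDiff.neg, hf.compact.neg⟩

lemma sub (hf : IsTest f) (hg : IsTest g) : IsTest (f - g) := by
  rw [sub_eq_add_neg]; exact hf.add hg.neg

lemma const_mul (hf : IsTest f) (c : ℂ) : IsTest (fun x => c * f x) :=
  ⟨contDiff_const.mul hf.contDiff, hf.compact.mul_left⟩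

lemma comp_smul (hf : IsTest f) {r : ℝ} (hr : r ≠ 0) : IsTest (fun x => f (r • x)) :=
  ⟨hf.contDiff.comp (contDiff_const_smul r), hf.compact.comp_smul hr⟩

lemma convolution (hf : IsTest f) (hg : LocallyIntegrable g) (hg' : HasCompactSupport g) :
    IsTest (cv f g) := by
  rw [cv_eq_convolution]
  refine ⟨?_, ?_⟩
  · exact hf.compact.contDiff_convolution_right (ContinuousLinearMap.mul ℝ ℂ) hg hf.contDiff
  · exact HasCompactSupport.convolution (ContinuousLinearMap.mul ℝ ℂ) hg' hf.compact

lemma fourier_decay (hf : IsTest f) (k : ℕ) : ∃ C : ℝ, ∀ ξ, ‖ξ‖ ^ k * ‖𝓕 f ξ‖ ≤ C := by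
  obtain ⟨C, hC⟩ := (𝓕 (hf.compact.toSchwartzMap hf.contDiff)).decay k 0
  refine ⟨C, fun ξ => ?_⟩
  have := hC.2 ξ
  rwa [norm_iteratedFDeriv_zero] at this

lemma integral_norm_sq_fourier (hf : IsTest f) : ∫ ξ, ‖𝓕 f ξ‖ ^ 2 = ∫ x, ‖f x‖ ^ 2 :=
  SchwartzMap.integral_norm_sq_fourier (hf.compact.toSchwartzMap hf.contDiff)

lemma integrable_norm_sq_fourier (hf : IsTest f) : Integrable fun ξ => ‖𝓕 f ξ‖ ^ 2 :=
  ((𝓕 (hf.compact.toSchwartzMap hf.contDiff)).memLp 2 volume).integrable_norm_pow two_ne_zero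

end IsTest

lemma fourier_cv {d : ℕ} {f g : Ed d → ℂ} (hf : Integrable f) (hg : Integrable g) (ξ : Ed d) :
    𝓕 (cv f g) ξ = 𝓕 f ξ * 𝓕 g ξ := by
  rw [mul_comm, ← Real.fourier_mul_convolution_eq hg hf, cv_eq_convolution]
  rfl

lemma fourier_add_apply {d : ℕ} {f g : Ed d → ℂ} (hf : Integrable f) (hg : Integrable g)
    (ξ : Ed d) :
    𝓕 (f + g) ξ = 𝓕 f ξ + 𝓕 g ξ := by
  simp only [Real.fourier_eq, Pi.add_apply, smul_add]
  exact integral_add ((Real.fourierIntegral_convergent_iff (μ := volume) ξ).2 hf)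
    ((Real.fourierIntegral_convergent_iff (μ := volume) ξ).2 hg)

lemma fourier_sub_apply {d : ℕ} {f g : Ed d → ℂ} (hf : Integrable f) (hg : Integrable g)
    (ξ : Ed d) :
    𝓕 (f - g) ξ = 𝓕 f ξ - 𝓕 g ξ := by
  simp only [Real.fourier_eq, Pi.sub_apply, smul_sub]
  exact integral_sub ((Real.fourierIntegral_convergent_iff (μ := volume) ξ).2 hf)
    ((Real.fourierIntegral_convergent_iff (μ := volume) ξ).2 hg)

lemma norm_fourierChar_sub_one_le (x : ℝ) : ‖(Real.fourierChar x : ℂ) - 1‖ ≤ 2 * Real.pi * |x| := by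
  rw [Real.fourierChar_apply, mul_comm _ Complex.I]
  refine (Real.norm_exp_I_mul_ofReal_sub_one_le).trans ?_
  rw [Real.norm_eq_abs, abs_mul, abs_of_pos (by positivity : 0 < 2 * Real.pi)]

lemma IsTest.norm_one_sub_fourier_le {d : ℕ} {f : Ed d → ℂ} (hf : IsTest f) (h1 : ∫ x, f x = 1) :
    ∃ C : ℝ, ∀ ξ, ‖1 - 𝓕 f ξ‖ ≤ C * ‖ξ‖ := by
  refine ⟨∫ x, 2 * Real.pi * ‖x‖ * ‖f x‖, fun ξ => ?_⟩
  have hInt : Integrable fun x => 2 * Real.pi * ‖x‖ * ‖f x‖ :=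
    Continuous.integrable_of_hasCompactSupport
      ((continuous_const.mul continuous_norm).mul hf.continuous.norm) hf.compact.norm.mul_left
  have hi2 : Integrable fun x => Real.fourierChar (-inner ℝ x ξ) • f x :=
    Real.fourierIntegral_convergent_iff (μ := volume) ξ |>.2 hf.integrable
  rw [Real.fourier_eq, ← h1, ← integral_sub hf.integrable hi2, ← integral_mul_const]
  refine norm_integral_le_of_norm_le (hInt.mul_const _) (.of_forall fun x => ?_)
  have : f x - Real.fourierChar (-inner ℝ x ξ) • f x =
      -((Real.fourierChar (-inner ℝ x ξ) : ℂ) - 1) * f x := by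
    rw [Circle.smul_def, smul_eq_mul]; ring
  rw [this, norm_mul, norm_neg]
  have h2 := norm_fourierChar_sub_one_le (-inner ℝ x ξ)
  have h3 : |-inner ℝ x ξ| ≤ ‖x‖ * ‖ξ‖ := by rw [abs_neg]; exact abs_real_inner_le_norm x ξ
  calc _ ≤ 2 * Real.pi * (‖x‖ * ‖ξ‖) * ‖f x‖ := by
        gcongr; exact h2.trans (by gcongr)
    _ = _ := by ring

lemma exists_isTest_integral_eq_one (d : ℕ) : ∃ η : Ed d → ℂ, IsTest η ∧ ∫ x, η x = 1 := by
  let b : ContDiffBump (0 : Ed d) := ⟨1, 2, by norm_num, by norm_num⟩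
  refine ⟨fun x => ((b.normed volume x : ℝ) : ℂ), ⟨?_, ?_⟩, ?_⟩
  · exact Complex.ofRealCLM.contDiff.comp b.contDiff_normed
  · exact b.hasCompactSupport_normed.comp_left (g := fun x : ℝ => (x : ℂ)) (by simp)
  · rw [integral_complex_ofReal, b.integral_normed, Complex.ofReal_one]

/-- Mollifiers whose Fourier transform is flat to high order at the origin. -/
lemma exists_isTest_flat (d n : ℕ) : ∃ Φ : Ed d → ℂ, IsTest Φ ∧
    ∃ C : ℝ, ∀ ξ, ‖1 - 𝓕 Φ ξ‖ ≤ C * ‖ξ‖ ^ n := by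
  obtain ⟨η, hη, h1⟩ := exists_isTest_integral_eq_one d
  obtain ⟨C, hC⟩ := hη.norm_one_sub_fourier_le h1
  induction n with
  | zero =>
    obtain ⟨D, hD⟩ := hη.fourier_decay 0
    refine ⟨η, hη, 1 + D, fun ξ => ?_⟩
    have := hD ξ
    simp only [pow_zero, one_mul, mul_one] at this ⊢
    exact (norm_sub_le _ _).trans (by simpa using this)
  | succ n ih =>
    obtain ⟨Φ, hΦ, D, hD⟩ := ih
    have hcv := hΦ.convolution hη.integrable.locallyIntegrable hη.compact
    refine ⟨Φ + η - cv Φ η, (hΦ.add hη).sub hcv, D * C, fun ξ => ?_⟩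
    have hF : 𝓕 (Φ + η - cv Φ η) ξ = 𝓕 Φ ξ + 𝓕 η ξ - 𝓕 Φ ξ * 𝓕 η ξ := by
      rw [← fourier_cv hΦ.integrable hη.integrable, fourier_sub_apply (hΦ.add hη).integrable
        hcv.integrable, fourier_add_apply hΦ.integrable hη.integrable]
    have : 1 - 𝓕 (Φ + η - cv Φ η) ξ = (1 - 𝓕 Φ ξ) * (1 - 𝓕 η ξ) := by rw [hF]; ring
    rw [this, norm_mul]
    calc _ ≤ (D * ‖ξ‖ ^ n) * (C * ‖ξ‖) :=
          mul_le_mul (hD ξ) (hC ξ) (norm_nonneg _) ((norm_nonneg _).trans (hD ξ))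
      _ = _ := by ring

/-! ### Littlewood–Paley kernels -/

/-- `L¹`-normalised dilation. -/
def dil {d : ℕ} (r : ℝ) (f : Ed d → ℂ) (x : Ed d) : ℂ := ((r ^ d)⁻¹ : ℝ) * f (r⁻¹ • x)

lemma IsTest.dilate {d : ℕ} {f : Ed d → ℂ} (hf : IsTest f) {r : ℝ} (hr : 0 < r) :
    IsTest (dil r f) :=
  (hf.comp_smul (inv_pos.2 hr).ne').const_mul _

lemma integral_dil {d : ℕ} {r : ℝ} (hr : 0 < r) (g : Ed d → Ed d → ℂ) :
    ∫ x, ((r ^ d)⁻¹ : ℝ) * g x (r⁻¹ • x) = ∫ x, g (r • x) x := by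
  have h := Measure.integral_comp_inv_smul_of_nonneg (volume : Measure (Ed d))
    (fun x => g (r • x) x) hr.le
  simp only [smul_inv_smul₀ hr.ne', finrank_euclideanSpace, Fintype.card_fin] at h
  rw [integral_const_mul, h, Complex.real_smul, ← mul_assoc, ← Complex.ofReal_mul,
    inv_mul_cancel₀ (by positivity), Complex.ofReal_one, one_mul]

lemma fourier_dil {d : ℕ} {r : ℝ} (hr : 0 < r) (f : Ed d → ℂ) (ξ : Ed d) :
    𝓕 (dil r f) ξ = 𝓕 f (r • ξ) := by
  simp only [Real.fourier_eq, dil, Circle.smul_def, smul_eq_mul]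
  rw [← integral_dil hr (fun y x => (Real.fourierChar (-inner ℝ x (r • ξ)) : ℂ) * f x)]
  refine integral_congr_ae (.of_forall fun x => ?_)
  simp only [inner_smul_left, inner_smul_right]
  have : r * ((starRingEnd ℝ) r⁻¹ * inner ℝ x ξ) = inner ℝ x ξ := by
    simp only [conj_trivial]; field_simp
  rw [this]; ring

lemma dil_dil {d : ℕ} (r s : ℝ) (f : Ed d → ℂ) : dil r (dil s f) = dil (r * s) f := by
  ext x
  simp only [dil, smul_smul]
  rw [← mul_assoc, ← Complex.ofReal_mul, mul_pow, mul_inv, mul_inv, mul_comm s⁻¹]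

lemma dil_sub {d : ℕ} (r : ℝ) (f g : Ed d → ℂ) : dil r (f - g) = dil r f - dil r g := by
  ext x
  simp only [dil, Pi.sub_apply, mul_sub]

/-- The band weight. -/
def band (u : ℝ) : ℝ := min u u⁻¹

lemma band_nonneg {u : ℝ} (hu : 0 ≤ u) : 0 ≤ band u := le_min hu (inv_nonneg.2 hu)

lemma band_le_one (u : ℝ) : band u ≤ 1 := by
  rcases le_total u 1 with h | h
  · exact (min_le_left _ _).trans h
  · exact (min_le_right _ _).trans (inv_le_one_of_one_le₀ h)

lemma measurable_band : Measurable band := measurable_id.min measurable_inv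

lemma summable_pow_natAbs {r : ℝ} (h0 : 0 ≤ r) (h1 : r < 1) :
    Summable fun n : ℤ => r ^ n.natAbs := by
  refine Summable.of_nat_of_neg ?_ ?_ <;>
  simpa using summable_geometric_of_lt_one h0 h1

lemma tsum_ofReal_pow_natAbs_lt_top {r : ℝ} (h0 : 0 ≤ r) (h1 : r < 1) :
    ∑' n : ℤ, ENNReal.ofReal (r ^ n.natAbs) < ∞ := by
  rw [← ENNReal.ofReal_tsum_of_nonneg (fun n => by positivity) (summable_pow_natAbs h0 h1)]
  exact ENNReal.ofReal_lt_top

lemma band_zpow_mul_le (n : ℤ) {s : ℝ} (h1 : 1 ≤ s) (h2 : s ≤ 2) :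
    band ((2 : ℝ) ^ n * s) ≤ 2 * (1 / 2) ^ n.natAbs := by
  have hs : 0 < s := by linarith
  rcases le_total n 0 with hn | hn
  · obtain ⟨m, rfl⟩ := Int.exists_eq_neg_ofNat hn
    refine (min_le_left _ _).trans ?_
    rw [Int.natAbs_neg, Int.natAbs_natCast, zpow_neg, zpow_natCast, one_div, inv_pow, mul_comm]
    gcongr
  · obtain ⟨m, rfl⟩ := Int.eq_ofNat_of_zero_le hn
    refine (min_le_right _ _).trans ?_
    rw [Int.natAbs_natCast, zpow_natCast, one_div, inv_pow, mul_inv, mul_comm]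
    gcongr
    exact (inv_le_one_of_one_le₀ h1).trans (by norm_num)

lemma exists_tsum_band_le : ∃ C : ℝ≥0∞, C ≠ ∞ ∧ ∀ u : ℝ, 0 < u →
    ∑' n : ℤ, ENNReal.ofReal (band ((2 : ℝ) ^ n * u) ^ 2) ≤ C := by
  refine ⟨∑' n : ℤ, 4 * ENNReal.ofReal ((1 / 4) ^ n.natAbs), ?_, fun u hu => ?_⟩
  · rw [ENNReal.tsum_mul_left]
    exact ENNReal.mul_ne_top (by norm_num)
      (tsum_ofReal_pow_natAbs_lt_top (by norm_num) (by norm_num)).ne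
  · obtain ⟨m, hm1, hm2⟩ := exists_mem_Ico_zpow hu (by norm_num : (1 : ℝ) < 2)
    rw [← (Equiv.addRight (-m)).tsum_eq]
    refine ENNReal.tsum_le_tsum fun n => ?_
    have hpos : (0 : ℝ) < 2 ^ m := by positivity
    have h1 : (2 : ℝ) ^ (Equiv.addRight (-m) n) * u = 2 ^ n * (u / 2 ^ m) := by
      rw [Equiv.coe_addRight, zpow_add₀ (by norm_num), zpow_neg]; ring
    rw [h1, show (4 : ℝ≥0∞) = ENNReal.ofReal 4 by simp, ← ENNReal.ofReal_mul (by norm_num)]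
    refine ENNReal.ofReal_le_ofReal ?_
    have h2 := band_zpow_mul_le n (s := u / 2 ^ m) ((one_le_div hpos).2 hm1)
      ((div_le_iff₀ hpos).2 (by rw [zpow_add_one₀ (by norm_num)] at hm2; linarith))
    calc _ ≤ (2 * (1 / 2 : ℝ) ^ n.natAbs) ^ 2 := by
          gcongr
          exact band_nonneg (by positivity)
      _ = _ := by rw [mul_pow, ← pow_mul, mul_comm _ 2, pow_mul]; norm_num

/-- A mollifier `Φ` such that the Fourier transform of `ψ = 2^d Φ(2·) - Φ` is well localised. -/
lemma exists_lp_kernel {d : ℕ} (hd : 2 ≤ d) : ∃ Φ : Ed d → ℂ, IsTest Φ ∧ ∫ x, Φ x = 1 ∧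
    ∃ C : ℝ, 0 < C ∧ ∀ ξ : Ed d, ξ ≠ 0 → (1 + ‖ξ‖ ^ 2) * ‖𝓕 (dil (1 / 2) Φ - Φ) ξ‖ ^ 2 ≤
      C ^ 2 * (‖ξ‖ ^ (d - 1) * band ‖ξ‖ ^ 2) := by
  obtain ⟨Φ, hΦ, C, hC⟩ := exists_isTest_flat d d
  have hψ : IsTest (dil (1 / 2) Φ - Φ) := (hΦ.dilate (by norm_num)).sub hΦ
  obtain ⟨D, hD⟩ := hψ.fourier_decay 2
  refine ⟨Φ, hΦ, ?_, ?_⟩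
  · have := hC 0
    rw [norm_zero, zero_pow (by omega), mul_zero, norm_le_zero_iff, sub_eq_zero] at this
    rw [this, Real.fourier_eq]
    simp
  · have hflat : ∀ ξ, ‖𝓕 (dil (1 / 2) Φ - Φ) ξ‖ ≤ 2 * |C| * ‖ξ‖ ^ d := by
      intro ξ
      rw [fourier_sub_apply (hΦ.dilate (by norm_num)).integrable hΦ.integrable,
        fourier_dil (by norm_num)]
      have e : 𝓕 Φ ((1 / 2 : ℝ) • ξ) - 𝓕 Φ ξ = (1 - 𝓕 Φ ξ) - (1 - 𝓕 Φ ((1 / 2 : ℝ) • ξ)) := by ring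
      rw [e]
      have h1 : ‖1 - 𝓕 Φ ξ‖ ≤ |C| * ‖ξ‖ ^ d := (hC ξ).trans (by gcongr; exact le_abs_self _)
      have h2 : ‖1 - 𝓕 Φ ((1 / 2 : ℝ) • ξ)‖ ≤ |C| * ‖ξ‖ ^ d := by
        refine (hC _).trans ?_
        rw [norm_smul]
        gcongr
        · exact le_abs_self _
        · refine mul_le_of_le_one_left (norm_nonneg _) (by norm_num)
      refine (norm_sub_le _ _).trans ?_
      linarith
    set M := 1 + 4 * |C| + 2 * |D| with hM
    have hM0 : 0 < M := by positivity
    refine ⟨M, hM0, fun ξ hξ => ?_⟩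
    set u := ‖ξ‖ with hu
    have hu0 : 0 < u := norm_pos_iff.2 hξ
    set w := ‖𝓕 (dil (1 / 2) Φ - Φ) ξ‖ with hw
    have hw0 : 0 ≤ w := norm_nonneg _
    rcases le_total u 1 with h | h
    · have hb : band u = u := min_eq_left (h.trans ((one_le_inv₀ hu0).2 h))
      rw [hb, ← pow_add]
      have h1 : w ^ 2 ≤ (2 * |C|) ^ 2 * u ^ (d - 1 + 2) := by
        calc w ^ 2 ≤ (2 * |C| * u ^ d) ^ 2 := by gcongr; exact hflat ξ
          _ = (2 * |C|) ^ 2 * u ^ (d * 2) := by rw [mul_pow, ← pow_mul]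
          _ ≤ _ := by
            refine mul_le_mul_of_nonneg_left (pow_le_pow_of_le_one hu0.le h (by omega))
                (by positivity)
      have h2 : 1 + u ^ 2 ≤ 2 := by nlinarith
      calc _ ≤ 2 * ((2 * |C|) ^ 2 * u ^ (d - 1 + 2)) := by gcongr
        _ = (2 * (2 * |C|) ^ 2) * u ^ (d - 1 + 2) := by ring
        _ ≤ _ := by
          gcongr
          have := abs_nonneg C
          have := abs_nonneg D
          nlinarith
    · have hb : band u = u⁻¹ := min_eq_right ((inv_le_one_of_one_le₀ h).trans h)
      rw [hb]
      have h1 : w ≤ |D| * (u⁻¹) ^ 2 := by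
        rw [inv_pow, ← div_eq_mul_inv, le_div_iff₀ (by positivity), mul_comm]
        exact (hD ξ).trans (le_abs_self _)
      have h3 : u⁻¹ * u = 1 := inv_mul_cancel₀ hu0.ne'
      have h2 : 1 + u ^ 2 ≤ 2 * u ^ 2 := by nlinarith
      calc _ ≤ 2 * u ^ 2 * (|D| * (u⁻¹) ^ 2) ^ 2 := by gcongr
        _ = 2 * |D| ^ 2 * ((u⁻¹) ^ 2 * (u⁻¹ * u) ^ 2) := by ring
        _ = 2 * |D| ^ 2 * (1 * (u⁻¹) ^ 2) := by rw [h3]; ring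
        _ ≤ _ := by
          gcongr
          · have := abs_nonneg C
            have := abs_nonneg D
            nlinarith
          · exact one_le_pow₀ h

/-! ### `L²` estimates -/

/-- Bounded measurable functions of compact support. -/
structure IsBddCompact {d : ℕ} (h : Ed d → ℂ) : Prop where
  measurable : Measurable h
  bounded : ∃ H : ℝ, ∀ x, ‖h x‖ ≤ H
  compact : HasCompactSupport h

lemma IsBddCompact.integrable {d : ℕ} {h : Ed d → ℂ} (hh : IsBddCompact h) : Integrable h := by
  obtain ⟨H, hH⟩ := hh.bounded
  have hs : volume (tsupport h) ≠ ∞ := hh.compact.isCompact.measure_lt_top.ne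
  refine (integrableOn_iff_integrable_of_support_subset (subset_tsupport h)).1 ?_
  exact Measure.integrableOn_of_bounded hs hh.measurable.aestronglyMeasurable
    (.of_forall fun x => hH x)

lemma continuous_fourier_of_integrable {d : ℕ} {h : Ed d → ℂ} (hh : Integrable h) :
    Continuous (𝓕 h) :=
  VectorFourier.fourierIntegral_continuous Real.continuous_fourierChar
    (L := innerₗ (Ed d)) continuous_inner hh

lemma sq_lintegral_mul_le {α : Type*} [MeasurableSpace α] (μ : Measure α) {f g : α → ℝ≥0∞}
    (hf : AEMeasurable f μ) (hg : AEMeasurable g μ) :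
    (∫⁻ a, f a * g a ∂μ) ^ 2 ≤ (∫⁻ a, f a ^ 2 ∂μ) * ∫⁻ a, g a ^ 2 ∂μ := by
  have h := ENNReal.lintegral_mul_le_Lp_mul_Lq μ Real.HolderConjugate.two_two hf hg
  simp only [Pi.mul_apply, ENNReal.rpow_two] at h
  calc _ ≤ ((∫⁻ a, f a ^ 2 ∂μ) ^ (1 / 2 : ℝ) * (∫⁻ a, g a ^ 2 ∂μ) ^ (1 / 2 : ℝ)) ^ 2 := by gcongr
    _ = _ := by
      rw [← ENNReal.rpow_two, ENNReal.mul_rpow_of_nonneg _ _ (by norm_num), ← ENNReal.rpow_mul,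
        ← ENNReal.rpow_mul]
      norm_num

/-- Weighted Cauchy–Schwarz. -/
lemma sq_lintegral_mul_le_weight {α : Type*} [MeasurableSpace α] (μ : Measure α) {w g : α → ℝ≥0∞}
    (hw : AEMeasurable w μ) (hg : AEMeasurable g μ) :
    (∫⁻ a, w a * g a ∂μ) ^ 2 ≤ (∫⁻ a, w a ∂μ) * ∫⁻ a, w a * g a ^ 2 ∂μ := by
  have h := sq_lintegral_mul_le μ (f := fun a => w a ^ (1 / 2 : ℝ))
    (g := fun a => w a ^ (1 / 2 : ℝ) * g a) (hw.pow_const _) ((hw.pow_const _).mul hg)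
  have e : ∀ a, w a ^ (1 / 2 : ℝ) * w a ^ (1 / 2 : ℝ) = w a := fun a => by
    rw [← ENNReal.rpow_add_of_nonneg _ _ (by norm_num) (by norm_num)]; norm_num
  simp only [← mul_assoc, mul_pow, e, sq (w _ ^ (1 / 2 : ℝ))] at h
  exact h

lemma enorm_cv_le {d : ℕ} (K h : Ed d → ℂ) (x : Ed d) :
    ‖cv K h x‖ₑ ≤ ∫⁻ z, ‖K (x - z)‖ₑ * ‖h z‖ₑ := by
  refine (enorm_integral_le_lintegral_enorm _).trans (le_of_eq ?_)
  simp only [enorm_mul]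

lemma lintegral_sub_left {d : ℕ} (g : Ed d → ℝ≥0∞) (x : Ed d) : ∫⁻ z, g (x - z) = ∫⁻ z, g z :=
  lintegral_sub_left_eq_self g x

lemma lintegral_sub_right {d : ℕ} (g : Ed d → ℝ≥0∞) (x : Ed d) : ∫⁻ z, g (z - x) = ∫⁻ z, g z :=
  lintegral_sub_right_eq_self g x

/-- Young's inequality in `L²`. -/
lemma lintegral_enorm_cv_sq_le {d : ℕ} {K h : Ed d → ℂ} (hK : Measurable K) (hh : Measurable h) :
    ∫⁻ x, ‖cv K h x‖ₑ ^ 2 ≤ (∫⁻ x, ‖K x‖ₑ) ^ 2 * ∫⁻ x, ‖h x‖ₑ ^ 2 := by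
  have hKs : ∀ x, Measurable fun z => ‖K (x - z)‖ₑ := fun x => by fun_prop
  calc ∫⁻ x, ‖cv K h x‖ₑ ^ 2
      ≤ ∫⁻ x, (∫⁻ z, ‖K z‖ₑ) * ∫⁻ z, ‖K (x - z)‖ₑ * ‖h z‖ₑ ^ 2 := by
        refine lintegral_mono fun x => ?_
        refine (pow_le_pow_left' (enorm_cv_le K h x) 2).trans ?_
        refine (sq_lintegral_mul_le_weight _ (hKs x).aemeasurable
          hh.enorm.aemeasurable).trans (le_of_eq ?_)
        rw [lintegral_sub_left (fun z => ‖K z‖ₑ)]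
    _ = (∫⁻ z, ‖K z‖ₑ) * ∫⁻ x, ∫⁻ z, ‖K (x - z)‖ₑ * ‖h z‖ₑ ^ 2 := by
        rw [lintegral_const_mul]
        refine Measurable.lintegral_prod_right' (f := fun p : Ed d × Ed d =>
          ‖K (p.1 - p.2)‖ₑ * ‖h p.2‖ₑ ^ 2) ?_
        fun_prop
    _ = (∫⁻ z, ‖K z‖ₑ) * ∫⁻ z, (∫⁻ x, ‖K x‖ₑ) * ‖h z‖ₑ ^ 2 := by
        rw [lintegral_lintegral_swap (by fun_prop)]
        congr 1
        refine lintegral_congr fun z => ?_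
        rw [lintegral_mul_const _ (by fun_prop), lintegral_sub_right (fun x => ‖K x‖ₑ)]
    _ = _ := by
        rw [lintegral_const_mul _ (by fun_prop), sq, mul_assoc]

lemma lintegral_enorm_sq_eq {d : ℕ} {g : Ed d → ℂ} (hg : Integrable fun x => ‖g x‖ ^ 2) :
    ∫⁻ x, ‖g x‖ₑ ^ 2 = ENNReal.ofReal (∫ x, ‖g x‖ ^ 2) := by
  rw [ofReal_integral_eq_lintegral_ofReal hg (.of_forall fun x => by positivity)]
  refine lintegral_congr fun x => ?_
  rw [ENNReal.ofReal_pow (norm_nonneg _), ofReal_norm]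

lemma IsTest.lintegral_enorm_fourier_sq {d : ℕ} {f : Ed d → ℂ} (hf : IsTest f) :
    ∫⁻ ξ, ‖𝓕 f ξ‖ₑ ^ 2 = ∫⁻ x, ‖f x‖ₑ ^ 2 := by
  rw [lintegral_enorm_sq_eq hf.integrable_norm_sq_fourier, hf.integral_norm_sq_fourier,
    lintegral_enorm_sq_eq]
  refine Continuous.integrable_of_hasCompactSupport (hf.continuous.norm.pow 2) ?_
  exact hf.compact.comp_left (g := fun z : ℂ => ‖z‖ ^ 2) (by simp)

lemma lintegral_enorm_cv_sq_eq {d : ℕ} {K h : Ed d → ℂ} (hK : IsTest K) (hh : IsBddCompact h) :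
    ∫⁻ x, ‖cv K h x‖ₑ ^ 2 = ∫⁻ ξ, ‖𝓕 K ξ‖ₑ ^ 2 * ‖𝓕 h ξ‖ₑ ^ 2 := by
  rw [← (hK.convolution hh.integrable.locallyIntegrable hh.compact).lintegral_enorm_fourier_sq]
  simp only [fourier_cv hK.integrable hh.integrable, enorm_mul, mul_pow]

lemma lintegral_enorm_dil {d : ℕ} {r : ℝ} (hr : 0 < r) (f : Ed d → ℂ) :
    ∫⁻ x, ‖dil r f x‖ₑ = ∫⁻ x, ‖f x‖ₑ := by
  simp only [dil, enorm_mul]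
  rw [lintegral_const_mul' _ _ enorm_ne_top]
  have h1 : ∫⁻ x, ‖f (r⁻¹ • x)‖ₑ = ∫⁻ x, ‖f x‖ₑ ∂(Measure.map (r⁻¹ • ·) volume) :=
    ((measurableEmbedding_const_smul₀ (inv_pos.2 hr).ne').lintegral_map (fun x => ‖f x‖ₑ)).symm
  rw [h1, Measure.map_addHaar_smul _ (inv_pos.2 hr).ne', lintegral_smul_measure]
  simp only [finrank_euclideanSpace, Fintype.card_fin]
  rw [smul_eq_mul, ← mul_assoc]
  have e : ‖(((r ^ d)⁻¹ : ℝ) : ℂ)‖ₑ * ENNReal.ofReal |(r⁻¹ ^ d)⁻¹| = 1 := by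
    rw [← ofReal_norm, ← ENNReal.ofReal_mul (norm_nonneg _), Complex.norm_real, Real.norm_eq_abs,
      ← abs_mul, inv_pow, mul_inv_cancel₀ (by positivity)]
    simp
  rw [e, one_mul]

/-- Bessel's inequality for the Fourier transform. -/
lemma exists_lintegral_enorm_fourier_sq_le (d : ℕ) : ∃ C : ℝ≥0∞, C ≠ ∞ ∧
    ∀ h : Ed d → ℂ, IsBddCompact h → ∫⁻ ξ, ‖𝓕 h ξ‖ₑ ^ 2 ≤ C * ∫⁻ x, ‖h x‖ₑ ^ 2 := by
  obtain ⟨η, hη, h1⟩ := exists_isTest_integral_eq_one d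
  refine ⟨(∫⁻ x, ‖η x‖ₑ) ^ 2, ENNReal.pow_ne_top hη.integrable.2.ne, fun h hh => ?_⟩
  have hcont := continuous_fourier_of_integrable hh.integrable
  have hηc := continuous_fourier_of_integrable hη.integrable
  have hη0 : 𝓕 η 0 = 1 := by rw [Real.fourier_eq, ← h1]; simp
  have hlim : ∀ ξ, Tendsto (fun n : ℕ => ‖𝓕 (dil ((1 / 2 : ℝ) ^ n) η) ξ‖ₑ ^ 2 * ‖𝓕 h ξ‖ₑ ^ 2) atTop
      (𝓝 (‖𝓕 h ξ‖ₑ ^ 2)) := by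
    intro ξ
    have h2 : Tendsto (fun n : ℕ => 𝓕 (dil ((1 / 2 : ℝ) ^ n) η) ξ) atTop (𝓝 1) := by
      rw [← hη0, ← zero_smul ℝ ξ]
      simp only [fun n : ℕ => fourier_dil (r := (1 / 2 : ℝ) ^ n) (by positivity) η ξ]
      exact (hηc.tendsto _).comp ((tendsto_pow_atTop_nhds_zero_of_lt_one (by norm_num)
        (by norm_num)).smul_const ξ)
    have h3 := ENNReal.Tendsto.mul_const (b := ‖𝓕 h ξ‖ₑ ^ 2)
      (((ENNReal.continuous_pow 2).tendsto _).comp h2.enorm) (.inr (by finiteness))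
    simpa using h3
  calc ∫⁻ ξ, ‖𝓕 h ξ‖ₑ ^ 2
      = ∫⁻ ξ, liminf (fun n : ℕ => ‖𝓕 (dil ((1 / 2 : ℝ) ^ n) η) ξ‖ₑ ^ 2 * ‖𝓕 h ξ‖ₑ ^ 2) atTop :=
        lintegral_congr fun ξ => (hlim ξ).liminf_eq.symm
    _ ≤ liminf (fun n : ℕ => ∫⁻ ξ, ‖𝓕 (dil ((1 / 2 : ℝ) ^ n) η) ξ‖ₑ ^ 2 * ‖𝓕 h ξ‖ₑ ^ 2) atTop := by
        refine lintegral_liminf_le fun n => ?_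
        have := continuous_fourier_of_integrable (hη.dilate (r := (1 / 2 : ℝ) ^ n)
          (by positivity)).integrable
        fun_prop
    _ ≤ _ := by
        refine liminf_le_of_frequently_le' (.of_forall fun n => ?_)
        rw [← lintegral_enorm_cv_sq_eq (hη.dilate (by positivity)) hh]
        refine (lintegral_enorm_cv_sq_le (hη.dilate (by positivity)).continuous.measurable
          hh.measurable).trans (le_of_eq ?_)
        rw [lintegral_enorm_dil (by positivity)]

/-- The energy of `h` at frequencies of size about `2^{-n}`. -/
def bandEnergy {d : ℕ} (n : ℤ) (h : Ed d → ℂ) : ℝ≥0∞ :=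
  ∫⁻ ξ, ENNReal.ofReal (band ((2 : ℝ) ^ n * ‖ξ‖) ^ 2) * ‖𝓕 h ξ‖ₑ ^ 2

lemma exists_tsum_bandEnergy_le (d : ℕ) : ∃ C : ℝ≥0∞, C ≠ ∞ ∧
    ∀ h : Ed d → ℂ, IsBddCompact h → ∑' n : ℤ, bandEnergy n h ≤ C * ∫⁻ x, ‖h x‖ₑ ^ 2 := by
  obtain ⟨C, hC, hCb⟩ := exists_lintegral_enorm_fourier_sq_le d
  obtain ⟨D, hD, hDb⟩ := exists_tsum_band_le
  refine ⟨D * C, ENNReal.mul_ne_top hD hC, fun h hh => ?_⟩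
  have hcont := continuous_fourier_of_integrable hh.integrable
  have hm := measurable_band
  unfold bandEnergy
  rw [← lintegral_tsum fun n => by fun_prop, mul_assoc]
  refine le_trans ?_ (mul_le_mul_right (hCb h hh) D)
  rw [← lintegral_const_mul _ (by fun_prop)]
  refine lintegral_mono fun ξ => ?_
  rw [ENNReal.tsum_mul_right]
  gcongr
  rcases eq_or_ne ξ 0 with rfl | hξ
  · simp [band]
  · exact hDb _ (norm_pos_iff.2 hξ)

/-! ### Spherical means of smooth kernels -/

lemma sphMean_eq_convolution {d : ℕ} (t : ℝ) (ψ : Ed d → ℂ) :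
    sphMean d t ψ = (fun _ => (1 : ℝ)) ⋆[ContinuousLinearMap.lsmul ℝ ℝ,
      (sphMeas d).map (fun y => t • y)] ψ := by
  ext x
  have hm : Measurable fun y : Ed d => t • y := measurable_const_smul t
  rw [sphMean_eq_integral, convolution]
  by_cases ht : t = 0
  · subst ht
    have : (fun y : Ed d => (0 : ℝ) • y) = fun _ => 0 := by ext; simp
    rw [this, Measure.map_const]
    simp only [zero_smul, sub_zero, integral_const]
    simp [Measure.real]
  · rw [(measurableEmbedding_const_smul₀ ht).integral_map]
    simp

lemma norm_sub_smul_ge {d : ℕ} {t : ℝ} (ht : 0 ≤ t) {y : Ed d} (hy : ‖y‖ = 1) (z : Ed d) :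
    |‖z‖ - t| ≤ ‖z - t • y‖ := by
  have := abs_norm_sub_norm_le z (t • y)
  rwa [norm_smul, hy, mul_one, Real.norm_eq_abs, abs_of_nonneg ht] at this

lemma sphMean_eq_zero {d : ℕ} {ψ : Ed d → ℂ} {R : ℝ} (hR : ∀ x, R < ‖x‖ → ψ x = 0) {t : ℝ}
    (ht : 0 ≤ t) {z : Ed d} (hz : R < |‖z‖ - t|) : sphMean d t ψ z = 0 := by
  rw [sphMean_eq_integral]
  refine integral_eq_zero_of_ae ?_
  filter_upwards [ae_norm_eq_one_sphMeas d] with y hy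
  exact hR _ (hz.trans_le (norm_sub_smul_ge ht hy z))

lemma HasCompactSupport.exists_radius {d : ℕ} {ψ : Ed d → ℂ} (h : HasCompactSupport ψ) :
    ∃ R : ℝ, 1 ≤ R ∧ ∀ x, R < ‖x‖ → ψ x = 0 := by
  obtain ⟨R, hR⟩ := h.isCompact.isBounded.subset_closedBall (0 : Ed d)
  refine ⟨max 1 R, le_max_left _ _, fun x hx => ?_⟩
  by_contra hne
  have := hR (subset_tsupport ψ hne)
  rw [mem_closedBall_zero_iff] at this
  exact absurd (this.trans (le_max_right 1 R)) (not_le.2 hx)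

lemma IsTest.spherical {d : ℕ} (hd : 2 ≤ d) {ψ : Ed d → ℂ} (hψ : IsTest ψ) {t : ℝ} (ht : 0 ≤ t) :
    IsTest (sphMean d t ψ) := by
  have := isProbabilityMeasure_sphMeas hd
  have : IsFiniteMeasure ((sphMeas d).map (fun y => t • y)) := inferInstance
  refine ⟨?_, ?_⟩
  · rw [sphMean_eq_convolution]
    refine hψ.compact.contDiff_convolution_right _ ?_ hψ.contDiff
    exact (integrable_const _).locallyIntegrable
  · obtain ⟨R, -, hR⟩ := hψ.compact.exists_radius
    refine HasCompactSupport.intro (isCompact_closedBall 0 (R + t)) fun z hz => ?_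
    rw [mem_closedBall_zero_iff, not_le] at hz
    exact sphMean_eq_zero hR ht ((by linarith : R < ‖z‖ - t).trans_le (le_abs_self _))

lemma IsTest.norm_le {d : ℕ} {ψ : Ed d → ℂ} (hψ : IsTest ψ) : ∃ M : ℝ, ∀ x, ‖ψ x‖ ≤ M :=
  hψ.continuous.bounded_above_of_compact_support hψ.compact

lemma integrable_prod_sub {d : ℕ} (hd : 2 ≤ d) {ψ h : Ed d → ℂ} {M : ℝ} (hψ : Continuous ψ)
    (hM : ∀ x, ‖ψ x‖ ≤ M) (hh : Integrable h) (t : ℝ) (x : Ed d) :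
    Integrable (fun p : Ed d × Ed d => ψ (x - p.2 - t • p.1) * h p.2)
      ((sphMeas d).prod volume) := by
  have := isProbabilityMeasure_sphMeas hd
  refine (hh.comp_snd (sphMeas d)).bdd_mul (c := M) ?_ (.of_forall fun p => hM _)
  exact Continuous.aestronglyMeasurable (by fun_prop)

lemma sphMean_cv {d : ℕ} (hd : 2 ≤ d) {ψ h : Ed d → ℂ} (hψ : IsTest ψ) (hh : Integrable h)
    (t : ℝ) : sphMean d t (cv ψ h) = cv (sphMean d t ψ) h := by
  have := isProbabilityMeasure_sphMeas hd
  obtain ⟨M, hM⟩ := hψ.norm_le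
  ext x
  rw [sphMean_eq_integral]
  simp only [cv, sphMean_eq_integral]
  simp_rw [← integral_mul_const]
  refine Eq.trans ?_ (integral_integral_swap (integrable_prod_sub hd hψ.continuous hM hh t x))
  simp_rw [sub_right_comm x (t • _)]

lemma fourier_sphMean {d : ℕ} (hd : 2 ≤ d) (i : Fin d) {ψ : Ed d → ℂ} (hψ : IsTest ψ) {t : ℝ}
    (ht : 0 ≤ t) (ξ : Ed d) :
    𝓕 (sphMean d t ψ) ξ = sphProfile i (2 * Real.pi * (t * ‖ξ‖)) * 𝓕 ψ ξ := by
  have := isProbabilityMeasure_sphMeas hd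
  have hInt : Integrable (fun p : Ed d × Ed d =>
      (Real.fourierChar (-inner ℝ p.2 ξ) : ℂ) * ψ (p.2 - t • p.1)) ((sphMeas d).prod volume) := by
    have hc : Continuous fun p : Ed d × Ed d =>
        (Real.fourierChar (-inner ℝ p.2 ξ) : ℂ) * ψ (p.2 - t • p.1) := by
      have h1 := Real.continuous_fourierChar
      have h2 := hψ.continuous
      fun_prop
    rw [integrable_prod_iff hc.aestronglyMeasurable]
    refine ⟨.of_forall fun y => ?_, ?_⟩
    · have := (Real.fourierIntegral_convergent_iff (μ := volume) ξ).2
        (hψ.integrable.comp_sub_right (t • y))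
      simpa only [Circle.smul_def, smul_eq_mul] using this
    · simp only [norm_mul, Circle.norm_coe, one_mul]
      have : ∀ y, ∫ z, ‖ψ (z - t • y)‖ = ∫ z, ‖ψ z‖ := fun y =>
        integral_sub_right_eq_self (fun z => ‖ψ z‖) (t • y)
      simp only [this]
      exact integrable_const _
  rw [Real.fourier_eq]
  simp only [sphMean_eq_integral, Circle.smul_def, smul_eq_mul]
  simp_rw [← integral_const_mul]
  rw [← integral_integral_swap hInt]
  have h1 : ∀ y : Ed d, ∫ z, (Real.fourierChar (-inner ℝ z ξ) : ℂ) * ψ (z - t • y) =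
      (Real.fourierChar (-inner ℝ y (t • ξ)) : ℂ) * 𝓕 ψ ξ := by
    intro y
    rw [← integral_add_right_eq_self _ (t • y), Real.fourier_eq, ← integral_const_mul]
    refine integral_congr_ae (.of_forall fun z => ?_)
    simp only [add_sub_cancel_right, inner_add_left, neg_add, AddChar.map_add_eq_mul,
      Circle.coe_mul, inner_smul_left, inner_smul_right, Circle.smul_def, smul_eq_mul, conj_trivial]
    ring
  simp_rw [h1]
  rw [integral_mul_const, integral_fourierChar_sphMeas i hd, norm_smul, Real.norm_eq_abs,
    abs_of_nonneg ht]

end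

/-! ### `L¹` moduli of continuity -/

lemma lintegral_enorm_comp_sub_sub_le {d : ℕ} {F : Type*} [NormedAddCommGroup F] [NormedSpace ℝ F]
    [CompleteSpace F] {G : Ed d → F} (hG : ContDiff ℝ 1 G) (v : Ed d) :
    ∫⁻ x, ‖G (x - v) - G x‖ₑ ≤ ‖v‖ₑ * ∫⁻ x, ‖fderiv ℝ G x‖ₑ := by
  have hc : Continuous (fderiv ℝ G) := hG.continuous_fderiv one_ne_zero
  have hdiff : ∀ x, G (x - v) - G x = ∫ s in (0 : ℝ)..1, fderiv ℝ G (x - s • v) (-v) := by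
    intro x
    have hder : ∀ s : ℝ, HasDerivAt (fun s : ℝ => G (x - s • v)) (fderiv ℝ G (x - s • v)
        (-v)) s := by
      intro s
      have h1 : HasDerivAt (fun s : ℝ => x - s • v) (-v) s := by
        simpa using ((hasDerivAt_id s).smul_const v).const_sub x
      exact ((hG.differentiable one_ne_zero _).hasFDerivAt).comp_hasDerivAt s h1
    have hcont : Continuous fun s : ℝ => fderiv ℝ G (x - s • v) (-v) := by fun_prop
    rw [intervalIntegral.integral_eq_sub_of_hasDerivAt (fun s _ => hder s)
      (hcont.intervalIntegrable _ _)]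
    simp
  calc ∫⁻ x, ‖G (x - v) - G x‖ₑ
      ≤ ∫⁻ x, ∫⁻ s in Ioc (0 : ℝ) 1, ‖fderiv ℝ G (x - s • v)‖ₑ * ‖v‖ₑ := by
        refine lintegral_mono fun x => ?_
        rw [hdiff, intervalIntegral.integral_of_le zero_le_one]
        refine (enorm_integral_le_lintegral_enorm _).trans (lintegral_mono fun s => ?_)
        have := (fderiv ℝ G (x - s • v)).le_opENorm (-v)
        rwa [enorm_neg] at this
    _ = ∫⁻ s in Ioc (0 : ℝ) 1, ∫⁻ x, ‖fderiv ℝ G (x - s • v)‖ₑ * ‖v‖ₑ := by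
        refine lintegral_lintegral_swap ?_
        have hc2 : Continuous fun p : Ed d × ℝ => ‖fderiv ℝ G (p.1 - p.2 • v)‖ₑ := by fun_prop
        exact (hc2.measurable.mul_const _).aemeasurable
    _ = ∫⁻ s in Ioc (0 : ℝ) 1, ‖v‖ₑ * ∫⁻ x, ‖fderiv ℝ G x‖ₑ := by
        refine lintegral_congr fun s => ?_
        rw [lintegral_mul_const _ (Continuous.measurable (by fun_prop)),
          lintegral_sub_right_eq_self (fun x => ‖fderiv ℝ G x‖ₑ), mul_comm]
    _ = _ := by simp

/-- Integrated first and second differences of a test function. -/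
lemma IsTest.exists_differences_le {d : ℕ} {ψ : Ed d → ℂ} (hψ : IsTest ψ) :
    ∃ C : ℝ≥0∞, C ≠ ∞ ∧ (∀ v, ∫⁻ x, ‖ψ (x - v) - ψ x‖ₑ ≤ C * ‖v‖ₑ) ∧
      ∀ u v, ∫⁻ x, ‖ψ (x - u - v) - ψ (x - u) - (ψ (x - v) - ψ x)‖ₑ ≤ C * ‖u‖ₑ * ‖v‖ₑ := by
  have h2 : ContDiff ℝ 2 ψ := hψ.contDiff.of_le (by norm_cast)
  have h1 : ContDiff ℝ 1 (fderiv ℝ ψ) := h2.fderiv_right (by norm_num)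
  have hfin : ∀ {F : Type} [NormedAddCommGroup F] {g : Ed d → F}, Continuous g →
      HasCompactSupport g → ∫⁻ x, ‖g x‖ₑ ≠ ∞ := fun hg hg' =>
    (hg.integrable_of_hasCompactSupport hg').2.ne
  have c1 := hfin (h2.continuous_fderiv two_ne_zero) (hψ.compact.fderiv ℝ)
  have c2 := hfin (h1.continuous_fderiv one_ne_zero) ((hψ.compact.fderiv ℝ).fderiv ℝ)
  refine ⟨(∫⁻ x, ‖fderiv ℝ ψ x‖ₑ) + ∫⁻ x, ‖fderiv ℝ (fderiv ℝ ψ) x‖ₑ,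
    ENNReal.add_ne_top.2 ⟨c1, c2⟩, fun v => ?_, fun u v => ?_⟩
  · refine (lintegral_enorm_comp_sub_sub_le (h2.of_le (by norm_num)) v).trans ?_
    rw [mul_comm]
    gcongr
    exact le_self_add
  · have hv : ContDiff ℝ 1 fun x => ψ (x - v) - ψ x := by
      have := h2.of_le (by norm_num : (1 : WithTop ℕ∞) ≤ 2)
      exact (this.comp (contDiff_id.sub contDiff_const)).sub this
    have hdv : ∀ x, fderiv ℝ (fun x => ψ (x - v) - ψ x) x = fderiv ℝ ψ (x - v) - fderiv ℝ ψ x := by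
      intro x
      have hd := h2.differentiable two_ne_zero
      have h3 : DifferentiableAt ℝ (fun x => ψ (x - v)) x :=
        (hd _).comp x (differentiableAt_id.sub_const v)
      rw [fderiv_fun_sub h3 (hd x), fderiv_comp_sub]
    refine (lintegral_enorm_comp_sub_sub_le hv u).trans ?_
    simp only [hdv]
    calc ‖u‖ₑ * ∫⁻ x, ‖fderiv ℝ ψ (x - v) - fderiv ℝ ψ x‖ₑ
        ≤ ‖u‖ₑ * (‖v‖ₑ * ∫⁻ x, ‖fderiv ℝ (fderiv ℝ ψ) x‖ₑ) := by
          gcongr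
          exact lintegral_enorm_comp_sub_sub_le h1 v
      _ = (∫⁻ x, ‖fderiv ℝ (fderiv ℝ ψ) x‖ₑ) * ‖u‖ₑ * ‖v‖ₑ := by ring
      _ ≤ _ := by
          gcongr
          exact le_add_self

/-- Rescaled version of `IsTest.exists_differences_le`. -/
lemma IsTest.exists_differences_dil_le {d : ℕ} {ψ : Ed d → ℂ} (hψ : IsTest ψ) :
    ∃ C : ℝ≥0∞, C ≠ ∞ ∧ ∀ r : ℝ, 0 < r →
      (∀ v, ∫⁻ x, ‖dil r ψ (x - v) - dil r ψ x‖ₑ ≤ C * (‖v‖ₑ / ENNReal.ofReal r)) ∧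
      ∀ u v, ∫⁻ x, ‖dil r ψ (x - u - v) - dil r ψ (x - u) - (dil r ψ (x - v) - dil r ψ x)‖ₑ ≤
        C * (‖u‖ₑ / ENNReal.ofReal r) * (‖v‖ₑ / ENNReal.ofReal r) := by
  obtain ⟨C, hC, h1, h2⟩ := hψ.exists_differences_le
  have hn : ∀ {r : ℝ}, 0 < r → ∀ v : Ed d, ‖r⁻¹ • v‖ₑ = ‖v‖ₑ / ENNReal.ofReal r := by
    intro r hr v
    rw [enorm_smul, enorm_inv hr.ne', Real.enorm_eq_ofReal hr.le, mul_comm, ENNReal.div_eq_inv_mul,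
      mul_comm]
  refine ⟨C, hC, fun r hr => ⟨fun v => ?_, fun u v => ?_⟩⟩
  · have := lintegral_enorm_dil hr (fun x => ψ (x - r⁻¹ • v) - ψ x)
    simp only [dil, smul_sub, mul_sub] at this ⊢
    rw [this, ← hn hr]
    exact h1 _
  · have := lintegral_enorm_dil hr
      (fun x => ψ (x - r⁻¹ • u - r⁻¹ • v) - ψ (x - r⁻¹ • u) - (ψ (x - r⁻¹ • v) - ψ x))
    simp only [dil, smul_sub, mul_sub] at this ⊢
    rw [this, ← hn hr, ← hn hr]
    exact h2 _ _

section

open scoped FourierTransform Convolution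

/-! ### Families of increments of spherical kernels -/

/-- The first kernel, followed by the successive differences. -/
def incr {d : ℕ} (t : ℕ → ℝ) (ψ : Ed d → ℂ) : ℕ → Ed d → ℂ
  | 0 => sphMean d (t 0) ψ
  | m + 1 => sphMean d (t (m + 1)) ψ - sphMean d (t m) ψ

/-- The variation operator attached to `incr`. -/
def vop {d : ℕ} (N : ℕ) (t : ℕ → ℝ) (ψ h : Ed d → ℂ) (x : Ed d) : ℝ≥0∞ :=
  ∑ m ∈ Finset.range (N + 1), ‖cv (incr t ψ m) h x‖ₑ

/-- A nondecreasing sequence of radii at least `T`, spread over a range of length `r`. -/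
structure RadiiWindow (t : ℕ → ℝ) (T r : ℝ) : Prop where
  pos : 0 < T
  mono : Monotone t
  ge : T ≤ t 0
  le : ∀ m, t m ≤ t 0 + r

namespace RadiiWindow

variable {t : ℕ → ℝ} {T r : ℝ}

lemma ge' (ht : RadiiWindow t T r) (m : ℕ) : T ≤ t m := ht.ge.trans (ht.mono (Nat.zero_le m))

lemma nonneg (ht : RadiiWindow t T r) (m : ℕ) : 0 ≤ t m := ht.pos.le.trans (ht.ge' m)

lemma sum_le (ht : RadiiWindow t T r) (hr : 0 < r) (N : ℕ) :
    ∑ m ∈ Finset.range N, ENNReal.ofReal ((t (m + 1) - t m) / r) ≤ 1 := by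
  rw [← ENNReal.ofReal_sum_of_nonneg fun m _ =>
    div_nonneg (sub_nonneg.2 (ht.mono (Nat.le_succ m))) hr.le, ← Finset.sum_div,
    Finset.sum_range_sub]
  refine ENNReal.ofReal_le_one.2 ((div_le_one hr).2 ?_)
  linarith [ht.le N]

end RadiiWindow

lemma isTest_incr {d : ℕ} (hd : 2 ≤ d) {ψ : Ed d → ℂ} (hψ : IsTest ψ) {t : ℕ → ℝ} {T r : ℝ}
    (ht : RadiiWindow t T r) (m : ℕ) : IsTest (incr t ψ m) := by
  cases m with
  | zero => exact hψ.spherical hd (ht.nonneg 0)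
  | succ m => exact (hψ.spherical hd (ht.nonneg _)).sub (hψ.spherical hd (ht.nonneg _))

lemma integrable_cv_integrand {d : ℕ} {K h : Ed d → ℂ} (hK : IsTest K) (hh : Integrable h)
    (x : Ed d) : Integrable fun z => K (x - z) * h z := by
  obtain ⟨M, hM⟩ := hK.norm_le
  exact hh.bdd_mul (c := M) (hK.continuous.comp (by fun_prop)).aestronglyMeasurable
    (.of_forall fun z => hM _)

lemma cv_sub_left {d : ℕ} {K K' h : Ed d → ℂ} (hK : IsTest K) (hK' : IsTest K')
    (hh : Integrable h) (x : Ed d) : cv (K - K') h x = cv K h x - cv K' h x := by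
  simp only [cv, Pi.sub_apply, sub_mul]
  exact integral_sub (integrable_cv_integrand hK hh x) (integrable_cv_integrand hK' hh x)

lemma enorm_cv_sphMean_le_vop {d : ℕ} (hd : 2 ≤ d) {ψ h : Ed d → ℂ} (hψ : IsTest ψ)
    (hh : Integrable h) {t : ℕ → ℝ} {T r : ℝ} (ht : RadiiWindow t T r) {i N : ℕ} (hi : i ≤ N)
    (x : Ed d) : ‖cv (sphMean d (t i) ψ) h x‖ₑ ≤ vop N t ψ h x := by
  have key : ‖cv (sphMean d (t i) ψ) h x‖ₑ ≤ vop i t ψ h x := by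
    clear hi
    induction i with
    | zero => simp [vop, incr]
    | succ i ih =>
      rw [vop, Finset.sum_range_succ]
      have h1 := cv_sub_left (hψ.spherical hd (ht.nonneg (i + 1))) (hψ.spherical hd
          (ht.nonneg i)) hh x
      have h2 : cv (sphMean d (t (i + 1)) ψ) h x =
          cv (sphMean d (t i) ψ) h x + cv (incr t ψ (i + 1)) h x := by
        rw [incr, h1]; ring
      rw [h2]
      exact (enorm_add_le _ _).trans (by gcongr; exact ih)
  refine key.trans (Finset.sum_le_sum_of_subset ?_)
  exact Finset.range_mono (by omega)

lemma incr_eq_zero {d : ℕ} {ψ : Ed d → ℂ} {R : ℝ} (hR : ∀ x, R < ‖x‖ → ψ x = 0) {t : ℕ → ℝ}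
    {T r : ℝ} (ht : RadiiWindow t T r) (m : ℕ) {z : Ed d} (hz : R + r < |‖z‖ - t 0|) :
    incr t ψ m z = 0 := by
  have h : ∀ m, sphMean d (t m) ψ z = 0 := by
    intro m
    refine sphMean_eq_zero hR (ht.nonneg m) ?_
    have h1 := ht.le m
    have h2 := ht.mono (Nat.zero_le m)
    have h3 : |‖z‖ - t 0| ≤ |‖z‖ - t m| + |t m - t 0| := abs_sub_le _ _ _
    rw [abs_of_nonneg (by linarith : 0 ≤ t m - t 0)] at h3
    linarith
  cases m with
  | zero => exact h 0
  | succ m => simp [incr, h]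

lemma lintegral_enorm_integral_sphMeas_le {d : ℕ} (hd : 2 ≤ d) {Ψ : Ed d × Ed d → ℂ}
    (hΨ : Continuous Ψ) {B : ℝ≥0∞} (hB : ∀ y, ‖y‖ = 1 → ∫⁻ x, ‖Ψ (x, y)‖ₑ ≤ B) :
    ∫⁻ x, ‖∫ y, Ψ (x, y) ∂(sphMeas d)‖ₑ ≤ B := by
  have := isProbabilityMeasure_sphMeas hd
  calc _ ≤ ∫⁻ x, ∫⁻ y, ‖Ψ (x, y)‖ₑ ∂(sphMeas d) :=
        lintegral_mono fun x => enorm_integral_le_lintegral_enorm _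
    _ = ∫⁻ y, (∫⁻ x, ‖Ψ (x, y)‖ₑ) ∂(sphMeas d) :=
        lintegral_lintegral_swap hΨ.measurable.enorm.aemeasurable
    _ ≤ ∫⁻ y, B ∂(sphMeas d) := by
        refine lintegral_mono_ae ?_
        filter_upwards [ae_norm_eq_one_sphMeas d] with y hy using hB y hy
    _ = B := by simp

/-- Smoothness of the increments in `L¹`. -/
lemma IsTest.exists_incr_smooth {d : ℕ} (hd : 2 ≤ d) {ψ : Ed d → ℂ} (hψ : IsTest ψ) :
    ∃ C : ℝ≥0∞, C ≠ ∞ ∧ ∀ (t : ℕ → ℝ) (T r : ℝ), 0 < r → RadiiWindow t T r → ∀ (N : ℕ)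
        (z z' : Ed d),
      ∑ m ∈ Finset.range (N + 1), ∫⁻ x, ‖incr t (_root_.dil r ψ) m (x - z) -
        incr t (_root_.dil r ψ) m (x - z')‖ₑ ≤ C * (‖z - z'‖ₑ / ENNReal.ofReal r) := by
  obtain ⟨C, hC, hCb⟩ := hψ.exists_differences_dil_le
  refine ⟨C * 2, ENNReal.mul_ne_top hC (by norm_num), fun t T r hr ht N z z' => ?_⟩
  obtain ⟨h1, h2⟩ := hCb r hr
  have hc : Continuous (_root_.dil r ψ) := (hψ.dilate hr).continuous
  set g := _root_.dil r ψ with hg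
  set v := z - z' with hv
  have hshift : ∀ F : Ed d → ℂ, ∫⁻ x, ‖F (x - z) - F (x - z')‖ₑ = ∫⁻ x, ‖F (x - v) - F x‖ₑ := by
    intro F
    rw [← lintegral_sub_right (fun x => ‖F (x - v) - F x‖ₑ) z']
    simp only [hv, sub_sub, add_sub_cancel]
  simp only [hshift]
  have hInt : ∀ (s : ℝ) (x : Ed d), Integrable (fun y => g (x - s • y)) (sphMeas d) := fun s x =>
    Continuous.integrable_sphMeas hd (by fun_prop)
  have hm0 : ∫⁻ x, ‖incr t g 0 (x - v) - incr t g 0 x‖ₑ ≤ C * (‖v‖ₑ / ENNReal.ofReal r) := by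
    have e : ∀ x, incr t g 0 (x - v) - incr t g 0 x =
        ∫ y, (g (x - v - t 0 • y) - g (x - t 0 • y)) ∂(sphMeas d) := by
      intro x
      rw [integral_sub (hInt _ _) (hInt _ _)]
      simp only [incr, sphMean_eq_integral]
    simp only [e]
    refine lintegral_enorm_integral_sphMeas_le hd
      (Ψ := fun p => g (p.1 - v - t 0 • p.2) - g (p.1 - t 0 • p.2)) (by fun_prop) fun y _ => ?_
    have := lintegral_sub_right (fun x => ‖g (x - v) - g x‖ₑ) (t 0 • y)
    simp only [sub_right_comm _ v]
    rw [this]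
    exact h1 v
  have hm1 : ∀ m, ∫⁻ x, ‖incr t g (m + 1) (x - v) - incr t g (m + 1) x‖ₑ ≤
      C * (‖v‖ₑ / ENNReal.ofReal r) * ENNReal.ofReal ((t (m + 1) - t m) / r) := by
    intro m
    have hle : 0 ≤ t (m + 1) - t m := sub_nonneg.2 (ht.mono (Nat.le_succ m))
    have e : ∀ x, incr t g (m + 1) (x - v) - incr t g (m + 1) x =
        ∫ y, (g (x - v - t (m + 1) • y) - g (x - v - t m • y) -
          (g (x - t (m + 1) • y) - g (x - t m • y))) ∂(sphMeas d) := by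
      intro x
      have hi : ∀ x : Ed d, Integrable (fun y => g (x - t (m + 1) • y) - g (x - t m • y))
          (sphMeas d) := fun x => (hInt _ _).sub (hInt _ _)
      rw [integral_sub (hi _) (hi _), integral_sub (hInt _ _) (hInt _ _),
        integral_sub (hInt _ _) (hInt _ _)]
      simp only [incr, sphMean_eq_integral, Pi.sub_apply]
    simp only [e]
    refine lintegral_enorm_integral_sphMeas_le hd (Ψ := fun p => g (p.1 - v - t (m + 1) • p.2) -
      g (p.1 - v - t m • p.2) - (g (p.1 - t (m + 1) • p.2) - g (p.1 - t m • p.2)))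
      (by fun_prop) fun y hy => ?_
    have h3 := lintegral_sub_right (fun x => ‖g (x - v - (t (m + 1) - t m) • y) - g (x - v) -
      (g (x - (t (m + 1) - t m) • y) - g x)‖ₑ) (t m • y)
    have e2 : ∀ x, x - v - t (m + 1) • y = x - t m • y - v - (t (m + 1) - t m) • y := fun x => by
      rw [sub_smul]; abel
    have e3 : ∀ x, x - t (m + 1) • y = x - t m • y - (t (m + 1) - t m) • y := fun x => by
      rw [sub_smul]; abel
    have e4 : ∀ x, x - v - t m • y = x - t m • y - v := fun x => sub_right_comm _ _ _
    simp only [e2, e3, e4]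
    rw [h3]
    refine (h2 _ _).trans (le_of_eq ?_)
    rw [enorm_smul, ← ofReal_norm y, hy, ENNReal.ofReal_one, mul_one, Real.enorm_eq_ofReal hle,
      ENNReal.ofReal_div_of_pos hr]
  rw [Finset.sum_range_succ']
  calc _ ≤ ∑ m ∈ Finset.range N, C * (‖v‖ₑ / ENNReal.ofReal r) *
          ENNReal.ofReal ((t (m + 1) - t m) / r) + C * (‖v‖ₑ / ENNReal.ofReal r) :=
        add_le_add (Finset.sum_le_sum fun m _ => hm1 m) hm0
    _ ≤ C * (‖v‖ₑ / ENNReal.ofReal r) * 1 + C * (‖v‖ₑ / ENNReal.ofReal r) := by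
        rw [← Finset.mul_sum]
        gcongr
        exact ht.sum_le hr N
    _ = _ := by ring

/-! ### The variation operator in `L²` -/

lemma lintegral_sum_sq_le {α : Type*} [MeasurableSpace α] {μ : Measure α} (f : ℕ → α → ℝ≥0∞)
    (hf : ∀ m, Measurable (f m)) (δ : ℕ → ℝ≥0∞) (X : ℝ≥0∞) (N : ℕ)
    (h : ∀ m < N, ∫⁻ x, f m x ^ 2 ∂μ ≤ δ m ^ 2 * X) :
    ∫⁻ x, (∑ m ∈ Finset.range N, f m x) ^ 2 ∂μ ≤ (∑ m ∈ Finset.range N, δ m) ^ 2 * X := by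
  have key : ∀ n ≤ N, (∫⁻ x, (∑ m ∈ Finset.range n, f m x) ^ (2 : ℝ) ∂μ) ^ (1 / 2 : ℝ) ≤
      (∑ m ∈ Finset.range n, δ m) * X ^ (1 / 2 : ℝ) := by
    intro n hn
    induction n with
    | zero => simp
    | succ n ih =>
      have h1 := ENNReal.lintegral_Lp_add_le (μ := μ) (p := 2)
        (f := fun x => ∑ m ∈ Finset.range n, f m x) (g := f n)
        (Finset.measurable_sum _ fun m _ => hf m).aemeasurable (hf n).aemeasurable (by norm_num)
      simp only [Pi.add_apply] at h1
      simp only [Finset.sum_range_succ]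
      refine h1.trans ?_
      rw [add_mul]
      refine add_le_add (ih (by omega)) ?_
      have h2 := ENNReal.rpow_le_rpow (h n (by omega)) (by norm_num : (0 : ℝ) ≤ 1 / 2)
      rw [ENNReal.mul_rpow_of_nonneg _ _ (by norm_num), ← ENNReal.rpow_natCast, ← ENNReal.rpow_mul]
        at h2
      simpa using h2
  have h2 := ENNReal.rpow_le_rpow (key N le_rfl) (by norm_num : (0 : ℝ) ≤ 2)
  rw [ENNReal.mul_rpow_of_nonneg _ _ (by norm_num), ← ENNReal.rpow_mul, ← ENNReal.rpow_mul] at h2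
  simpa using h2

/-- The relative size of the increments. -/
def incrSize (t : ℕ → ℝ) (r : ℝ) : ℕ → ℝ
  | 0 => 1
  | m + 1 => (t (m + 1) - t m) / r

lemma RadiiWindow.incrSize_nonneg {t : ℕ → ℝ} {T r : ℝ} (ht : RadiiWindow t T r) (hr : 0 < r) :
    ∀ m, 0 ≤ incrSize t r m
  | 0 => zero_le_one
  | m + 1 => div_nonneg (sub_nonneg.2 (ht.mono (Nat.le_succ m))) hr.le

lemma RadiiWindow.sum_incrSize_le {t : ℕ → ℝ} {T r : ℝ} (ht : RadiiWindow t T r) (hr : 0 < r)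
    (N : ℕ) : ∑ m ∈ Finset.range (N + 1), ENNReal.ofReal (incrSize t r m) ≤ 2 := by
  rw [Finset.sum_range_succ']
  calc _ ≤ (1 : ℝ≥0∞) + 1 := add_le_add (ht.sum_le hr N) (by simp [incrSize])
    _ = 2 := by norm_num

lemma div_pow_aux {ρ r T b : ℝ} (hρ : 0 < ρ) (hT : 0 < T) (k : ℕ) {u C : ℝ}
    {s : ℝ} (hs : T * ρ ≤ s) (hu0 : 0 ≤ u) (hu : s ^ k * u ≤ C) (hb : 0 ≤ b) :
    u * ((r * ρ) ^ k * b) ≤ C * ((r / T) ^ k * b) ∨ r < 0 := by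
  rcases lt_or_ge r 0 with h | hr
  · exact Or.inr h
  left
  have h1 : (T * ρ) ^ k * u ≤ C :=
    (mul_le_mul_of_nonneg_right (pow_le_pow_left₀ (by positivity) hs k) hu0).trans hu
  have e : u * ((r * ρ) ^ k * b) = ((T * ρ) ^ k * u) * ((r / T) ^ k * b) := by
    rw [div_pow, mul_pow, mul_pow]; field_simp
  rw [e]
  exact mul_le_mul_of_nonneg_right h1 (by positivity)

lemma exists_fourier_incr_le {d : ℕ} (hd : 2 ≤ d) {ψ : Ed d → ℂ} (hψ : IsTest ψ) {B : ℝ}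
    (hB : ∀ ξ, ξ ≠ 0 → (1 + ‖ξ‖ ^ 2) * ‖𝓕 ψ ξ‖ ^ 2 ≤ B ^ 2 * (‖ξ‖ ^ (d - 1) * band ‖ξ‖ ^ 2)) :
    ∃ C : ℝ, 0 ≤ C ∧ ∀ (t : ℕ → ℝ) (T r : ℝ), 0 < r → RadiiWindow t T r → ∀ m ξ, ξ ≠ 0 →
      ‖𝓕 (incr t (dil r ψ) m) ξ‖ ^ 2 ≤
        C * (incrSize t r m ^ 2 * ((r / T) ^ (d - 1) * band (r * ‖ξ‖) ^ 2)) := by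
  let i : Fin d := ⟨0, by omega⟩
  obtain ⟨D, hD, hD0, hD1⟩ := exists_sphProfile_decay hd i
  refine ⟨(2 * Real.pi) ^ 2 * D ^ 2 * B ^ 2, by positivity, fun t T r hr ht m ξ hξ => ?_⟩
  have hπ : 1 ≤ 2 * Real.pi := by linarith [Real.pi_gt_three]
  have hρ : 0 < ‖ξ‖ := norm_pos_iff.2 hξ
  have hg := hψ.dilate hr
  have hrξ : ‖r • ξ‖ = r * ‖ξ‖ := by rw [norm_smul, Real.norm_of_nonneg hr.le]
  have hBr := hB (r • ξ) (smul_ne_zero hr.ne' hξ)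
  rw [hrξ] at hBr
  set a := ‖𝓕 ψ (r • ξ)‖ with ha
  set b := band (r * ‖ξ‖) ^ 2 with hb
  have hb0 : 0 ≤ b := sq_nonneg _
  have ht0 := ht.pos
  have hsm : ∀ m, T * ‖ξ‖ ≤ 2 * Real.pi * (t m * ‖ξ‖) := fun m => by
    have h1 := ht.ge' m
    have h2 : T * ‖ξ‖ ≤ t m * ‖ξ‖ := by gcongr
    have h3 : 0 ≤ t m * ‖ξ‖ := mul_nonneg (ht.nonneg m) hρ.le
    nlinarith
  have hspos : ∀ m, 0 < 2 * Real.pi * (t m * ‖ξ‖) := fun m => lt_of_lt_of_le (by positivity) (hsm m)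
  cases m with
  | zero =>
    rw [incr, fourier_sphMean hd i hg (ht.nonneg 0), fourier_dil hr, norm_mul, mul_pow,
      Complex.norm_real, Real.norm_eq_abs, sq_abs, ← ha]
    set u := sphProfile i (2 * Real.pi * (t 0 * ‖ξ‖)) ^ 2 with hu
    have h1 : a ^ 2 ≤ B ^ 2 * ((r * ‖ξ‖) ^ (d - 1) * b) := by nlinarith [sq_nonneg ((r * ‖ξ‖) * a)]
    have h2 := (div_pow_aux (r := r) hρ ht.pos (d - 1) (hsm 0) (sq_nonneg _)
      (hD0 _ (hspos 0)) hb0).resolve_right hr.le.not_gt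
    calc u * a ^ 2 ≤ u * (B ^ 2 * ((r * ‖ξ‖) ^ (d - 1) * b)) := by gcongr
      _ = B ^ 2 * (u * ((r * ‖ξ‖) ^ (d - 1) * b)) := by ring
      _ ≤ B ^ 2 * (D ^ 2 * ((r / T) ^ (d - 1) * b)) := by gcongr
      _ ≤ (2 * Real.pi) ^ 2 * (B ^ 2 * (D ^ 2 * ((r / T) ^ (d - 1) * b))) :=
          le_mul_of_one_le_left (by positivity) (one_le_pow₀ hπ)
      _ = _ := by simp [incrSize]; ring
  | succ m =>
    have hle := ht.mono (Nat.le_succ m)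
    have hsub : 𝓕 (incr t (dil r ψ) (m + 1)) ξ =
        𝓕 (sphMean d (t (m + 1)) (dil r ψ)) ξ - 𝓕 (sphMean d (t m) (dil r ψ)) ξ := by
      rw [incr, fourier_sub_apply (hg.spherical hd (ht.nonneg _)).integrable
        (hg.spherical hd (ht.nonneg _)).integrable]
    rw [hsub, fourier_sphMean hd i hg (ht.nonneg _), fourier_sphMean hd i hg (ht.nonneg _),
      fourier_dil hr, ← sub_mul, norm_mul, mul_pow, ← Complex.ofReal_sub,
      Complex.norm_real, Real.norm_eq_abs, sq_abs, ← ha]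
    have hst : 2 * Real.pi * (t m * ‖ξ‖) ≤ 2 * Real.pi * (t (m + 1) * ‖ξ‖) := by gcongr
    have h0 := sphProfile_sub_sq_le hd i hD1 (hspos m) hst
    set u := (sphProfile i (2 * Real.pi * (t (m + 1) * ‖ξ‖)) -
      sphProfile i (2 * Real.pi * (t m * ‖ξ‖))) ^ 2 with hu
    have h1 : r ^ 2 * ‖ξ‖ ^ 2 * a ^ 2 ≤ B ^ 2 * ((r * ‖ξ‖) ^ (d - 1) * b) := by
      nlinarith [sq_nonneg a]
    have h2 := (div_pow_aux (r := r) hρ ht.pos (d - 1) (hsm m) (sq_nonneg _)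
      h0 hb0).resolve_right hr.le.not_gt
    have h3 : u * (r ^ 2 * ‖ξ‖ ^ 2 * a ^ 2) ≤
        B ^ 2 * (D ^ 2 * (2 * Real.pi * (t (m + 1) * ‖ξ‖) - 2 * Real.pi * (t m * ‖ξ‖)) ^ 2 *
          ((r / T) ^ (d - 1) * b)) := by
      calc _ ≤ u * (B ^ 2 * ((r * ‖ξ‖) ^ (d - 1) * b)) := by gcongr
        _ = B ^ 2 * (u * ((r * ‖ξ‖) ^ (d - 1) * b)) := by ring
        _ ≤ _ := by gcongr
    have h4 : 0 < r ^ 2 * ‖ξ‖ ^ 2 := by positivity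
    refine le_of_mul_le_mul_left ?_ h4
    calc _ = u * (r ^ 2 * ‖ξ‖ ^ 2 * a ^ 2) := by ring
      _ ≤ _ := h3
      _ = _ := by simp only [incrSize]; field_simp

lemma measurable_enorm_cv_incr {d : ℕ} (hd : 2 ≤ d) {ψ h : Ed d → ℂ} (hψ : IsTest ψ) {t : ℕ → ℝ}
    {T r : ℝ} (ht : RadiiWindow t T r) (hh : IsBddCompact h) (m : ℕ) :
    Measurable fun x => ‖cv (incr t ψ m) h x‖ₑ :=
  ((isTest_incr hd hψ ht m).convolution hh.integrable.locallyIntegrable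
    hh.compact).continuous.measurable.enorm

lemma measurable_vop {d : ℕ} (hd : 2 ≤ d) {ψ h : Ed d → ℂ} (hψ : IsTest ψ) {t : ℕ → ℝ}
    {T r : ℝ} (ht : RadiiWindow t T r) (hh : IsBddCompact h) (N : ℕ) :
    Measurable (vop N t ψ h) :=
  Finset.measurable_sum _ fun m _ => measurable_enorm_cv_incr hd hψ ht hh m

/-- The `L²` bound for the variation operator. -/
lemma exists_lintegral_vop_sq_le {d : ℕ} (hd : 2 ≤ d) {ψ : Ed d → ℂ} (hψ : IsTest ψ) {B : ℝ}
    (hB : ∀ ξ, ξ ≠ 0 → (1 + ‖ξ‖ ^ 2) * ‖𝓕 ψ ξ‖ ^ 2 ≤ B ^ 2 * (‖ξ‖ ^ (d - 1) * band ‖ξ‖ ^ 2)) :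
    ∃ C : ℝ≥0∞, C ≠ ∞ ∧ ∀ (n : ℤ) (t : ℕ → ℝ) (T : ℝ), RadiiWindow t T (2 ^ n) →
      ∀ (N : ℕ) (h : Ed d → ℂ), IsBddCompact h →
      ∫⁻ x, vop N t (dil (2 ^ n) ψ) h x ^ 2 ≤
        C * ENNReal.ofReal ((2 ^ n / T) ^ (d - 1)) * bandEnergy n h := by
  obtain ⟨C, hC, hCb⟩ := exists_fourier_incr_le hd hψ hB
  refine ⟨4 * ENNReal.ofReal C, ENNReal.mul_ne_top (by norm_num) (by simp),
    fun n t T ht N h hh => ?_⟩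
  have hr : (0 : ℝ) < 2 ^ n := by positivity
  have : Nontrivial (Ed d) := by
    have : Nonempty (Fin d) := ⟨⟨0, by omega⟩⟩
    infer_instance
  have hT := ht.pos
  have key : ∀ m < N + 1, ∫⁻ x, ‖cv (incr t (dil (2 ^ n) ψ) m) h x‖ₑ ^ 2 ≤
      ENNReal.ofReal (incrSize t (2 ^ n) m) ^ 2 *
        (ENNReal.ofReal C * ENNReal.ofReal ((2 ^ n / T) ^ (d - 1)) * bandEnergy n h) := by
    intro m _
    rw [lintegral_enorm_cv_sq_eq (isTest_incr hd (hψ.dilate hr) ht m) hh, bandEnergy,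
      ← mul_assoc, ← ENNReal.ofReal_mul hC, ← ENNReal.ofReal_pow (ht.incrSize_nonneg hr m),
      ← ENNReal.ofReal_mul (by positivity), ← lintegral_const_mul' _ _ (by simp)]
    refine lintegral_mono_ae ?_
    have hne : ∀ᵐ ξ : Ed d, ξ ≠ 0 := by simp [ae_iff]
    filter_upwards [hne] with ξ hξ
    rw [← mul_assoc, ← ENNReal.ofReal_mul (by positivity)]
    gcongr
    rw [← ofReal_norm, ← ENNReal.ofReal_pow (norm_nonneg _)]
    refine ENNReal.ofReal_le_ofReal ((hCb t T _ hr ht m ξ hξ).trans (le_of_eq (by ring)))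
  have := lintegral_sum_sq_le _
    (fun m => measurable_enorm_cv_incr hd (hψ.dilate hr) ht hh m) _ _ (N + 1) key
  refine this.trans ?_
  calc _ ≤ (2 : ℝ≥0∞) ^ 2 * _ := by gcongr; exact ht.sum_incrSize_le hr N
    _ = _ := by ring

end

section

open scoped Function

/-! ### Dyadic cubes -/

/-- The index of the dyadic cube of side `2 ^ l` containing a point. -/
def cubeIdx {d : ℕ} (l : ℤ) (x : Ed d) : Fin d → ℤ := fun i => ⌊x i / 2 ^ l⌋

/-- The dyadic cube of side `2 ^ l` with a given index. -/
def cube {d : ℕ} (l : ℤ) (v : Fin d → ℤ) : Set (Ed d) := cubeIdx l ⁻¹' {v}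

/-- The corner of a dyadic cube. -/
def cubeCorner {d : ℕ} (l : ℤ) (v : Fin d → ℤ) : Ed d := WithLp.toLp 2 fun i => 2 ^ l * v i

lemma measurable_cubeIdx {d : ℕ} (l : ℤ) : Measurable (cubeIdx (d := d) l) :=
  measurable_pi_lambda _ fun i => Int.measurable_floor.comp
    (((EuclideanSpace.proj (𝕜 := ℝ) i).continuous.measurable).div_const _)

lemma measurableSet_cube {d : ℕ} (l : ℤ) (v : Fin d → ℤ) : MeasurableSet (cube l v) :=
  measurable_cubeIdx l (measurableSet_singleton v)

lemma mem_cube_iff {d : ℕ} {l : ℤ} {v : Fin d → ℤ} {x : Ed d} :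
    x ∈ cube l v ↔ ∀ i, x i ∈ Ico ((2 : ℝ) ^ l * v i) (2 ^ l * v i + 2 ^ l) := by
  have h2 : (0 : ℝ) < 2 ^ l := by positivity
  simp only [cube, mem_preimage, mem_singleton_iff, funext_iff, cubeIdx, Int.floor_eq_iff, mem_Ico]
  refine forall_congr' fun i => ?_
  rw [le_div_iff₀ h2, div_lt_iff₀ h2, add_mul, one_mul, mul_comm (v i : ℝ)]

lemma pairwise_disjoint_cube (d : ℕ) (l : ℤ) :
    Pairwise (Disjoint on (cube l : (Fin d → ℤ) → Set (Ed d))) :=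
  fun _ _ h => (disjoint_singleton.2 h).preimage _

lemma iUnion_cube (d : ℕ) (l : ℤ) : ⋃ v, cube (d := d) l v = univ :=
  eq_univ_of_forall fun x => mem_iUnion.2 ⟨cubeIdx l x, rfl⟩

lemma volume_cube {d : ℕ} (l : ℤ) (v : Fin d → ℤ) :
    volume (cube l v) = ENNReal.ofReal (2 ^ l) ^ d := by
  have h : cube l v = WithLp.ofLp ⁻¹' (Set.pi univ fun i => Ico ((2 : ℝ) ^ l * v i)
      (2 ^ l * v i + 2 ^ l)) := by
    ext x
    simp [mem_cube_iff]
  rw [h, (PiLp.volume_preserving_ofLp (Fin d)).measure_preimage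
    (MeasurableSet.univ_pi fun i => measurableSet_Ico).nullMeasurableSet, Real.volume_pi_Ico]
  simp

lemma norm_sub_cubeCorner_le {d : ℕ} {l : ℤ} {v : Fin d → ℤ} {x : Ed d} (hx : x ∈ cube l v) :
    ‖x - cubeCorner l v‖ ≤ d * 2 ^ l := by
  have h2 : (0 : ℝ) < 2 ^ l := by positivity
  rw [mem_cube_iff] at hx
  rw [EuclideanSpace.norm_eq]
  refine Real.sqrt_le_iff.2 ⟨by positivity, ?_⟩
  calc ∑ i, ‖(x - cubeCorner l v) i‖ ^ 2 ≤ ∑ _i : Fin d, ((2 : ℝ) ^ l) ^ 2 := by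
        refine Finset.sum_le_sum fun i _ => ?_
        have := hx i
        rw [mem_Ico] at this
        rw [Real.norm_eq_abs, sq_abs]
        refine pow_le_pow_left₀ ?_ ?_ 2 <;> simp [cubeCorner] <;> linarith
    _ = d * ((2 : ℝ) ^ l) ^ 2 := by simp
    _ ≤ (d : ℝ) ^ 2 * ((2 : ℝ) ^ l) ^ 2 := by
        gcongr
        exact_mod_cast Nat.le_self_pow two_ne_zero d
    _ = _ := by ring

lemma norm_sub_le_of_mem_cube {d : ℕ} {l : ℤ} {v : Fin d → ℤ} {x y : Ed d} (hx : x ∈ cube l v)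
    (hy : y ∈ cube l v) : ‖x - y‖ ≤ 2 * d * 2 ^ l := by
  have h1 := norm_sub_cubeCorner_le hx
  have h2 := norm_sub_cubeCorner_le hy
  have h3 := norm_sub_le_norm_sub_add_norm_sub x (cubeCorner l v) y
  rw [norm_sub_rev (cubeCorner l v)] at h3
  linarith

lemma cubeIdx_eq_of_le {d : ℕ} {l l' : ℤ} (h : l ≤ l') {x y : Ed d}
    (hxy : cubeIdx l x = cubeIdx l y) : cubeIdx l' x = cubeIdx l' y := by
  obtain ⟨n, rfl⟩ := Int.le.dest h
  have key : ∀ z : Ed d, ∀ i, cubeIdx (l + n) z i = cubeIdx l z i / (2 : ℤ) ^ n := by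
    intro z i
    simp only [cubeIdx]
    have := Int.floor_div_natCast (z i / 2 ^ l) (2 ^ n)
    rw [zpow_add₀ two_ne_zero, ← div_div]
    push_cast at this
    exact_mod_cast this
  ext i
  rw [key, key, hxy]

lemma enorm_cv_le_tsum {d : ℕ} {ι : Type*} [Countable ι] {K h : Ed d → ℂ} (hK : IsTest K)
    (hh : Integrable h) {Q : ι → Set (Ed d)} (hQ : ∀ v, MeasurableSet (Q v))
    (hdisj : Pairwise (Disjoint on Q)) (hsupp : ∀ x ∉ ⋃ v, Q v, h x = 0) (x : Ed d) :
    ‖cv K h x‖ₑ ≤ ∑' v, ‖cv K ((Q v).indicator h) x‖ₑ := by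
  have hi := integrable_cv_integrand hK hh x
  have e : cv K h x = ∫ z in ⋃ v, Q v, K (x - z) * h z := by
    rw [setIntegral_eq_integral_of_forall_compl_eq_zero]
    · rfl
    · intro z hz
      rw [hsupp z hz, mul_zero]
  have h1 := hasSum_integral_iUnion hQ hdisj hi.integrableOn
  rw [e, ← h1.tsum_eq]
  refine enorm_tsum_le_tsum_enorm.trans (le_of_eq ?_)
  refine tsum_congr fun v => ?_
  rw [← integral_indicator (hQ v), cv]
  congr 2
  ext z
  by_cases hz : z ∈ Q v <;> simp [hz]

lemma vop_le_tsum {d : ℕ} (hd : 2 ≤ d) {ι : Type*} [Countable ι] {ψ h : Ed d → ℂ} (hψ : IsTest ψ)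
    (hh : Integrable h) {t : ℕ → ℝ} {T r : ℝ} (ht : RadiiWindow t T r)
    {Q : ι → Set (Ed d)} (hQ : ∀ v, MeasurableSet (Q v))
    (hdisj : Pairwise (Disjoint on Q)) (hsupp : ∀ x ∉ ⋃ v, Q v, h x = 0) (N : ℕ) (x : Ed d) :
    vop N t ψ h x ≤ ∑' v, vop N t ψ ((Q v).indicator h) x := by
  simp only [vop]
  rw [Summable.tsum_finsetSum fun _ _ => ENNReal.summable]
  exact Finset.sum_le_sum fun m _ => enorm_cv_le_tsum (isTest_incr hd hψ ht m) hh hQ hdisj hsupp x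

/-! ### The variation operator on functions with cancellation on dyadic cubes -/

lemma exists_volume_annulus_le {d : ℕ} (hd : 0 < d) :
    ∃ C : ℝ≥0∞, C ≠ ∞ ∧ ∀ (z : Ed d) (a w : ℝ), 0 ≤ a → 0 ≤ w →
    volume {x : Ed d | |‖x - z‖ - a| ≤ w} ≤ C * ENNReal.ofReal ((a + w) ^ (d - 1) * w) := by
  refine ⟨ENNReal.ofReal (2 * (d + 1)) * volume (ball (0 : Ed d) 1),
    ENNReal.mul_ne_top ENNReal.ofReal_ne_top measure_ball_lt_top.ne, fun z a w ha hw => ?_⟩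
  have hfr : Module.finrank ℝ (Ed d) = d := by simp
  have hball : ∀ ρ, 0 ≤ ρ → volume (closedBall z ρ) =
      ENNReal.ofReal (ρ ^ d) * volume (ball (0 : Ed d) 1) := fun ρ hρ => by
    rw [Measure.addHaar_closedBall _ _ hρ, hfr]
  have : Nonempty (Fin d) := ⟨⟨0, hd⟩⟩
  have : Nontrivial (Ed d) := inferInstance
  have key : ∀ b, 0 ≤ b → a - w ≤ b → a + w - b ≤ 2 * w → b ≤ a + w →
      (a + w) ^ d - b ^ d ≤ 2 * (d + 1) * ((a + w) ^ (d - 1) * w) := by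
    intro b hb0 hb1 hb2 hb3
    have h := abs_pow_sub_pow_le (a + w) b d
    rw [abs_of_nonneg (by linarith : 0 ≤ a + w - b), abs_of_nonneg (by linarith : 0 ≤ a + w),
      abs_of_nonneg hb0, max_eq_left hb3] at h
    have hX : 0 ≤ (a + w) ^ (d - 1) := by positivity
    calc _ ≤ _ := le_abs_self _
      _ ≤ _ := h
      _ ≤ 2 * w * (d + 1) * (a + w) ^ (d - 1) := by gcongr; linarith
      _ = _ := by ring
  have hsub : {x : Ed d | |‖x - z‖ - a| ≤ w} ⊆ closedBall z (a + w) := fun x hx => by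
    rw [mem_ofPred_eq, abs_le] at hx
    rw [mem_closedBall, dist_eq_norm]; linarith
  rcases le_total a w with h | h
  · refine (measure_mono hsub).trans ?_
    rw [hball _ (by linarith), mul_right_comm, ← ENNReal.ofReal_mul (by positivity)]
    gcongr
    have := key 0 le_rfl (by linarith) (by linarith) (by linarith)
    rwa [zero_pow hd.ne', sub_zero] at this
  · have hsub2 : {x : Ed d | |‖x - z‖ - a| ≤ w} ⊆ closedBall z (a + w) \ ball z (a - w) :=
      fun x hx => ⟨hsub hx, fun h2 => by
        rw [mem_ofPred_eq, abs_le] at hx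
        rw [mem_ball, dist_eq_norm] at h2; linarith⟩
    refine (measure_mono hsub2).trans ?_
    rw [measure_sdiff (ball_subset_closedBall.trans (closedBall_subset_closedBall (by linarith)))
      measurableSet_ball.nullMeasurableSet measure_ball_lt_top.ne, hball _ (by linarith),
      Measure.addHaar_ball volume z (r := a - w) (by linarith), hfr, mul_right_comm,
      ← ENNReal.ofReal_mul (by positivity), ← ENNReal.sub_mul fun _ _ => measure_ball_lt_top.ne,
      ← ENNReal.ofReal_sub _ (by apply pow_nonneg; linarith)]
    gcongr
    exact key _ (by linarith) le_rfl (by linarith) (by linarith)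

/-- A bounded function carried by a union of dyadic cubes, with mean zero on every dyadic cube. -/
structure IsCubeAtom {d : ℕ} (l : ℤ) (S : Set (Ed d)) (H : ℝ≥0∞) (h : Ed d → ℂ) : Prop where
  bdd : IsBddCompact h
  measurableSet : MeasurableSet S
  saturated : ∀ x y : Ed d, cubeIdx l x = cubeIdx l y → x ∈ S → y ∈ S
  le : ∀ x, ‖h x‖ₑ ≤ S.indicator (fun _ => H) x
  mean : ∀ v, ∫ x in cube l v, h x = 0

namespace IsCubeAtom

variable {d : ℕ} {l : ℤ} {S : Set (Ed d)} {H : ℝ≥0∞} {h : Ed d → ℂ}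

lemma lintegral_le (hh : IsCubeAtom l S H h) : ∫⁻ x, ‖h x‖ₑ ≤ H * volume S := by
  refine (lintegral_mono hh.le).trans ?_
  rw [lintegral_indicator_const hh.measurableSet]

lemma lintegral_sq_le (hh : IsCubeAtom l S H h) : ∫⁻ x, ‖h x‖ₑ ^ 2 ≤ H ^ 2 * volume S := by
  rw [← lintegral_indicator_const hh.measurableSet]
  refine lintegral_mono fun x => ?_
  have := hh.le x
  by_cases hx : x ∈ S
  · simp only [hx, indicator_of_mem] at this ⊢
    gcongr
  · simp only [hx, not_false_eq_true, indicator_of_notMem, nonpos_iff_eq_zero] at this ⊢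
    simp [this]

/-- The corner of the dyadic cube containing a point. -/
lemma measurable_corner : Measurable fun z : Ed d => cubeCorner (d := d) l (cubeIdx l z) :=
  (measurable_of_countable fun v : Fin d → ℤ => (cubeCorner l v : Ed d)).comp (measurable_cubeIdx l)

lemma cv_eq (hh : IsCubeAtom l S H h) {K : Ed d → ℂ} (hK : IsTest K) (x : Ed d) :
    cv K h x = ∫ z, (K (x - z) - K (x - cubeCorner l (cubeIdx l z))) * h z := by
  have hi := integrable_cv_integrand hK hh.bdd.integrable x
  obtain ⟨M, hM⟩ := hK.norm_le
  have hi2 : Integrable fun z => K (x - cubeCorner l (cubeIdx l z)) * h z :=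
    hh.bdd.integrable.bdd_mul (c := M) (hK.continuous.measurable.comp
      (measurable_const.sub measurable_corner)).aestronglyMeasurable (.of_forall fun z => hM _)
  have h0 : ∫ z, K (x - cubeCorner l (cubeIdx l z)) * h z = 0 := by
    rw [← setIntegral_univ, ← iUnion_cube d l,
      integral_iUnion (measurableSet_cube l) (pairwise_disjoint_cube d l) hi2.integrableOn]
    refine (tsum_congr fun v => ?_).trans tsum_zero
    rw [setIntegral_congr_fun (g := fun z => K (x - cubeCorner l v) * h z) (measurableSet_cube l v),
      integral_const_mul, hh.mean, mul_zero]
    intro z hz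
    have hz : cubeIdx l z = v := hz
    simp only [hz]
  simp only [sub_mul]
  rw [integral_sub hi hi2, h0, sub_zero, cv]

/-- Cancellation gain at scales coarser than the cubes. -/
lemma exists_lintegral_vop_le_fine (hd : 2 ≤ d) {ψ : Ed d → ℂ} (hψ : IsTest ψ) :
    ∃ C : ℝ≥0∞, C ≠ ∞ ∧ ∀ (l : ℤ) (S : Set (Ed d)) (H : ℝ≥0∞) (h : Ed d → ℂ), IsCubeAtom l S H h →
      ∀ (t : ℕ → ℝ) (T r : ℝ), 0 < r → RadiiWindow t T r → ∀ N : ℕ,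
      ∫⁻ x, vop N t (dil r ψ) h x ≤ C * ENNReal.ofReal (2 ^ l / r) * (H * volume S) := by
  obtain ⟨C, hC, hCb⟩ := hψ.exists_incr_smooth hd
  refine ⟨C * d, ENNReal.mul_ne_top hC (by simp), fun l S H h hh t T r hr ht N => ?_⟩
  have hK := fun m => isTest_incr hd (hψ.dilate hr) ht m
  have hm0 : ∀ m, Measurable fun p : Ed d × Ed d => ‖incr t (dil r ψ) m (p.1 - p.2) -
      incr t (dil r ψ) m (p.1 - cubeCorner l (cubeIdx l p.2))‖ₑ := fun m => by
    have h1 := (hK m).continuous.measurable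
    have h2 := measurable_corner (d := d) (l := l)
    exact ((h1.comp (measurable_fst.sub measurable_snd)).sub
      (h1.comp (measurable_fst.sub (h2.comp measurable_snd)))).enorm
  have hm : ∀ m, Measurable fun p : Ed d × Ed d => ‖incr t (dil r ψ) m (p.1 - p.2) -
      incr t (dil r ψ) m (p.1 - cubeCorner l (cubeIdx l p.2))‖ₑ * ‖h p.2‖ₑ := fun m =>
    (hm0 m).mul (hh.bdd.measurable.comp measurable_snd).enorm
  have hm2 : ∀ m z, Measurable fun x : Ed d => ‖incr t (dil r ψ) m (x - z) -
      incr t (dil r ψ) m (x - cubeCorner l (cubeIdx l z))‖ₑ := fun m z => by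
    have := (hK m).continuous
    exact Continuous.measurable (by fun_prop)
  calc ∫⁻ x, vop N t (dil r ψ) h x
      ≤ ∫⁻ x, ∑ m ∈ Finset.range (N + 1), ∫⁻ z, ‖incr t (dil r ψ) m (x - z) -
          incr t (dil r ψ) m (x - cubeCorner l (cubeIdx l z))‖ₑ * ‖h z‖ₑ := by
        refine lintegral_mono fun x => Finset.sum_le_sum fun m _ => ?_
        rw [hh.cv_eq (hK m)]
        refine (enorm_integral_le_lintegral_enorm _).trans (le_of_eq ?_)
        simp only [enorm_mul]
    _ = ∑ m ∈ Finset.range (N + 1), ∫⁻ z, (∫⁻ x, ‖incr t (dil r ψ) m (x - z) -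
          incr t (dil r ψ) m (x - cubeCorner l (cubeIdx l z))‖ₑ) * ‖h z‖ₑ := by
        rw [lintegral_finsetSum _ fun m _ => (hm m).lintegral_prod_right']
        refine Finset.sum_congr rfl fun m _ => ?_
        rw [lintegral_lintegral_swap (hm m).aemeasurable]
        refine lintegral_congr fun z => ?_
        dsimp only
        exact lintegral_mul_const _ (hm2 m z)
    _ = ∫⁻ z, (∑ m ∈ Finset.range (N + 1), ∫⁻ x, ‖incr t (dil r ψ) m (x - z) -
          incr t (dil r ψ) m (x - cubeCorner l (cubeIdx l z))‖ₑ) * ‖h z‖ₑ := by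
        simp only [Finset.sum_mul]
        exact (lintegral_finsetSum _ fun m _ =>
          (hm0 m).lintegral_prod_left'.mul hh.bdd.measurable.enorm).symm
    _ ≤ ∫⁻ z, C * d * ENNReal.ofReal (2 ^ l / r) * ‖h z‖ₑ := by
        refine lintegral_mono fun z => ?_
        gcongr
        refine (hCb t T r hr ht N _ _).trans ?_
        rw [mul_assoc]
        gcongr
        rw [ENNReal.ofReal_div_of_pos hr, ← mul_div_assoc]
        gcongr
        rw [← ofReal_norm, ← ENNReal.ofReal_natCast, ← ENNReal.ofReal_mul (by positivity)]
        exact ENNReal.ofReal_le_ofReal (norm_sub_cubeCorner_le rfl)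
    _ = C * d * ENNReal.ofReal (2 ^ l / r) * ∫⁻ z, ‖h z‖ₑ :=
        lintegral_const_mul _ hh.bdd.measurable.enorm
    _ ≤ _ := by gcongr; exact hh.lintegral_le

end IsCubeAtom

end

section

open scoped Function FourierTransform

/-- The rate of decay of the off-diagonal estimates. -/
def decayRate : ℝ := √2⁻¹

lemma decayRate_pos : 0 < decayRate := Real.sqrt_pos.2 (by norm_num)

lemma decayRate_sq : decayRate ^ 2 = 2⁻¹ := Real.sq_sqrt (by norm_num)

lemma decayRate_lt_one : decayRate < 1 := by
  rw [decayRate, Real.sqrt_lt' one_pos]; norm_num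

lemma decayRate_pow_sq (m : ℤ) : (decayRate ^ m.natAbs) ^ 2 = 2 ^ (-|m|) := by
  rw [← pow_mul, mul_comm, pow_mul, decayRate_sq, Int.abs_eq_natAbs, zpow_neg, zpow_natCast,
      inv_pow]

lemma IsBddCompact.indicator {d : ℕ} {h : Ed d → ℂ} (hh : IsBddCompact h) {S : Set (Ed d)}
    (hS : MeasurableSet S) : IsBddCompact (S.indicator h) := by
  obtain ⟨H, hH⟩ := hh.bounded
  refine ⟨hh.measurable.indicator hS, ⟨H, fun x => (norm_indicator_le_norm_self _ _).trans (hH x)⟩,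
    hh.compact.mono' ?_⟩
  rw [support_indicator]
  exact inter_subset_right.trans (subset_tsupport h)

lemma bandEnergy_le {d : ℕ} (hd : 0 < d) (n : ℤ) (h : Ed d → ℂ) :
    bandEnergy n h ≤ ∫⁻ ξ, ‖𝓕 h ξ‖ₑ ^ 2 := by
  have : Nonempty (Fin d) := ⟨⟨0, hd⟩⟩
  refine lintegral_mono_ae ?_
  have hne : ∀ᵐ ξ : Ed d, ξ ≠ 0 := by simp [ae_iff]
  filter_upwards [hne] with ξ hξ
  have hξ : 0 < ‖ξ‖ := norm_pos_iff.2 hξ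
  refine mul_le_of_le_one_left' (ENNReal.ofReal_le_one.2 (pow_le_one₀ (band_nonneg
      (by positivity)) ?_))
  exact band_le_one _

lemma vop_eq_zero {d : ℕ} {ψ h : Ed d → ℂ} {R : ℝ} (hR : ∀ x, R < ‖x‖ → ψ x = 0) {t : ℕ → ℝ}
    {T r : ℝ} (ht : RadiiWindow t T r) (N : ℕ) {x : Ed d}
    (hx : ∀ z, h z ≠ 0 → R + r < |‖x - z‖ - t 0|) : vop N t ψ h x = 0 := by
  refine Finset.sum_eq_zero fun m _ => ?_
  rw [enorm_eq_zero]
  refine integral_eq_zero_of_ae (.of_forall fun z => ?_)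
  by_cases hz : h z = 0
  · simp [hz]
  · simp [incr_eq_zero hR ht m (hx z hz)]

lemma dil_eq_zero {d : ℕ} {ψ : Ed d → ℂ} {R : ℝ} (hR : ∀ x, R < ‖x‖ → ψ x = 0) {r : ℝ} (hr : 0 < r)
    (x : Ed d) (hx : R * r < ‖x‖) : dil r ψ x = 0 := by
  rw [dil, hR, mul_zero]
  rw [norm_smul, norm_inv, Real.norm_of_nonneg hr.le, ← div_eq_inv_mul, lt_div_iff₀ hr]
  exact hx

/-- Decay of the variation operator on a single cube coarser than its smoothing scale. -/
lemma exists_lintegral_vop_cube_le {d : ℕ} (hd : 2 ≤ d) {ψ : Ed d → ℂ} (hψ : IsTest ψ) {B : ℝ}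
    (hB : ∀ ξ, ξ ≠ 0 → (1 + ‖ξ‖ ^ 2) * ‖𝓕 ψ ξ‖ ^ 2 ≤ B ^ 2 * (‖ξ‖ ^ (d - 1) * band ‖ξ‖ ^ 2)) :
    ∃ C : ℝ≥0∞, C ≠ ∞ ∧ ∀ (n l k : ℤ), n ≤ l → l ≤ k → ∀ (v : Fin d → ℤ) (H : ℝ≥0∞) (h : Ed d → ℂ),
      IsBddCompact h → (∀ x ∉ cube l v, h x = 0) → (∀ x, ‖h x‖ₑ ≤ H) →
      ∀ t : ℕ → ℝ, RadiiWindow t (2 ^ k) (2 ^ n) → t 0 ≤ 2 * 2 ^ k → ∀ N : ℕ,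
      ∫⁻ x, vop N t (dil (2 ^ n) ψ) h x ≤
        C * ENNReal.ofReal (decayRate ^ (l - n).natAbs) * (H * volume (cube l v)) := by
  obtain ⟨R, hR1, hR⟩ := hψ.compact.exists_radius
  obtain ⟨C1, hC1, hA⟩ := exists_volume_annulus_le (d := d) (by omega)
  obtain ⟨C2, hC2, hV⟩ := exists_lintegral_vop_sq_le hd hψ hB
  obtain ⟨C3, hC3, hF⟩ := exists_lintegral_enorm_fourier_sq_le d
  set c : ℝ := R + 3 + d with hc
  have hc0 : 0 < c := by positivity
  have hfin : C1 * ENNReal.ofReal (c ^ d) * C2 * C3 ≠ ∞ :=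
    ENNReal.mul_ne_top (ENNReal.mul_ne_top (ENNReal.mul_ne_top hC1 ENNReal.ofReal_ne_top) hC2) hC3
  refine ⟨(C1 * ENNReal.ofReal (c ^ d) * C2 * C3) ^ (1 / 2 : ℝ),
    ENNReal.rpow_ne_top_of_nonneg (by norm_num) hfin,
    fun n l k hnl hlk v H h hh hsupp hH t ht ht0 N => ?_⟩
  have h2n : (0 : ℝ) < 2 ^ n := by positivity
  have h2l : (0 : ℝ) < 2 ^ l := by positivity
  have h2k : (0 : ℝ) < 2 ^ k := by positivity
  have hnl2 : (2 : ℝ) ^ n ≤ 2 ^ l := zpow_le_zpow_right₀ one_le_two hnl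
  have hlk2 : (2 : ℝ) ^ l ≤ 2 ^ k := zpow_le_zpow_right₀ one_le_two hlk
  set w : ℝ := (R + 1 + d) * 2 ^ l with hw
  set A := {x : Ed d | |‖x - cubeCorner l v‖ - t 0| ≤ w} with hAdef
  have hAm : MeasurableSet A := by
    refine (isClosed_le (f := fun x : Ed d => |‖x - cubeCorner l v‖ - t 0|) (g := fun _ => w)
      (by fun_prop) continuous_const).measurableSet
  have hzero : ∀ x ∉ A, vop N t (dil (2 ^ n) ψ) h x = 0 := by
    intro x hx
    refine vop_eq_zero (dil_eq_zero hR h2n) ht N fun z hz => ?_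
    have hzc : z ∈ cube l v := by by_contra h'; exact hz (hsupp z h')
    have h1 := norm_sub_cubeCorner_le hzc
    have h2 : w < |‖x - cubeCorner l v‖ - t 0| := not_le.1 hx
    have h3 : |‖x - cubeCorner l v‖ - t 0| ≤
        |‖x - cubeCorner l v‖ - ‖x - z‖| + |‖x - z‖ - t 0| := abs_sub_le _ _ _
    have h4 : |‖x - cubeCorner l v‖ - ‖x - z‖| ≤ ‖z - cubeCorner l v‖ := by
      refine (abs_norm_sub_norm_le _ _).trans (le_of_eq ?_)
      congr 1; abel
    have h5 : R * 2 ^ n + 2 ^ n ≤ (R + 1) * 2 ^ l := by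
      rw [← add_one_mul]; gcongr
    rw [hw, add_mul _ (d : ℝ)] at h2
    linarith
  have hvol : volume (cube l v) = ENNReal.ofReal (2 ^ l) ^ d := volume_cube l v
  have hCS : (∫⁻ x, vop N t (dil (2 ^ n) ψ) h x) ^ 2 ≤
      volume A * ∫⁻ x, vop N t (dil (2 ^ n) ψ) h x ^ 2 := by
    have h1 := sq_lintegral_mul_le volume (f := A.indicator 1) (g := vop N t (dil (2 ^ n) ψ) h)
      (measurable_one.indicator hAm).aemeasurable
      (measurable_vop hd (hψ.dilate h2n) ht hh N).aemeasurable
    have e1 : ∀ x, A.indicator (1 : Ed d → ℝ≥0∞) x * vop N t (dil (2 ^ n) ψ) h x =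
        vop N t (dil (2 ^ n) ψ) h x := fun x => by
      by_cases hx : x ∈ A
      · simp [hx]
      · simp [hzero x hx]
    have e2 : ∀ x, A.indicator (1 : Ed d → ℝ≥0∞) x ^ 2 = A.indicator 1 x := fun x => by
      by_cases hx : x ∈ A <;> simp [hx]
    simpa only [e1, e2, lintegral_indicator_one hAm] using h1
  have hL2 : ∫⁻ x, ‖h x‖ₑ ^ 2 ≤ H ^ 2 * volume (cube l v) := by
    rw [← lintegral_indicator_const (measurableSet_cube l v)]
    refine lintegral_mono fun x => ?_
    by_cases hx : x ∈ cube l v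
    · simp only [hx, indicator_of_mem]; gcongr; exact hH x
    · simp [hsupp x hx]
  have hvA : volume A ≤ C1 * ENNReal.ofReal (c ^ d * ((2 ^ k) ^ (d - 1) * 2 ^ l)) := by
    refine (hA _ (t 0) w (ht.nonneg 0) (by positivity)).trans ?_
    gcongr C1 * ENNReal.ofReal ?_
    have h1 : t 0 + w ≤ c * 2 ^ k := by
      have : w ≤ (R + 1 + d) * 2 ^ k := by rw [hw]; gcongr
      rw [hc]; linarith
    have h2 : w ≤ c * 2 ^ l := by rw [hw, hc]; gcongr; linarith
    have h3 : c ^ d = c ^ (d - 1) * c := by rw [← pow_succ]; congr 1; omega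
    calc _ ≤ (c * 2 ^ k) ^ (d - 1) * (c * 2 ^ l) := by
          have := ht.nonneg 0
          gcongr
      _ = _ := by rw [mul_pow, h3]; ring
  have hsq : (∫⁻ x, vop N t (dil (2 ^ n) ψ) h x) ^ 2 ≤ C1 * ENNReal.ofReal (c ^ d) * C2 * C3 *
      (ENNReal.ofReal (decayRate ^ (l - n).natAbs) * (H * volume (cube l v))) ^ 2 := by
    calc _ ≤ _ := hCS
      _ ≤ (C1 * ENNReal.ofReal (c ^ d * ((2 ^ k) ^ (d - 1) * 2 ^ l))) *
          (C2 * ENNReal.ofReal ((2 ^ n / 2 ^ k) ^ (d - 1)) *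
            (C3 * (H ^ 2 * volume (cube l v)))) := by
          gcongr
          refine (hV n t _ ht N h hh).trans ?_
          gcongr
          exact (bandEnergy_le (by omega) n h).trans ((hF h hh).trans (by gcongr))
      _ = C1 * ENNReal.ofReal (c ^ d) * C2 * C3 * (ENNReal.ofReal ((2 ^ n) ^ (d - 1) * 2 ^ l) *
            (H ^ 2 * volume (cube l v))) := by
          have : ENNReal.ofReal ((2 ^ k) ^ (d - 1) * 2 ^ l) *
              ENNReal.ofReal ((2 ^ n / 2 ^ k) ^ (d - 1)) =
              ENNReal.ofReal ((2 ^ n) ^ (d - 1) * 2 ^ l) := by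
            rw [← ENNReal.ofReal_mul (by positivity), div_pow]
            congr 1
            field_simp
          rw [← this, ENNReal.ofReal_mul (by positivity)]
          ring
      _ ≤ _ := by
          rw [mul_pow, mul_pow, hvol, ← ENNReal.ofReal_pow h2l.le]
          have : ENNReal.ofReal ((2 ^ n) ^ (d - 1) * 2 ^ l) ≤
              ENNReal.ofReal (decayRate ^ (l - n).natAbs) ^ 2 * ENNReal.ofReal ((2 ^ l) ^ d) := by
            rw [← ENNReal.ofReal_pow (by have := decayRate_pos; positivity),
              ← ENNReal.ofReal_mul (by positivity), decayRate_pow_sq, abs_of_nonneg (by linarith)]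
            refine ENNReal.ofReal_le_ofReal ?_
            have e1 : (2 : ℝ) ^ (-(l - n)) = 2 ^ n / 2 ^ l := by
              rw [neg_sub, zpow_sub₀ two_ne_zero]
            obtain ⟨e, rfl⟩ : ∃ e, d = e + 2 := ⟨d - 2, by omega⟩
            rw [e1]
            simp only [show e + 2 - 1 = e + 1 from rfl]
            calc ((2 : ℝ) ^ n) ^ (e + 1) * 2 ^ l = 2 ^ n * 2 ^ l * (2 ^ n) ^ e := by ring
              _ ≤ 2 ^ n * 2 ^ l * (2 ^ l) ^ e := by gcongr
              _ = _ := by rw [div_mul_eq_mul_div, eq_div_iff h2l.ne']; ring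
          calc _ ≤ C1 * ENNReal.ofReal (c ^ d) * C2 * C3 *
                ((ENNReal.ofReal (decayRate ^ (l - n).natAbs) ^ 2 * ENNReal.ofReal ((2 ^ l) ^ d)) *
                (H ^ 2 * ENNReal.ofReal ((2 ^ l) ^ d))) := by gcongr
            _ = _ := by ring
  refine (ENNReal.pow_le_pow_left_iff two_ne_zero).1 (hsq.trans (le_of_eq ?_))
  have e : ∀ a : ℝ≥0∞, (a ^ (1 / 2 : ℝ)) ^ 2 = a := fun a => by
    rw [← ENNReal.rpow_natCast, ← ENNReal.rpow_mul]; norm_num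
  rw [mul_assoc (_ ^ (1 / 2 : ℝ)), mul_pow (_ ^ (1 / 2 : ℝ)), e]

/-- The off-diagonal `L¹` estimate. -/
lemma exists_lintegral_vop_atom_le {d : ℕ} (hd : 2 ≤ d) {ψ : Ed d → ℂ} (hψ : IsTest ψ) {B : ℝ}
    (hB : ∀ ξ, ξ ≠ 0 → (1 + ‖ξ‖ ^ 2) * ‖𝓕 ψ ξ‖ ^ 2 ≤ B ^ 2 * (‖ξ‖ ^ (d - 1) * band ‖ξ‖ ^ 2)) :
    ∃ C : ℝ≥0∞, C ≠ ∞ ∧ ∀ (n l k : ℤ), l ≤ k → ∀ (S : Set (Ed d)) (H : ℝ≥0∞) (h : Ed d → ℂ),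
      IsCubeAtom l S H h → ∀ t : ℕ → ℝ, RadiiWindow t (2 ^ k) (2 ^ n) → t 0 ≤ 2 * 2 ^ k → ∀ N : ℕ,
      ∫⁻ x, vop N t (dil (2 ^ n) ψ) h x ≤
        C * ENNReal.ofReal (decayRate ^ (l - n).natAbs) * (H * volume S) := by
  obtain ⟨C1, hC1, h1⟩ := IsCubeAtom.exists_lintegral_vop_le_fine hd hψ
  obtain ⟨C2, hC2, h2⟩ := exists_lintegral_vop_cube_le hd hψ hB
  refine ⟨max C1 C2, max_lt hC1.lt_top hC2.lt_top |>.ne, fun n l k hlk S H h hh t ht ht0 N => ?_⟩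
  have h2n : (0 : ℝ) < 2 ^ n := by positivity
  rcases le_total l n with hln | hnl
  · refine (h1 l S H h hh t _ _ h2n ht N).trans ?_
    gcongr
    · exact le_max_left _ _
    · rw [← zpow_sub₀ two_ne_zero]
      have e : (2 : ℝ) ^ (l - n) = (decayRate ^ (l - n).natAbs) ^ 2 := by
        rw [decayRate_pow_sq, abs_of_nonpos (by linarith), neg_neg]
      rw [e]
      have h0 := decayRate_pos.le
      exact pow_le_of_le_one (by positivity) (pow_le_one₀ h0 decayRate_lt_one.le) two_ne_zero
  · have hvm : ∀ v, MeasurableSet (cube (d := d) l v) := measurableSet_cube l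
    calc _ ≤ ∫⁻ x, ∑' v, vop N t (dil (2 ^ n) ψ) ((cube l v).indicator h) x :=
          lintegral_mono fun x => vop_le_tsum hd (hψ.dilate h2n) hh.bdd.integrable ht hvm
            (pairwise_disjoint_cube d l) (by simp [iUnion_cube]) N x
      _ = ∑' v, ∫⁻ x, vop N t (dil (2 ^ n) ψ) ((cube l v).indicator h) x :=
          lintegral_tsum fun v => (measurable_vop hd (hψ.dilate h2n) ht
            (hh.bdd.indicator (hvm v)) N).aemeasurable
      _ ≤ ∑' v, max C1 C2 * ENNReal.ofReal (decayRate ^ (l - n).natAbs) *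
            (H * volume (S ∩ cube l v)) := by
          refine ENNReal.tsum_le_tsum fun v => ?_
          by_cases hv : ∃ x ∈ cube l v, x ∈ S
          · obtain ⟨x, hx, hxS⟩ := hv
            have hsub : cube l v ⊆ S := fun y hy =>
              hh.saturated x y (Eq.trans (show cubeIdx l x = v from hx) (Eq.symm hy)) hxS
            rw [inter_eq_self_of_subset_right hsub]
            refine (h2 n l k hnl hlk v H _ (hh.bdd.indicator (hvm v))
              (fun x hx => indicator_of_notMem hx _) (fun x => ?_) t ht ht0 N).trans ?_
            · refine (enorm_indicator_le_enorm_self _ _).trans ((hh.le x).trans ?_)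
              exact indicator_le_self _ _ _
            · gcongr
              exact le_max_right _ _
          · push Not at hv
            have h0 : (cube l v).indicator h = 0 := by
              ext x
              by_cases hx : x ∈ cube l v
              · have := hh.le x
                simpa [hx, hv x hx] using this
              · simp [hx]
            simp [h0, vop, cv]
      _ = max C1 C2 * ENNReal.ofReal (decayRate ^ (l - n).natAbs) * (H * volume S) := by
          rw [ENNReal.tsum_mul_left, ENNReal.tsum_mul_left,
            ← measure_iUnion (fun v w hvw => ((pairwise_disjoint_cube d l hvw).mono
              inter_subset_right inter_subset_right)) fun v => hh.measurableSet.inter (hvm v),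
            ← inter_iUnion, iUnion_cube, inter_univ]

end

section

open scoped Function

/-! ### Averages over dyadic cubes -/

/-- The set is a union of dyadic cubes of side `2 ^ l`. -/
def IsSaturated {d : ℕ} (l : ℤ) (A : Set (Ed d)) : Prop :=
  ∀ x y : Ed d, cubeIdx l x = cubeIdx l y → x ∈ A → y ∈ A

/-- The average over the dyadic cube of side `2 ^ l` containing a point. -/
def cubeAvg {d : ℕ} (l : ℤ) (f : Ed d → ℂ) (x : Ed d) : ℂ :=
  (((2 : ℝ) ^ l) ^ d)⁻¹ • ∫ y in cube l (cubeIdx l x), f y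

/-- The average of the norm over the dyadic cube of side `2 ^ l` containing a point. -/
def cubeAvgNorm {d : ℕ} (l : ℤ) (f : Ed d → ℂ) (x : Ed d) : ℝ≥0∞ :=
  (∫⁻ y in cube l (cubeIdx l x), ‖f y‖ₑ) / ENNReal.ofReal (2 ^ l) ^ d

section
variable {d : ℕ} {l : ℤ} {f : Ed d → ℂ} {x : Ed d}

lemma IsSaturated.subset_or {A : Set (Ed d)} (hA : IsSaturated l A) (v : Fin d → ℤ) :
    A ∩ cube l v = cube l v ∧ cube l v ⊆ A ∨ A ∩ cube l v = ∅ := by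
  by_cases h : ∃ x ∈ cube l v, x ∈ A
  · left
    obtain ⟨x, hx, hxA⟩ := h
    have : cube l v ⊆ A := fun y hy =>
      hA x y (Eq.trans (show cubeIdx l x = v from hx) (Eq.symm hy)) hxA
    exact ⟨inter_eq_self_of_subset_right this, this⟩
  · right
    push Not at h
    ext x
    simp only [mem_inter_iff, mem_empty_iff_false, iff_false, not_and]
    exact fun hA hx => h x hx hA

lemma IsSaturated.mono {l' : ℤ} (h : l ≤ l') {A : Set (Ed d)} (hA : IsSaturated l' A) :
    IsSaturated l A := fun x y hxy => hA x y (cubeIdx_eq_of_le h hxy)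

lemma IsSaturated.measure_le {A : Set (Ed d)} (hA : IsSaturated l A) (hm : MeasurableSet A)
    {m₁ m₂ : Measure (Ed d)} (h : ∀ v, cube l v ⊆ A → m₁ (cube l v) ≤ m₂ (cube l v)) :
    m₁ A ≤ m₂ A := by
  have e : ∀ m : Measure (Ed d), m A = ∑' v, m (A ∩ cube l v) := fun m => by
    rw [← measure_iUnion (fun v w hvw => ((pairwise_disjoint_cube d l hvw).mono
      inter_subset_right inter_subset_right)) fun v => hm.inter (measurableSet_cube l v),
      ← inter_iUnion, iUnion_cube, inter_univ]
  rw [e m₁, e m₂]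
  refine ENNReal.tsum_le_tsum fun v => ?_
  rcases hA.subset_or v with ⟨h1, h2⟩ | h1
  · rw [h1]; exact h v h2
  · simp [h1]

lemma measurable_cubeAvg (l : ℤ) (f : Ed d → ℂ) : Measurable (cubeAvg l f) :=
  (measurable_of_countable fun v : Fin d → ℤ =>
    (((2 : ℝ) ^ l) ^ d)⁻¹ • ∫ y in cube l v, f y).comp (measurable_cubeIdx l)

lemma measurable_cubeAvgNorm (l : ℤ) (f : Ed d → ℂ) : Measurable (cubeAvgNorm l f) :=
  (measurable_of_countable fun v : Fin d → ℤ =>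
    (∫⁻ y in cube l v, ‖f y‖ₑ) / ENNReal.ofReal (2 ^ l) ^ d).comp (measurable_cubeIdx l)

lemma cubeAvgNorm_congr {l' : ℤ} (h : l ≤ l') {y : Ed d} (hxy : cubeIdx l x = cubeIdx l y) :
    cubeAvgNorm l' f x = cubeAvgNorm l' f y := by
  rw [cubeAvgNorm, cubeAvgNorm, cubeIdx_eq_of_le h hxy]

lemma ofReal_two_zpow_pow_ne (d : ℕ) (l : ℤ) :
    ENNReal.ofReal (2 ^ l) ^ d ≠ 0 ∧ ENNReal.ofReal (2 ^ l) ^ d ≠ ∞ := by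
  have : (0 : ℝ) < 2 ^ l := by positivity
  exact ⟨pow_ne_zero _ (ENNReal.ofReal_pos.2 this).ne', ENNReal.pow_ne_top ENNReal.ofReal_ne_top⟩

lemma cubeAvgNorm_mul_volume {v : Fin d → ℤ} (hx : x ∈ cube l v) :
    cubeAvgNorm l f x * volume (cube l v) = ∫⁻ y in cube l v, ‖f y‖ₑ := by
  have h := ofReal_two_zpow_pow_ne d l
  have hx : cubeIdx l x = v := hx
  rw [volume_cube, cubeAvgNorm, hx, ENNReal.div_mul_cancel h.1 h.2]

lemma enorm_cubeAvg_le (l : ℤ) (f : Ed d → ℂ) (x : Ed d) :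
    ‖cubeAvg l f x‖ₑ ≤ cubeAvgNorm l f x := by
  have h2 : (0 : ℝ) < 2 ^ l := by positivity
  rw [cubeAvg, cubeAvgNorm, enorm_smul, mul_comm, div_eq_mul_inv]
  gcongr
  · exact enorm_integral_le_lintegral_enorm _
  · rw [Real.enorm_eq_ofReal (by positivity), ENNReal.ofReal_inv_of_pos (by positivity),
      ENNReal.ofReal_pow h2.le]

lemma cubeAvgNorm_le_succ (l : ℤ) (f : Ed d → ℂ) (x : Ed d) :
    cubeAvgNorm l f x ≤ 2 ^ d * cubeAvgNorm (l + 1) f x := by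
  have h := ofReal_two_zpow_pow_ne d l
  have hsub : cube l (cubeIdx l x) ⊆ cube (l + 1) (cubeIdx (l + 1) x) := fun y hy =>
    cubeIdx_eq_of_le (by omega) hy
  have e : ENNReal.ofReal (2 ^ (l + 1)) ^ d = 2 ^ d * ENNReal.ofReal (2 ^ l) ^ d := by
    rw [← mul_pow, zpow_add_one₀ two_ne_zero, mul_comm, ENNReal.ofReal_mul zero_le_two]
    simp
  rw [cubeAvgNorm, cubeAvgNorm, e, ENNReal.div_eq_inv_mul, ENNReal.div_eq_inv_mul,
    ENNReal.mul_inv (by simp) (by simp), ← mul_assoc, ← mul_assoc,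
    ENNReal.mul_inv_cancel (by simp) (by simp), one_mul]
  gcongr

lemma cubeAvgNorm_le_of_bound {H : ℝ≥0∞} (hH : ∀ y, ‖f y‖ₑ ≤ H) (l : ℤ) (x : Ed d) :
    cubeAvgNorm l f x ≤ H := by
  have h := ofReal_two_zpow_pow_ne d l
  refine ENNReal.div_le_of_le_mul ?_
  rw [← volume_cube l (cubeIdx l x), ← setLIntegral_const]
  exact lintegral_mono fun y => hH y

lemma exists_cube_subset_ball (x : Ed d) {ε : ℝ} (hε : 0 < ε) :
    ∃ l : ℤ, cube l (cubeIdx l x) ⊆ ball x ε := by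
  obtain ⟨n, hn⟩ := exists_pow_lt_of_lt_one (show 0 < ε / (2 * d + 1) by positivity)
    (show (1 / 2 : ℝ) < 1 by norm_num)
  refine ⟨-n, fun y hy => ?_⟩
  have h := norm_sub_le_of_mem_cube hy (show x ∈ cube (-(n : ℤ)) (cubeIdx (-n) x) from rfl)
  rw [zpow_neg, zpow_natCast, ← inv_pow] at h
  rw [lt_div_iff₀ (by positivity), one_div] at hn
  rw [mem_ball, dist_eq_norm]
  have : (0 : ℝ) < 2⁻¹ ^ n := by positivity
  nlinarith

lemma enorm_le_of_forall_cubeAvgNorm_le (hf : Continuous f) {θ : ℝ≥0∞}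
    (h : ∀ l, cubeAvgNorm l f x ≤ θ) : ‖f x‖ₑ ≤ θ := by
  by_contra! hlt
  obtain ⟨c, hc1, hc2⟩ := exists_between hlt
  obtain ⟨ε, hε, hball⟩ := Metric.isOpen_iff.1 (isOpen_lt continuous_const hf.enorm) x hc2
  obtain ⟨l, hl⟩ := exists_cube_subset_ball x hε
  have h0 := ofReal_two_zpow_pow_ne d l
  have : c ≤ cubeAvgNorm l f x := by
    rw [cubeAvgNorm, ENNReal.le_div_iff_mul_le (Or.inl h0.1) (Or.inl h0.2),
      ← volume_cube l (cubeIdx l x), ← setLIntegral_const]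
    exact setLIntegral_mono' (measurableSet_cube _ _) fun y hy => (hball (hl hy)).le
  exact absurd (this.trans (h l)) (not_le.2 hc1)

lemma IsSaturated.setIntegral_cubeAvg {A : Set (Ed d)} (hA : IsSaturated l A)
    (hm : MeasurableSet A) (hf : Integrable f) (hf' : IntegrableOn (cubeAvg l f) A) :
    ∫ x in A, cubeAvg l f x = ∫ x in A, f x := by
  have e : A = ⋃ v, A ∩ cube l v := by rw [← inter_iUnion, iUnion_cube, inter_univ]
  have hdisj : Pairwise (Disjoint on fun v => A ∩ cube l v) := fun v w hvw =>
    (pairwise_disjoint_cube d l hvw).mono inter_subset_right inter_subset_right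
  have hmv := fun v => hm.inter (measurableSet_cube (d := d) l v)
  rw [e, integral_iUnion hmv hdisj (e ▸ hf'), integral_iUnion hmv hdisj hf.integrableOn]
  refine tsum_congr fun v => ?_
  rcases hA.subset_or v with ⟨h1, h2⟩ | h1
  · rw [h1]
    have h2 : (0 : ℝ) < 2 ^ l := by positivity
    rw [setIntegral_congr_fun (g := fun _ => (((2 : ℝ) ^ l) ^ d)⁻¹ • ∫ y in cube l v, f y)
      (measurableSet_cube l v)]
    · rw [setIntegral_const, smul_smul, measureReal_def, volume_cube, ENNReal.toReal_pow,
        ENNReal.toReal_ofReal h2.le, mul_inv_cancel₀ (by positivity), one_smul]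
    · intro x hx
      have hx : cubeIdx l x = v := hx
      simp only [cubeAvg, hx]
  · simp [h1]

end

/-! ### A multi-level Calderón–Zygmund decomposition -/

/-- The point has an average exceeding `2 ^ μ` over a dyadic cube, and the largest such cube has
side `2 ^ l`. -/
def stopSet {d : ℕ} (f : Ed d → ℂ) (μ l : ℤ) : Set (Ed d) :=
  {x | ENNReal.ofReal (2 ^ μ) < cubeAvgNorm l f x ∧
    ∀ l' > l, cubeAvgNorm l' f x ≤ ENNReal.ofReal (2 ^ μ)}

/-- The set where the dyadic maximal function exceeds `2 ^ μ`. -/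
def big {d : ℕ} (f : Ed d → ℂ) (μ : ℤ) : Set (Ed d) := ⋃ l, stopSet f μ l

open Classical in
/-- The good function of the Calderón–Zygmund decomposition at height `2 ^ μ`. -/
def good {d : ℕ} (f : Ed d → ℂ) (μ : ℤ) (x : Ed d) : ℂ :=
  if h : ∃ l, x ∈ stopSet f μ l then cubeAvg h.choose f x else f x

/-- The difference of two consecutive good functions. -/
def goodDiff {d : ℕ} (f : Ed d → ℂ) (μ : ℤ) (x : Ed d) : ℂ := good f (μ + 1) x - good f μ x

lemma monotone_ofReal_two_zpow : Monotone fun μ : ℤ => ENNReal.ofReal (2 ^ μ) := fun _ _ h =>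
  ENNReal.ofReal_le_ofReal (zpow_le_zpow_right₀ one_le_two h)

section
variable {d : ℕ} {μ l : ℤ} {f : Ed d → ℂ} {x : Ed d}

lemma measurableSet_stopSet (f : Ed d → ℂ) (μ l : ℤ) : MeasurableSet (stopSet f μ l) := by
  have : stopSet f μ l = {x | ENNReal.ofReal (2 ^ μ) < cubeAvgNorm l f x} ∩
      ⋂ l' : ℤ, ⋂ _ : l' > l, {x | cubeAvgNorm l' f x ≤ ENNReal.ofReal (2 ^ μ)} := by
    ext x; simp [stopSet]
  rw [this]
  exact (measurableSet_lt measurable_const (measurable_cubeAvgNorm l f)).inter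
    (MeasurableSet.iInter fun l' => MeasurableSet.iInter fun _ =>
      measurableSet_le (measurable_cubeAvgNorm l' f) measurable_const)

lemma measurableSet_big (f : Ed d → ℂ) (μ : ℤ) : MeasurableSet (big f μ) :=
  MeasurableSet.iUnion fun l => measurableSet_stopSet f μ l

lemma isSaturated_stopSet (f : Ed d → ℂ) (μ l : ℤ) : IsSaturated l (stopSet f μ l) := by
  rintro x y hxy ⟨h1, h2⟩
  exact ⟨cubeAvgNorm_congr le_rfl hxy ▸ h1,
    fun l' hl' => cubeAvgNorm_congr (le_of_lt hl') hxy ▸ h2 l' hl'⟩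

lemma stopSet_level_le {μ' l' : ℤ} (hμ : μ ≤ μ') (hx : x ∈ stopSet f μ l)
    (hx' : x ∈ stopSet f μ' l') :
    l' ≤ l := by
  by_contra! h
  exact absurd ((hx.2 l' h).trans (monotone_ofReal_two_zpow hμ)) (not_le.2 hx'.1)

lemma pairwise_disjoint_stopSet (f : Ed d → ℂ) (μ : ℤ) : Pairwise (Disjoint on stopSet f μ) := by
  intro l l' hll
  refine Set.disjoint_left.2 fun x hx hx' => hll ?_
  exact le_antisymm (stopSet_level_le le_rfl hx' hx) (stopSet_level_le le_rfl hx hx')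

lemma good_eq_of_mem (hx : x ∈ stopSet f μ l) : good f μ x = cubeAvg l f x := by
  have h : ∃ l, x ∈ stopSet f μ l := ⟨l, hx⟩
  have e : h.choose = l := le_antisymm (stopSet_level_le le_rfl hx h.choose_spec)
    (stopSet_level_le le_rfl h.choose_spec hx)
  rw [good, dif_pos h, e]

lemma good_eq_of_notMem (hx : x ∉ big f μ) : good f μ x = f x := by
  rw [good, dif_neg]
  simpa [big] using hx

lemma exists_level_bound (hd : 0 < d) (hf : ∫⁻ x, ‖f x‖ₑ ≠ ∞) (μ : ℤ) :
    ∃ L : ℤ, ∀ l x, ENNReal.ofReal (2 ^ μ) < cubeAvgNorm l f x → l ≤ L := by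
  obtain ⟨N, hN⟩ := pow_unbounded_of_one_lt ((∫⁻ x, ‖f x‖ₑ).toReal / 2 ^ μ)
    (one_lt_two : (1 : ℝ) < 2)
  refine ⟨N, fun l x h => ?_⟩
  by_contra! hl
  have h2μ : (0 : ℝ) < 2 ^ μ := by positivity
  have h0 := ofReal_two_zpow_pow_ne d l
  rw [cubeAvgNorm, ENNReal.lt_div_iff_mul_lt (Or.inl h0.1) (Or.inl h0.2),
    ← ENNReal.ofReal_pow (by positivity), ← ENNReal.ofReal_mul (by positivity)] at h
  have h3 := h.trans_le (setLIntegral_le_lintegral _ _)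
  rw [ENNReal.ofReal_lt_iff_lt_toReal (by positivity) hf] at h3
  rw [div_lt_iff₀ h2μ] at hN
  have h4 : (2 : ℝ) ^ N ≤ (2 ^ l) ^ d := by
    calc (2 : ℝ) ^ N = 2 ^ (N : ℤ) := (zpow_natCast _ _).symm
      _ ≤ 2 ^ l := zpow_le_zpow_right₀ one_le_two hl.le
      _ ≤ (2 ^ l) ^ d := le_self_pow₀ (one_le_zpow₀ one_le_two (by omega)) hd.ne'
  nlinarith

lemma exists_mem_stopSet (hd : 0 < d) (hf : ∫⁻ x, ‖f x‖ₑ ≠ ∞)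
    (h : ENNReal.ofReal (2 ^ μ) < cubeAvgNorm l f x) : ∃ l' ≥ l, x ∈ stopSet f μ l' := by
  obtain ⟨L, hL⟩ := exists_level_bound hd hf μ
  obtain ⟨l', h1, h2⟩ := Int.exists_greatest_of_bdd
    (P := fun l => ENNReal.ofReal (2 ^ μ) < cubeAvgNorm l f x) ⟨L, fun z hz => hL z x hz⟩ ⟨l, h⟩
  refine ⟨l', h2 l h, h1, fun m hm => ?_⟩
  by_contra! h3
  exact absurd (h2 m h3) (not_le.2 hm)

lemma cubeAvgNorm_le_of_notMem_big (hd : 0 < d) (hf : ∫⁻ x, ‖f x‖ₑ ≠ ∞) (hx : x ∉ big f μ)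
    (l : ℤ) : cubeAvgNorm l f x ≤ ENNReal.ofReal (2 ^ μ) := by
  by_contra! h
  obtain ⟨l', -, h'⟩ := exists_mem_stopSet hd hf h
  exact hx (mem_iUnion.2 ⟨l', h'⟩)

lemma big_anti (hd : 0 < d) (hf : ∫⁻ x, ‖f x‖ₑ ≠ ∞) {μ' : ℤ} (hμ : μ ≤ μ') :
    big f μ' ⊆ big f μ := by
  intro x hx
  by_contra h
  obtain ⟨l, hl⟩ := mem_iUnion.1 hx
  exact absurd ((cubeAvgNorm_le_of_notMem_big hd hf h l).trans (monotone_ofReal_two_zpow hμ))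
    (not_le.2 hl.1)

lemma enorm_good_le (hd : 0 < d) (hc : Continuous f) (hf : ∫⁻ x, ‖f x‖ₑ ≠ ∞) (μ : ℤ) (x : Ed d) :
    ‖good f μ x‖ₑ ≤ 2 ^ d * ENNReal.ofReal (2 ^ μ) := by
  by_cases hx : x ∈ big f μ
  · obtain ⟨l, hl⟩ := mem_iUnion.1 hx
    rw [good_eq_of_mem hl]
    refine (enorm_cubeAvg_le l f x).trans ((cubeAvgNorm_le_succ l f x).trans ?_)
    gcongr
    exact hl.2 _ (lt_add_one l)
  · rw [good_eq_of_notMem hx]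
    refine (enorm_le_of_forall_cubeAvgNorm_le hc
      (cubeAvgNorm_le_of_notMem_big hd hf hx)).trans ?_
    exact le_mul_of_one_le_left' (one_le_pow₀ one_le_two)

lemma measurable_good (hc : Continuous f) (μ : ℤ) : Measurable (good f μ) := by
  intro A hA
  have : good f μ ⁻¹' A = ((big f μ)ᶜ ∩ f ⁻¹' A) ∪ ⋃ l, stopSet f μ l ∩ cubeAvg l f ⁻¹' A := by
    ext x
    by_cases hx : x ∈ big f μ
    · obtain ⟨l, hl⟩ := mem_iUnion.1 hx
      simp only [mem_preimage, mem_union, mem_inter_iff, mem_compl_iff, hx, not_true,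
        false_and, false_or, mem_iUnion]
      constructor
      · exact fun h => ⟨l, hl, by rwa [good_eq_of_mem hl] at h⟩
      · rintro ⟨l', hl', h⟩
        rwa [good_eq_of_mem hl']
    · have hx' : ∀ l, x ∉ stopSet f μ l := fun l hl => hx (mem_iUnion.2 ⟨l, hl⟩)
      simp [hx, hx', good_eq_of_notMem hx]
  rw [this]
  exact ((measurableSet_big f μ).compl.inter (hc.measurable hA)).union
    (MeasurableSet.iUnion fun l => (measurableSet_stopSet f μ l).inter (measurable_cubeAvg l f hA))

lemma exists_big_subset_closedBall (hd : 0 < d) (hc : Continuous f) (hs : HasCompactSupport f)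
    (μ : ℤ) : ∃ R, big f μ ⊆ closedBall 0 R := by
  have hf : ∫⁻ x, ‖f x‖ₑ ≠ ∞ := (hc.integrable_of_hasCompactSupport hs).2.ne
  obtain ⟨L, hL⟩ := exists_level_bound hd hf μ
  obtain ⟨R, -, hR⟩ := HasCompactSupport.exists_radius hs
  refine ⟨R + 2 * d * 2 ^ L, fun x hx => ?_⟩
  obtain ⟨l, hl⟩ := mem_iUnion.1 hx
  obtain ⟨y, hy, hfy⟩ : ∃ y ∈ cube l (cubeIdx l x), f y ≠ 0 := by
    by_contra! h
    have h1 := hl.1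
    rw [cubeAvgNorm, setLIntegral_congr_fun (g := fun _ => 0) (measurableSet_cube _ _)
      (fun y hy => by simp [h y hy])] at h1
    simp at h1
  have h1 : ‖y‖ ≤ R := by
    by_contra! h
    exact hfy (hR y h)
  have h2 := norm_sub_le_of_mem_cube (show x ∈ cube l (cubeIdx l x) from rfl) hy
  have h3 : (2 : ℝ) ^ l ≤ 2 ^ L := zpow_le_zpow_right₀ one_le_two (hL l x hl.1)
  rw [mem_closedBall_zero_iff]
  calc ‖x‖ = ‖y + (x - y)‖ := by congr 1; abel
    _ ≤ R + 2 * d * 2 ^ l := (norm_add_le _ _).trans (add_le_add h1 h2)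
    _ ≤ _ := by gcongr

lemma isBddCompact_good (hd : 0 < d) (hc : Continuous f) (hs : HasCompactSupport f)
    (μ : ℤ) : IsBddCompact (good f μ) := by
  have hf : ∫⁻ x, ‖f x‖ₑ ≠ ∞ := (hc.integrable_of_hasCompactSupport hs).2.ne
  obtain ⟨R, hR⟩ := exists_big_subset_closedBall hd hc hs μ
  obtain ⟨R', -, hR'⟩ := HasCompactSupport.exists_radius hs
  refine ⟨measurable_good hc μ, ⟨2 ^ d * 2 ^ μ, fun x => ?_⟩, ?_⟩
  · have h := enorm_good_le hd hc hf μ x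
    rw [← ofReal_norm, show (2 : ℝ≥0∞) ^ d = ENNReal.ofReal (2 ^ d) by
      rw [ENNReal.ofReal_pow zero_le_two]; simp, ← ENNReal.ofReal_mul (by positivity)] at h
    exact (ENNReal.ofReal_le_ofReal_iff (by positivity)).1 h
  · refine HasCompactSupport.intro (isCompact_closedBall (0 : Ed d) (max R R')) fun x hx => ?_
    rw [mem_closedBall_zero_iff, not_le, max_lt_iff] at hx
    rw [good_eq_of_notMem, hR' x hx.2]
    exact fun h => absurd (mem_closedBall_zero_iff.1 (hR h)) (not_le.2 hx.1)

lemma IsBddCompact.sub {g h : Ed d → ℂ} (hg : IsBddCompact g) (hh : IsBddCompact h) :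
    IsBddCompact fun x => g x - h x := by
  obtain ⟨A, hA⟩ := hg.bounded
  obtain ⟨B, hB⟩ := hh.bounded
  exact ⟨hg.measurable.sub hh.measurable,
    ⟨A + B, fun x => (norm_sub_le _ _).trans (add_le_add (hA x) (hB x))⟩,
    hg.compact.sub hh.compact⟩

lemma isBddCompact_goodDiff (hd : 0 < d) (hc : Continuous f) (hs : HasCompactSupport f)
    (μ : ℤ) : IsBddCompact (goodDiff f μ) :=
  (isBddCompact_good hd hc hs (μ + 1)).sub (isBddCompact_good hd hc hs μ)

lemma goodDiff_eq_zero (hd : 0 < d) (hf : ∫⁻ x, ‖f x‖ₑ ≠ ∞) (hx : x ∉ big f μ) :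
    goodDiff f μ x = 0 := by
  rw [goodDiff, good_eq_of_notMem hx, good_eq_of_notMem, sub_self]
  exact fun h => hx (big_anti hd hf (by omega) h)

lemma enorm_goodDiff_le (hd : 0 < d) (hc : Continuous f) (hf : ∫⁻ x, ‖f x‖ₑ ≠ ∞) (μ : ℤ)
    (x : Ed d) : ‖goodDiff f μ x‖ₑ ≤ 3 * 2 ^ d * ENNReal.ofReal (2 ^ μ) := by
  refine enorm_sub_le.trans ((add_le_add (enorm_good_le hd hc hf _ x)
    (enorm_good_le hd hc hf μ x)).trans (le_of_eq ?_))
  rw [zpow_add_one₀ two_ne_zero, mul_comm _ (2 : ℝ), ENNReal.ofReal_mul zero_le_two,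
    ENNReal.ofReal_ofNat]
  ring

lemma setIntegral_good (hd : 0 < d) (hc : Continuous f) (hs : HasCompactSupport f)
    {A : Set (Ed d)} (hm : MeasurableSet A) (hA : IsSaturated l A)
    (h : ∀ l' > l, Disjoint A (stopSet f μ l')) : ∫ x in A, good f μ x = ∫ x in A, f x := by
  have hg := (isBddCompact_good hd hc hs μ).integrable
  have hf : Integrable f := hc.integrable_of_hasCompactSupport hs
  have hgf : Integrable fun x => good f μ x - f x := hg.sub hf
  rw [← sub_eq_zero, ← integral_sub hg.integrableOn hf.integrableOn,
    setIntegral_eq_of_subset_of_forall_sdiff_eq_zero hm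
      (inter_subset_left : A ∩ big f μ ⊆ A) (fun x hx => by
        rw [good_eq_of_notMem fun h => hx.2 ⟨hx.1, h⟩, sub_self]),
    big, inter_iUnion, integral_iUnion (fun l' => hm.inter (measurableSet_stopSet f μ l'))
      (fun v w hvw => (pairwise_disjoint_stopSet f μ hvw).mono inter_subset_right
          inter_subset_right)
      hgf.integrableOn]
  rw [tsum_congr fun l' => ?_, tsum_zero]
  rcases le_or_gt l' l with hl | hl
  · have hm' := hm.inter (measurableSet_stopSet f μ l')
    have e : ∀ x ∈ A ∩ stopSet f μ l', good f μ x = cubeAvg l' f x := fun x hx =>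
      good_eq_of_mem hx.2
    rw [integral_sub hg.integrableOn hf.integrableOn, setIntegral_congr_fun hm' e,
      IsSaturated.setIntegral_cubeAvg _ hm' hf, sub_self]
    · exact (integrableOn_congr_fun e hm').1 hg.integrableOn
    · exact fun x y hxy hx => ⟨hA.mono hl x y hxy hx.1, isSaturated_stopSet f μ l' x y hxy hx.2⟩
  · rw [(h l' hl).inter_eq]; simp

lemma isCubeAtom_goodDiff (hd : 0 < d) (hc : Continuous f) (hs : HasCompactSupport f) (μ l : ℤ) :
    IsCubeAtom l (stopSet f μ l) (3 * 2 ^ d * ENNReal.ofReal (2 ^ μ))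
      ((stopSet f μ l).indicator (goodDiff f μ)) := by
  have hf : ∫⁻ x, ‖f x‖ₑ ≠ ∞ := (hc.integrable_of_hasCompactSupport hs).2.ne
  refine ⟨(isBddCompact_goodDiff hd hc hs μ).indicator (measurableSet_stopSet f μ l),
    measurableSet_stopSet f μ l, isSaturated_stopSet f μ l, fun x => ?_, fun v => ?_⟩
  · by_cases hx : x ∈ stopSet f μ l
    · simpa [hx] using enorm_goodDiff_le hd hc hf μ x
    · simp [hx]
  · rw [setIntegral_indicator (measurableSet_stopSet f μ l), inter_comm]
    rcases (isSaturated_stopSet f μ l).subset_or v with ⟨h1, h2⟩ | h1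
    · rw [h1]
      have hsat : IsSaturated l (cube l v) := fun x y hxy hx => hxy.symm.trans hx
      have hdis : ∀ μ' ≥ μ, ∀ l' > l, Disjoint (cube l v) (stopSet f μ' l') := fun μ' hμ l' hl =>
        Set.disjoint_left.2 fun x hx hx' => absurd (stopSet_level_le hμ (h2 hx) hx') (not_le.2 hl)
      simp only [goodDiff]
      rw [integral_sub (isBddCompact_good hd hc hs _).integrable.integrableOn
        (isBddCompact_good hd hc hs _).integrable.integrableOn,
        setIntegral_good hd hc hs (measurableSet_cube l v) hsat (hdis _ (by omega)),
        setIntegral_good hd hc hs (measurableSet_cube l v) hsat (hdis _ le_rfl), sub_self]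
    · rw [h1]; simp

end

lemma ENNReal.rpow_sub_one_mul_self {a : ℝ≥0∞} (h0 : a ≠ 0) (ht : a ≠ ∞) {p : ℝ} :
    a ^ (p - 1) * a = a ^ p := by
  nth_rewrite 2 [← ENNReal.rpow_one a]
  rw [← ENNReal.rpow_add _ _ h0 ht, sub_add_cancel]

section
variable {d : ℕ} {f : Ed d → ℂ}

lemma cv_sub_right {K g h : Ed d → ℂ} (hK : IsTest K) (hg : Integrable g) (hh : Integrable h)
    (x : Ed d) : cv K (fun z => g z - h z) x = cv K g x - cv K h x := by
  simp only [cv, mul_sub]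
  exact integral_sub (integrable_cv_integrand hK hg x) (integrable_cv_integrand hK hh x)

lemma enorm_cv_le_of_bound (K : Ed d → ℂ) {h : Ed d → ℂ} {H : ℝ≥0∞} (hH : ∀ x, ‖h x‖ₑ ≤ H)
    (hK : Measurable K) (x : Ed d) : ‖cv K h x‖ₑ ≤ (∫⁻ z, ‖K z‖ₑ) * H := by
  refine (enorm_cv_le K h x).trans ?_
  rw [← lintegral_sub_left (fun z => ‖K z‖ₑ) x, ← lintegral_mul_const]
  · exact lintegral_mono fun z => mul_le_mul_right (hH z) _
  · exact (hK.comp (measurable_const.sub measurable_id)).enorm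

lemma enorm_cv_le_tsum_goodDiff (hd : 0 < d) (hc : Continuous f) (hs : HasCompactSupport f)
    {K : Ed d → ℂ} (hK : IsTest K) (x : Ed d) :
    ‖cv K f x‖ₑ ≤ ∑' μ, ‖cv K (goodDiff f μ) x‖ₑ := by
  have hf : ∫⁻ x, ‖f x‖ₑ ≠ ∞ := (hc.integrable_of_hasCompactSupport hs).2.ne
  have hg := fun μ => (isBddCompact_good hd hc hs μ).integrable
  have hstep : ∀ (μ : ℤ) (n : ℕ), ‖cv K (good f (μ + n)) x‖ₑ ≤
      ‖cv K (good f μ) x‖ₑ + ∑ i ∈ Finset.range n, ‖cv K (goodDiff f (μ + i)) x‖ₑ := by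
    intro μ n
    induction n with
    | zero => simp
    | succ n ih =>
      rw [Finset.sum_range_succ, ← add_assoc]
      refine le_trans ?_ (add_le_add_left ih _)
      have e := cv_sub_right hK (hg (μ + n + 1)) (hg (μ + n)) x
      rw [show goodDiff f (μ + n) = fun z => good f (μ + n + 1) z - good f (μ + n) z from rfl, e,
        Nat.cast_succ, ← add_assoc]
      calc ‖cv K (good f (μ + n + 1)) x‖ₑ
          = ‖cv K (good f (μ + n)) x + (cv K (good f (μ + n + 1)) x
              - cv K (good f (μ + n)) x)‖ₑ := by congr 1; ring
        _ ≤ _ := enorm_add_le _ _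
  obtain ⟨M, hM⟩ := hc.bounded_above_of_compact_support hs
  obtain ⟨N, hN⟩ := pow_unbounded_of_one_lt M (one_lt_two : (1 : ℝ) < 2)
  have hgood : good f N = f := by
    funext y
    refine good_eq_of_notMem fun hy => ?_
    obtain ⟨l, hl⟩ := mem_iUnion.1 hy
    refine absurd (cubeAvgNorm_le_of_bound (H := ENNReal.ofReal (2 ^ (N : ℤ))) (fun z => ?_) l y)
      (not_le.2 hl.1)
    rw [← ofReal_norm, zpow_natCast]
    exact ENNReal.ofReal_le_ofReal ((hM z).trans hN.le)
  have hmain : ∀ n : ℕ, ‖cv K f x‖ₑ ≤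
      (∫⁻ z, ‖K z‖ₑ) * (2 ^ d * ENNReal.ofReal (2⁻¹ ^ n)) +
        ∑' μ, ‖cv K (goodDiff f μ) x‖ₑ := by
    intro n
    have h := hstep (-n) (n + N)
    rw [show (-(n : ℤ) + ((n + N : ℕ) : ℤ)) = N by push_cast; ring, hgood] at h
    refine h.trans (add_le_add ?_ ?_)
    · refine enorm_cv_le_of_bound K (fun y => ?_) hK.continuous.measurable x
      refine (enorm_good_le hd hc hf _ y).trans (le_of_eq ?_)
      rw [zpow_neg, zpow_natCast, inv_pow]
    · have hinj : Function.Injective fun i : ℕ => (-(n : ℤ) + i) := fun i j hij => by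
        simpa using hij
      exact (ENNReal.sum_le_tsum _).trans (ENNReal.tsum_comp_le_tsum_of_injective hinj
        fun μ => ‖cv K (goodDiff f μ) x‖ₑ)
  have hlim : Tendsto (fun n : ℕ => (∫⁻ z, ‖K z‖ₑ) * (2 ^ d * ENNReal.ofReal (2⁻¹ ^ n)) +
        ∑' μ, ‖cv K (goodDiff f μ) x‖ₑ) atTop
      (𝓝 ((∫⁻ z, ‖K z‖ₑ) * (2 ^ d * ENNReal.ofReal 0) + ∑' μ, ‖cv K (goodDiff f μ) x‖ₑ)) := by
    refine Tendsto.add_const _ (ENNReal.Tendsto.const_mul (ENNReal.Tendsto.const_mul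
      (ENNReal.tendsto_ofReal (tendsto_pow_atTop_nhds_zero_of_lt_one (by norm_num)
        (by norm_num))) (Or.inr (by finiteness))) (Or.inr hK.integrable.2.ne))
  have := ge_of_tendsto' hlim hmain
  simpa using this

lemma measure_big_le (hc : Continuous f) (μ : ℤ) :
    ENNReal.ofReal (2 ^ (μ - 1)) * volume (big f μ) ≤
      ∫⁻ x, {x | ENNReal.ofReal (2 ^ (μ - 1)) < ‖f x‖ₑ}.indicator (fun x => ‖f x‖ₑ) x := by
  set θ := ENNReal.ofReal (2 ^ (μ - 1)) with hθ
  set g := {x | θ < ‖f x‖ₑ}.indicator (fun x => ‖f x‖ₑ) with hg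
  have hgm : Measurable g := hc.measurable.enorm.indicator
    (measurableSet_lt measurable_const hc.measurable.enorm)
  have hθ2 : ENNReal.ofReal (2 ^ μ) = θ + θ := by
    rw [hθ, ← two_mul, ← ENNReal.ofReal_ofNat, ← ENNReal.ofReal_mul
        (by simp), zpow_sub_one₀ two_ne_zero]
    congr 1
    ring
  have hle : ∀ l, (θ • (volume : Measure (Ed d))) (stopSet f μ l) ≤
      (volume.withDensity g) (stopSet f μ l) := fun l => by
    refine (isSaturated_stopSet f μ l).measure_le (measurableSet_stopSet f μ l) fun v hv => ?_
    have h2 : (0 : ℝ) < 2 ^ l := by positivity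
    have hne : ∃ x, x ∈ cube (d := d) l v := by
      by_contra! h
      have := volume_cube (d := d) l v
      rw [eq_empty_of_forall_notMem h, measure_empty] at this
      exact (ofReal_two_zpow_pow_ne d l).1 this.symm
    obtain ⟨x, hx⟩ := hne
    have h1 := cubeAvgNorm_mul_volume (f := f) hx
    have hfin : θ * volume (cube (d := d) l v) ≠ ∞ := by
      rw [volume_cube]
      exact ENNReal.mul_ne_top ENNReal.ofReal_ne_top (ofReal_two_zpow_pow_ne d l).2
    rw [Measure.smul_apply, smul_eq_mul, withDensity_apply _ (measurableSet_cube l v)]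
    refine (ENNReal.add_le_add_iff_left hfin).1 ?_
    calc θ * volume (cube l v) + θ * volume (cube l v)
        = ENNReal.ofReal (2 ^ μ) * volume (cube l v) := by rw [hθ2, add_mul]
      _ ≤ cubeAvgNorm l f x * volume (cube l v) := by gcongr; exact (hv hx).1.le
      _ = ∫⁻ y in cube l v, ‖f y‖ₑ := h1
      _ ≤ ∫⁻ y in cube l v, (θ + g y) := by
          refine lintegral_mono fun y => ?_
          by_cases hy : θ < ‖f y‖ₑ
          · rw [hg, indicator_of_mem (show y ∈ {x | θ < ‖f x‖ₑ} from hy)]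
            exact le_add_self
          · exact (not_lt.1 hy).trans le_self_add
      _ = θ * volume (cube l v) + ∫⁻ y in cube l v, g y := by
          rw [lintegral_add_left measurable_const, setLIntegral_const]
  calc θ * volume (big f μ) = ∑' l, (θ • (volume : Measure (Ed d))) (stopSet f μ l) := by
        rw [big, measure_iUnion (pairwise_disjoint_stopSet f μ) (measurableSet_stopSet f μ),
          ← ENNReal.tsum_mul_left]
        rfl
    _ ≤ ∑' l, (volume.withDensity g) (stopSet f μ l) := ENNReal.tsum_le_tsum hle
    _ = (volume.withDensity g) (big f μ) :=
        (measure_iUnion (pairwise_disjoint_stopSet f μ) (measurableSet_stopSet f μ)).symm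
    _ ≤ (volume.withDensity g) univ := measure_mono (subset_univ _)
    _ = ∫⁻ x, g x := by simp

lemma exists_tsum_level_le {q : ℝ} (hq : 0 < q) : ∃ C : ℝ≥0∞, C ≠ ∞ ∧ ∀ a : ℝ≥0∞, a ≠ ∞ →
    ∑' μ : ℤ, {a | ENNReal.ofReal (2 ^ (μ - 1)) < a}.indicator
      (fun _ => ENNReal.ofReal (2 ^ μ) ^ q) a ≤ C * a ^ q := by
  have hρ0 : (0 : ℝ) ≤ 2 ^ (-q) := by positivity
  have hρ1 : (2 : ℝ) ^ (-q) < 1 := Real.rpow_lt_one_of_one_lt_of_neg one_lt_two (by linarith)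
  refine ⟨2 ^ q * ∑' n : ℤ, ENNReal.ofReal (((2 : ℝ) ^ (-q)) ^ n.natAbs),
    ENNReal.mul_ne_top (by finiteness) (tsum_ofReal_pow_natAbs_lt_top hρ0 hρ1).ne, fun a ha => ?_⟩
  lift a to ℝ≥0 using ha
  rcases eq_or_ne a 0 with rfl | ha0
  · simp [hq]
  obtain ⟨n, hn1, hn2⟩ := exists_mem_Ico_zpow (show (0 : ℝ) < a by positivity)
    (one_lt_two : (1 : ℝ) < 2)
  rw [← ENNReal.tsum_mul_left, ← ENNReal.tsum_mul_right, ← (Equiv.subLeft (n + 1)).tsum_eq]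
  refine ENNReal.tsum_le_tsum fun μ => ?_
  simp only [Equiv.subLeft_apply]
  rw [indicator_apply]
  split_ifs with h
  · simp only [mem_ofPred_eq] at h
    rw [← ENNReal.ofReal_coe_nnreal, ENNReal.ofReal_lt_ofReal_iff (by positivity)] at h
    have hlt := (zpow_lt_zpow_iff_right₀ (one_lt_two : (1 : ℝ) < 2)).1 (h.trans hn2)
    obtain ⟨m, hm⟩ : ∃ m : ℕ, μ = m := Int.eq_ofNat_of_zero_le (by omega)
    subst hm
    simp only [Int.natAbs_natCast]
    have h2 : (0 : ℝ) < 2 ^ n := by positivity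
    have e : ENNReal.ofReal (((2 : ℝ) ^ (-q)) ^ m) = ENNReal.ofReal (2 ^ (-(m : ℤ))) ^ q := by
      rw [ENNReal.ofReal_rpow_of_pos (by positivity), ← Real.rpow_natCast, ← Real.rpow_mul
          zero_le_two,
        ← Real.rpow_intCast, ← Real.rpow_mul zero_le_two]
      congr 2; push_cast; ring
    rw [e, ← ENNReal.mul_rpow_of_nonneg _ _ hq.le, ← ENNReal.mul_rpow_of_nonneg _ _ hq.le]
    refine ENNReal.rpow_le_rpow ?_ hq.le
    rw [show (n + 1 - m : ℤ) = n + 1 + -m by ring, zpow_add₀ two_ne_zero, zpow_add_one₀ two_ne_zero,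
      ENNReal.ofReal_mul (by positivity), ENNReal.ofReal_mul (by positivity), mul_comm _
          (ENNReal.ofReal 2),
      ENNReal.ofReal_ofNat, mul_right_comm]
    gcongr
    rw [← ENNReal.ofReal_coe_nnreal]
    exact ENNReal.ofReal_le_ofReal hn1
  · exact zero_le

lemma exists_tsum_measure_big_le {p : ℝ} (hp : 1 < p) : ∃ C : ℝ≥0∞, C ≠ ∞ ∧
    ∀ (d : ℕ) (f : Ed d → ℂ), Continuous f →
      ∑' μ : ℤ, ENNReal.ofReal (2 ^ μ) ^ p * volume (big f μ) ≤ C * ∫⁻ x, ‖f x‖ₑ ^ p := by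
  obtain ⟨C, hC, h⟩ := exists_tsum_level_le (sub_pos.2 hp)
  refine ⟨2 * C, by finiteness, fun d f hc => ?_⟩
  have hms := fun μ : ℤ => measurableSet_lt (measurable_const (a := ENNReal.ofReal (2 ^ (μ - 1))))
    hc.measurable.enorm
  calc ∑' μ : ℤ, ENNReal.ofReal (2 ^ μ) ^ p * volume (big f μ)
      ≤ ∑' μ : ℤ, ∫⁻ x, 2 * ({a | ENNReal.ofReal (2 ^ (μ - 1)) < a}.indicator
          (fun _ => ENNReal.ofReal (2 ^ μ) ^ (p - 1)) ‖f x‖ₑ * ‖f x‖ₑ) := by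
        refine ENNReal.tsum_le_tsum fun μ => ?_
        have h2 : (0 : ℝ) < 2 ^ μ := by positivity
        have e : ENNReal.ofReal (2 ^ μ) ^ p = 2 * ENNReal.ofReal (2 ^ μ) ^ (p - 1) *
            ENNReal.ofReal (2 ^ (μ - 1)) := by
          rw [zpow_sub_one₀ two_ne_zero, ENNReal.ofReal_mul h2.le, mul_right_comm, mul_comm 2,
            mul_assoc (ENNReal.ofReal (2 ^ μ)), ← ENNReal.ofReal_ofNat, ← ENNReal.ofReal_mul
                (by simp),
            inv_mul_cancel₀ two_ne_zero, ENNReal.ofReal_one, mul_one, mul_comm,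
            ENNReal.rpow_sub_one_mul_self (ENNReal.ofReal_pos.2 h2).ne' ENNReal.ofReal_ne_top]
        rw [e, mul_assoc]
        refine (mul_le_mul_right (measure_big_le hc μ) _).trans (le_of_eq ?_)
        rw [← lintegral_const_mul _ (hc.measurable.enorm.indicator (hms μ))]
        refine lintegral_congr fun x => ?_
        by_cases hx : ENNReal.ofReal (2 ^ (μ - 1)) < ‖f x‖ₑ
        · simp [indicator, hx, mul_assoc]
        · simp [indicator, hx]
    _ = ∫⁻ x, 2 * ((∑' μ : ℤ, {a | ENNReal.ofReal (2 ^ (μ - 1)) < a}.indicator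
          (fun _ => ENNReal.ofReal (2 ^ μ) ^ (p - 1)) ‖f x‖ₑ) * ‖f x‖ₑ) := by
        rw [← lintegral_tsum fun μ => ?_]
        · simp only [ENNReal.tsum_mul_left, ENNReal.tsum_mul_right]
        · refine ((Measurable.mul ?_ hc.measurable.enorm).const_mul 2).aemeasurable
          exact (measurable_const.indicator measurableSet_Ioi).comp hc.measurable.enorm
    _ ≤ ∫⁻ x, 2 * (C * ‖f x‖ₑ ^ (p - 1) * ‖f x‖ₑ) := by
        gcongr with x
        exact h _ enorm_ne_top
    _ = 2 * C * ∫⁻ x, ‖f x‖ₑ ^ p := by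
        rw [← lintegral_const_mul _ (hc.measurable.enorm.pow_const _)]
        refine lintegral_congr fun x => ?_
        rcases eq_or_ne ‖f x‖ₑ 0 with h0 | h0
        · simp [h0, show 0 < p by linarith]
        · rw [mul_assoc C, ENNReal.rpow_sub_one_mul_self h0 enorm_ne_top, mul_assoc]

end

/-! ### Enlargements of unions of dyadic cubes -/

/-- The translates of a set by integer multiples of `2 ^ l` with coefficients at most `m`. -/
def enlarge {d : ℕ} (m : ℕ) (l : ℤ) (A : Set (Ed d)) : Set (Ed d) :=
  ⋃ w ∈ Fintype.piFinset fun _ : Fin d => Finset.Icc (-(m : ℤ)) m, {x | x + cubeCorner l w ∈ A}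

/-- The union of the enlarged Calderón–Zygmund cubes at height `2 ^ μ`. -/
def bigStar {d : ℕ} (m : ℕ) (f : Ed d → ℂ) (μ : ℤ) : Set (Ed d) :=
  ⋃ l, enlarge m l (stopSet f μ l)

section
variable {d : ℕ} {f : Ed d → ℂ} {x : Ed d}

lemma measurableSet_enlarge (m : ℕ) (l : ℤ) {A : Set (Ed d)} (hA : MeasurableSet A) :
    MeasurableSet (enlarge m l A) :=
  Finset.measurableSet_biUnion _ fun w _ => (measurable_id.add_const (cubeCorner l w)) hA

lemma measure_enlarge_le (m : ℕ) (l : ℤ) (A : Set (Ed d)) :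
    volume (enlarge m l A) ≤ ((2 * m + 1) ^ d : ℕ) * volume A := by
  refine (measure_biUnion_finset_le _ _).trans (le_of_eq ?_)
  simp only [← preimage_ofPred_eq, measure_preimage_add_right, ofPred_mem_eq]
  rw [Finset.sum_const, nsmul_eq_mul]
  congr 2
  simp only [Fintype.card_piFinset, Int.card_Icc, Finset.prod_const, Finset.card_univ,
    Fintype.card_fin]
  congr 1
  omega

lemma IsSaturated.mem_enlarge {l : ℤ} {A : Set (Ed d)} (hA : IsSaturated l A) {m : ℕ} {y : Ed d}
    (hy : y ∈ A) (hxy : ‖x - y‖ ≤ m * 2 ^ l) : x ∈ enlarge (m + 1) l A := by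
  have h2 : (0 : ℝ) < 2 ^ l := by positivity
  simp only [enlarge, mem_iUnion, mem_ofPred_eq, exists_prop, Fintype.mem_piFinset, Finset.mem_Icc]
  refine ⟨fun i => cubeIdx l y i - cubeIdx l x i, fun i => ?_, hA y _ ?_ hy⟩
  · have h1 : |x i / 2 ^ l - y i / 2 ^ l| ≤ m := by
      rw [← sub_div, abs_div, abs_of_pos h2, div_le_iff₀ h2]
      exact (PiLp.norm_apply_le (x - y) i).trans hxy
    rw [abs_le] at h1
    have h3 := Int.floor_le (x i / 2 ^ l)
    have h4 := Int.lt_floor_add_one (x i / 2 ^ l)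
    have h5 := Int.floor_le (y i / 2 ^ l)
    have h6 := Int.lt_floor_add_one (y i / 2 ^ l)
    simp only [cubeIdx]
    constructor
    · rify; linarith
    · rify; linarith
  · funext i
    simp only [cubeIdx, cubeCorner, PiLp.add_apply, Int.cast_sub, add_div]
    rw [mul_div_cancel_left₀ _ h2.ne', ← Int.cast_sub, Int.floor_add_intCast]
    ring

lemma measurableSet_bigStar (m : ℕ) (f : Ed d → ℂ) (μ : ℤ) : MeasurableSet (bigStar m f μ) :=
  MeasurableSet.iUnion fun l => measurableSet_enlarge m l (measurableSet_stopSet f μ l)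

lemma measure_bigStar_le (m : ℕ) (f : Ed d → ℂ) (μ : ℤ) :
    volume (bigStar m f μ) ≤ ((2 * m + 1) ^ d : ℕ) * volume (big f μ) := by
  rw [big, measure_iUnion (pairwise_disjoint_stopSet f μ) (measurableSet_stopSet f μ),
    ← ENNReal.tsum_mul_left]
  exact (measure_iUnion_le _).trans (ENNReal.tsum_le_tsum fun l => measure_enlarge_le m l _)

lemma lt_norm_sub_of_notMem_bigStar {m : ℕ} {μ k l : ℤ} (hkl : k ≤ l)
    (hx : x ∉ bigStar (m + 1) f μ) {y : Ed d} (hy : y ∈ stopSet f μ l) : m * 2 ^ k < ‖x - y‖ := by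
  by_contra! h
  refine hx (mem_iUnion.2 ⟨l, (isSaturated_stopSet f μ l).mem_enlarge hy (h.trans ?_)⟩)
  gcongr
  exact one_le_two

lemma vop_goodDiff_le (hd : 2 ≤ d) (hc : Continuous f) (hs : HasCompactSupport f) {ψ : Ed d → ℂ}
    (hψ : IsTest ψ) {R : ℝ} (hR0 : 0 ≤ R) (hR : ∀ x, R < ‖x‖ → ψ x = 0) {m : ℕ} (hm : R + 3 ≤ m)
    {μ k n : ℤ} (hnk : n ≤ k) {t : ℕ → ℝ} (ht : RadiiWindow t (2 ^ k) (2 ^ n))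
    (ht0 : t 0 ≤ 2 * 2 ^ k) (N : ℕ) (hx : x ∉ bigStar (m + 1) f μ) :
    vop N t (dil (2 ^ n) ψ) (goodDiff f μ) x ≤ ∑' l : ℤ, if l < k then
      vop N t (dil (2 ^ n) ψ) ((stopSet f μ l).indicator (goodDiff f μ)) x else 0 := by
  have hd0 : 0 < d := by omega
  have hf : ∫⁻ x, ‖f x‖ₑ ≠ ∞ := (hc.integrable_of_hasCompactSupport hs).2.ne
  have h2n : (0 : ℝ) < 2 ^ n := by positivity
  refine (vop_le_tsum hd (hψ.dilate h2n) (isBddCompact_goodDiff hd0 hc hs μ).integrable ht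
    (measurableSet_stopSet f μ) (pairwise_disjoint_stopSet f μ)
    (fun y hy => goodDiff_eq_zero hd0 hf hy) N x).trans (ENNReal.tsum_le_tsum fun l => ?_)
  split_ifs with hl
  · exact le_rfl
  · refine le_of_eq (vop_eq_zero (fun y => dil_eq_zero hR h2n y) ht N fun z hz => ?_)
    have hz' : z ∈ stopSet f μ l := mem_of_indicator_ne_zero hz
    have h1 := lt_norm_sub_of_notMem_bigStar (not_lt.1 hl) hx hz'
    have h2 : (2 : ℝ) ^ n ≤ 2 ^ k := zpow_le_zpow_right₀ one_le_two hnk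
    refine lt_of_lt_of_le ?_ (le_abs_self _)
    nlinarith

lemma exists_setLIntegral_closedBall_le (d : ℕ) (r : ℝ) (hr : 0 ≤ r) : ∃ C : ℝ≥0∞, C ≠ ∞ ∧
    ∀ (f : Ed d → ℂ) (θ : ℝ≥0∞) (k : ℤ) (x : Ed d), Continuous f →
      (∀ y, ‖x - y‖ ≤ r * 2 ^ k → cubeAvgNorm k f y ≤ θ) →
      ∫⁻ y in closedBall x (r * 2 ^ k), ‖f y‖ₑ ≤ C * ENNReal.ofReal (2 ^ k) ^ d * θ := by
  refine ⟨ENNReal.ofReal ((r + 2 * d) ^ d) * volume (ball (0 : Ed d) 1),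
    ENNReal.mul_ne_top ENNReal.ofReal_ne_top measure_ball_lt_top.ne, fun f θ k x hc h => ?_⟩
  have h2 : (0 : ℝ) < 2 ^ k := by positivity
  set U : Set (Ed d) := {y | ∃ z ∈ closedBall x (r * 2 ^ k), cubeIdx k z = cubeIdx k y} with hU
  have hUs : IsSaturated k U := fun a b hab ⟨z, hz, hza⟩ => ⟨z, hz, hza.trans hab⟩
  have hUm : MeasurableSet U := by
    have : U = cubeIdx k ⁻¹' (cubeIdx k '' closedBall x (r * 2 ^ k)) := by
      ext y; simp [hU]
    rw [this]
    exact measurable_cubeIdx k (Set.to_countable _).measurableSet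
  have hUb : U ⊆ closedBall x ((r + 2 * d) * 2 ^ k) := by
    rintro y ⟨z, hz, hzy⟩
    have h1 := norm_sub_le_of_mem_cube (show y ∈ cube k (cubeIdx k y) from rfl)
      (show z ∈ cube k (cubeIdx k y) from hzy)
    rw [mem_closedBall, dist_eq_norm] at hz ⊢
    calc ‖y - x‖ = ‖(y - z) + (z - x)‖ := by congr 1; abel
      _ ≤ 2 * d * 2 ^ k + r * 2 ^ k := (norm_add_le _ _).trans (add_le_add h1 hz)
      _ = _ := by ring
  calc ∫⁻ y in closedBall x (r * 2 ^ k), ‖f y‖ₑ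
      ≤ ∫⁻ y in U, ‖f y‖ₑ := lintegral_mono_set fun y hy => ⟨y, hy, rfl⟩
    _ = (volume.withDensity fun y => ‖f y‖ₑ) U := (withDensity_apply _ hUm).symm
    _ ≤ (θ • (volume : Measure (Ed d))) U := by
        refine hUs.measure_le hUm fun v hv => ?_
        rw [withDensity_apply _ (measurableSet_cube k v), Measure.smul_apply, smul_eq_mul]
        by_cases hne : ∃ y, y ∈ cube (d := d) k v
        · obtain ⟨y, hy⟩ := hne
          obtain ⟨z, hz, hzy⟩ := hv hy
          have hzv : z ∈ cube k v := hzy.trans hy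
          rw [← cubeAvgNorm_mul_volume hzv]
          gcongr
          refine h z ?_
          rwa [mem_closedBall', dist_eq_norm] at hz
        · push Not at hne
          simp [eq_empty_of_forall_notMem hne]
    _ ≤ θ * volume (closedBall x ((r + 2 * d) * 2 ^ k)) := by
        rw [Measure.smul_apply, smul_eq_mul]
        gcongr
    _ = _ := by
        rw [Measure.addHaar_closedBall _ _ (by positivity), finrank_euclideanSpace,
            Fintype.card_fin,
          mul_pow, ENNReal.ofReal_mul (by positivity), ENNReal.ofReal_pow h2.le]
        ring

/-- The low frequency part is controlled off the exceptional sets. -/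
lemma exists_low_le (hd : 2 ≤ d) {Φ : Ed d → ℂ} (hΦ : IsTest Φ) {R : ℝ}
    (hR : ∀ x, R < ‖x‖ → Φ x = 0) {m : ℕ} (hm : R + 2 ≤ m) : ∃ C : ℝ≥0∞, C ≠ ∞ ∧
    ∀ f : Ed d → ℂ, Continuous f → HasCompactSupport f → ∀ (k μ : ℤ) (t : ℝ), 0 ≤ t →
      t ≤ 2 * 2 ^ k → ∀ x ∉ bigStar (m + 1) f μ,
      ‖cv (sphMean d t (dil (2 ^ k) Φ)) f x‖ₑ ≤ C * ENNReal.ofReal (2 ^ μ) := by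
  obtain ⟨C, hC, h⟩ := exists_setLIntegral_closedBall_le d m (by positivity)
  obtain ⟨M, hM⟩ := hΦ.norm_le
  have hM0 : 0 ≤ M := (norm_nonneg _).trans (hM 0)
  refine ⟨ENNReal.ofReal M * C, by finiteness, fun f hc hs k μ t ht ht2 x hx => ?_⟩
  have hf : ∫⁻ x, ‖f x‖ₑ ≠ ∞ := (hc.integrable_of_hasCompactSupport hs).2.ne
  have h2 : (0 : ℝ) < 2 ^ k := by positivity
  have h0 := ofReal_two_zpow_pow_ne d k
  have hker : ∀ z, ‖sphMean d t (dil (2 ^ k) Φ) z‖ₑ ≤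
      ENNReal.ofReal M * (ENNReal.ofReal (2 ^ k) ^ d)⁻¹ := fun z => by
    have := isProbabilityMeasure_sphMeas hd
    have hb : ∀ y, ‖dil (2 ^ k) Φ y‖ ≤ ((2 ^ k) ^ d)⁻¹ * M := fun y => by
      rw [dil, norm_mul, Complex.norm_real, Real.norm_of_nonneg (by positivity)]
      gcongr
      exact hM _
    have hn : ‖sphMean d t (dil (2 ^ k) Φ) z‖ ≤ ((2 ^ k) ^ d)⁻¹ * M := by
      rw [sphMean_eq_integral]
      refine (norm_integral_le_of_norm_le_const (.of_forall fun y => hb _)).trans ?_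
      simp
    rw [← ofReal_norm, ← ENNReal.ofReal_pow h2.le, ← ENNReal.ofReal_inv_of_pos (by positivity),
      ← ENNReal.ofReal_mul hM0, mul_comm M]
    exact ENNReal.ofReal_le_ofReal hn
  calc ‖cv (sphMean d t (dil (2 ^ k) Φ)) f x‖ₑ
      ≤ ∫⁻ z, ‖sphMean d t (dil (2 ^ k) Φ) (x - z)‖ₑ * ‖f z‖ₑ := enorm_cv_le _ _ _
    _ ≤ ∫⁻ z in closedBall x (m * 2 ^ k),
          ENNReal.ofReal M * (ENNReal.ofReal (2 ^ k) ^ d)⁻¹ * ‖f z‖ₑ := by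
        rw [← lintegral_indicator measurableSet_closedBall]
        refine lintegral_mono fun z => ?_
        by_cases hz : z ∈ closedBall x (m * 2 ^ k)
        · rw [indicator_of_mem hz]
          gcongr
          exact hker _
        · rw [mem_closedBall', dist_eq_norm, not_le] at hz
          rw [sphMean_eq_zero (fun y => dil_eq_zero hR h2 y) ht]
          · simp
          · refine lt_of_lt_of_le ?_ (le_abs_self _)
            nlinarith
    _ = ENNReal.ofReal M * (ENNReal.ofReal (2 ^ k) ^ d)⁻¹ *
          ∫⁻ z in closedBall x (m * 2 ^ k), ‖f z‖ₑ :=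
        lintegral_const_mul _ hc.measurable.enorm
    _ ≤ ENNReal.ofReal M * (ENNReal.ofReal (2 ^ k) ^ d)⁻¹ *
          (C * ENNReal.ofReal (2 ^ k) ^ d * ENNReal.ofReal (2 ^ μ)) := by
        gcongr
        refine h f _ k x hc fun y hy => ?_
        by_contra! hlt
        obtain ⟨l, hl, hyl⟩ := exists_mem_stopSet (by omega) hf hlt
        exact absurd (lt_norm_sub_of_notMem_bigStar hl hx hyl) (not_lt.2 hy)
    _ = ENNReal.ofReal M * C * ENNReal.ofReal (2 ^ μ) *
          ((ENNReal.ofReal (2 ^ k) ^ d)⁻¹ * ENNReal.ofReal (2 ^ k) ^ d) := by ring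
    _ = _ := by rw [ENNReal.inv_mul_cancel h0.1 h0.2, mul_one]

end

/-! ### Inequalities for sums -/

/-- A weighted Hölder inequality. -/
lemma tsum_rpow_le_weight {ι : Type*} {p : ℝ} (hp : 1 < p) {w : ι → ℝ} (hw : ∀ i, 0 < w i)
    (a : ι → ℝ≥0∞) : (∑' i, a i) ^ p ≤
      (∑' i, ENNReal.ofReal (w i ^ (-(p / (p - 1))))) ^ (p - 1) *
        ∑' i, ENNReal.ofReal (w i ^ p) * a i ^ p := by
  have hp0 : 0 < p := by linarith
  have hpq : (p / (p - 1)).HolderConjugate p := (Real.HolderConjugate.conjExponent hp).symm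
  set A := ∑' i, ENNReal.ofReal (w i ^ (-(p / (p - 1))))
  set B := ∑' i, ENNReal.ofReal (w i ^ p) * a i ^ p
  have h : ∑' i, a i ≤ A ^ (1 / (p / (p - 1))) * B ^ (1 / p) := by
    rw [ENNReal.tsum_eq_iSup_sum]
    refine iSup_le fun s => ?_
    calc ∑ i ∈ s, a i = ∑ i ∈ s, ENNReal.ofReal (w i ^ (-1 : ℝ)) * (ENNReal.ofReal
        (w i) * a i) := by
          refine Finset.sum_congr rfl fun i _ => ?_
          rw [← mul_assoc, ← ENNReal.ofReal_mul (Real.rpow_nonneg (hw i).le _), Real.rpow_neg_one,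
            inv_mul_cancel₀ (hw i).ne', ENNReal.ofReal_one, one_mul]
      _ ≤ _ := ENNReal.inner_le_Lp_mul_Lq s _ _ hpq
      _ ≤ _ := by
          gcongr
          · refine le_trans (Finset.sum_le_sum fun i _ => le_of_eq ?_) (ENNReal.sum_le_tsum s)
            rw [ENNReal.ofReal_rpow_of_pos (Real.rpow_pos_of_pos (hw i) _),
              ← Real.rpow_mul (hw i).le]
            congr 2; ring
          · refine le_trans (Finset.sum_le_sum fun i _ => le_of_eq ?_) (ENNReal.sum_le_tsum s)
            rw [ENNReal.mul_rpow_of_nonneg _ _ hp0.le, ENNReal.ofReal_rpow_of_pos (hw i)]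
  refine (ENNReal.rpow_le_rpow h hp0.le).trans (le_of_eq ?_)
  rw [ENNReal.mul_rpow_of_nonneg _ _ hp0.le, ← ENNReal.rpow_mul, ← ENNReal.rpow_mul,
    one_div_mul_cancel hp0.ne', ENNReal.rpow_one]
  congr 2
  field_simp

lemma tsum_rpow_le_of_tsum_weight_le_one {ι : Type*} {p : ℝ} (hp : 1 < p) {w : ι → ℝ}
    (hw : ∀ i, 0 < w i) (h : ∑' i, ENNReal.ofReal (w i ^ (-(p / (p - 1)))) ≤ 1)
    (a : ι → ℝ≥0∞) : (∑' i, a i) ^ p ≤ ∑' i, ENNReal.ofReal (w i ^ p) * a i ^ p :=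
  (tsum_rpow_le_weight hp hw a).trans
    (mul_le_of_le_one_left' (ENNReal.rpow_le_one h (by linarith)))

/-- A weighted Hölder inequality with geometric weights. -/
lemma exists_tsum_rpow_le_geometric {p r : ℝ} (hp : 1 < p) (h0 : 0 < r) (h1 : r < 1) :
    ∃ C : ℝ≥0∞, C ≠ ∞ ∧ ∀ a : ℤ → ℝ≥0∞,
      (∑' m, a m) ^ p ≤ C * ∑' m, ENNReal.ofReal ((r ^ m.natAbs)⁻¹) * a m ^ p := by
  have hp0 : 0 < p := by linarith
  have hq : 0 < p - 1 := by linarith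
  set ρ := r ^ (1 / (p - 1)) with hρ
  have hρ1 : ρ < 1 := Real.rpow_lt_one h0.le h1 (by positivity)
  have hw : ∀ m : ℤ, 0 < (r ^ m.natAbs) ^ (-(1 / p)) := fun m => by positivity
  refine ⟨(∑' m : ℤ, ENNReal.ofReal (ρ ^ m.natAbs)) ^ (p - 1), ENNReal.rpow_ne_top_of_nonneg hq.le
    (tsum_ofReal_pow_natAbs_lt_top (by positivity) hρ1).ne, fun a => ?_⟩
  refine (tsum_rpow_le_weight hp hw a).trans (le_of_eq ?_)
  congr 2
  · refine tsum_congr fun m => ?_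
    rw [← Real.rpow_mul (by positivity), hρ, ← Real.rpow_natCast, ← Real.rpow_natCast,
      ← Real.rpow_mul h0.le, ← Real.rpow_mul h0.le]
    congr 2
    field_simp
  · refine funext fun m => ?_
    rw [← Real.rpow_mul (by positivity), neg_mul, one_div_mul_cancel hp0.ne', Real.rpow_neg_one]

lemma exists_tsum_nat_rpow_le_geometric {p r : ℝ} (hp : 1 < p) (h0 : 0 < r) (h1 : r < 1) :
    ∃ C : ℝ≥0∞, C ≠ ∞ ∧ ∀ a : ℕ → ℝ≥0∞,
      (∑' m, a m) ^ p ≤ C * ∑' m, ENNReal.ofReal ((r ^ m)⁻¹) * a m ^ p := by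
  obtain ⟨C, hC, h⟩ := exists_tsum_rpow_le_geometric hp h0 h1
  refine ⟨C, hC, fun a => ?_⟩
  have key : ∀ g : ℤ → ℝ≥0∞, (∀ z < 0, g z = 0) → ∑' z, g z = ∑' n : ℕ, g n := fun g hg => by
    refine (Function.Injective.tsum_eq (g := fun n : ℕ => (n : ℤ)) Nat.cast_injective
      fun z hz => ?_).symm
    by_contra hne
    refine hz (hg z ?_)
    by_contra! hz0
    exact hne ⟨z.toNat, Int.toNat_of_nonneg hz0⟩
  have h2 := h fun z => if 0 ≤ z then a z.toNat else 0
  rw [key _ fun z hz => by simp [not_le.2 hz], key _ fun z hz => by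
    simp [not_le.2 hz, show 0 < p by linarith]] at h2
  simpa using h2

/-- Summation over levels of quantities controlled both linearly and quadratically. -/
lemma exists_tsum_rpow_le_interp {p : ℝ} (hp : 1 < p) (hp2 : p < 2) :
    ∃ C : ℝ≥0∞, C ≠ ∞ ∧ ∀ (s : ℝ), 0 < s → ∀ F : ℤ → ℝ≥0∞,
      (∑' μ, F μ) ^ p ≤ C * ∑' μ : ℤ, (ENNReal.ofReal ((s * 2 ^ μ) ^ (p - 1)) * F μ +
        ENNReal.ofReal ((s * 2 ^ μ) ^ (p - 2)) * F μ ^ 2) := by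
  have hp0 : 0 < p := by linarith
  set ρ : ℝ := max (2 ^ (-(p - 1))) (2 ^ (-((2 - p) / 2))) with hρ
  have hρ0 : 0 < ρ := lt_max_of_lt_left (by positivity)
  have hρ1 : ρ < 1 := max_lt (Real.rpow_lt_one_of_one_lt_of_neg one_lt_two (by linarith))
    (Real.rpow_lt_one_of_one_lt_of_neg one_lt_two (by linarith))
  set G₀ := ∑' n : ℤ, ENNReal.ofReal (ρ ^ n.natAbs) with hG
  have hGt : G₀ ≠ ∞ := (tsum_ofReal_pow_natAbs_lt_top hρ0.le hρ1).ne
  refine ⟨(2 * G₀) ^ p, by finiteness, fun s hs F => ?_⟩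
  set T := ∑' μ : ℤ, (ENNReal.ofReal ((s * 2 ^ μ) ^ (p - 1)) * F μ +
        ENNReal.ofReal ((s * 2 ^ μ) ^ (p - 2)) * F μ ^ 2) with hT
  have hterm : ∀ μ, ENNReal.ofReal ((s * 2 ^ μ) ^ (p - 1)) * F μ +
        ENNReal.ofReal ((s * 2 ^ μ) ^ (p - 2)) * F μ ^ 2 ≤ T := fun μ => ENNReal.le_tsum μ
  have hs2 : ∀ μ : ℤ, 0 < s * 2 ^ μ := fun μ => by positivity
  rcases eq_or_ne T ∞ with hTt | hTt
  · rw [hTt, ENNReal.mul_top]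
    · exact le_top
    · have : G₀ ≠ 0 := fun h0 => by
        have := ENNReal.tsum_eq_zero.1 h0 0
        simp at this
      simp [this, hp0, hp0.not_gt]
  have hFt : ∀ μ, F μ ≠ ∞ := fun μ h => by
    refine hTt (top_le_iff.1 (le_trans (le_of_eq ?_) (le_self_add.trans (hterm μ))))
    rw [h, ENNReal.mul_top]
    exact (ENNReal.ofReal_pos.2 (Real.rpow_pos_of_pos (hs2 μ) _)).ne'
  rcases eq_or_ne T 0 with hT0 | hT0
  · have hF0 : ∀ μ, F μ = 0 := fun μ => by
      have h := le_self_add.trans ((hterm μ).trans hT0.le)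
      rw [nonpos_iff_eq_zero, mul_eq_zero] at h
      exact h.resolve_left (ENNReal.ofReal_pos.2 (Real.rpow_pos_of_pos (hs2 μ) _)).ne'
    simp [hF0, hp0]
  set τ := T.toReal with hτ
  have hτ0 : 0 < τ := ENNReal.toReal_pos hT0 hTt
  have hTτ : T = ENNReal.ofReal τ := (ENNReal.ofReal_toReal hTt).symm
  set a := τ ^ (1 / p) with ha
  have ha0 : 0 < a := by positivity
  have hap : a ^ p = τ := by
    rw [ha, ← Real.rpow_mul hτ0.le, one_div_mul_cancel hp0.ne', Real.rpow_one]
  obtain ⟨n, hn1, hn2⟩ := exists_mem_Ico_zpow (show 0 < a / s by positivity)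
    (one_lt_two : (1 : ℝ) < 2)
  have hFle : ∀ μ, F μ ≤ ENNReal.ofReal (2 * a) * ENNReal.ofReal (ρ ^ (n - μ).natAbs) := by
    intro μ
    obtain ⟨y, hy0, hy⟩ : ∃ y : ℝ, 0 ≤ y ∧ F μ = ENNReal.ofReal y :=
      ⟨(F μ).toReal, ENNReal.toReal_nonneg, (ENNReal.ofReal_toReal (hFt μ)).symm⟩
    have h1 := hterm μ
    rw [hy, hTτ, ← ENNReal.ofReal_pow hy0, ← ENNReal.ofReal_mul
      (Real.rpow_nonneg (hs2 μ).le _), ← ENNReal.ofReal_mul (Real.rpow_nonneg (hs2 μ).le _),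
      ← ENNReal.ofReal_add (mul_nonneg (Real.rpow_nonneg (hs2 μ).le _) hy0)
        (mul_nonneg (Real.rpow_nonneg (hs2 μ).le _) (by positivity)),
      ENNReal.ofReal_le_ofReal_iff hτ0.le, ← hap] at h1
    rw [hy, ← ENNReal.ofReal_mul (by positivity)]
    refine ENNReal.ofReal_le_ofReal ?_
    set σ := s * 2 ^ μ with hσ
    have hσ0 : 0 < σ := hs2 μ
    have hpos1 : 0 ≤ σ ^ (p - 1) * y := mul_nonneg (Real.rpow_nonneg hσ0.le _) hy0
    have hpos2 : 0 ≤ σ ^ (p - 2) * y ^ 2 :=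
      mul_nonneg (Real.rpow_nonneg hσ0.le _) (by positivity)
    rw [le_div_iff₀ hs] at hn1
    rw [div_lt_iff₀ hs] at hn2
    rcases le_total n μ with hle | hle
    · obtain ⟨m, rfl⟩ : ∃ m : ℕ, μ = n + m := ⟨(μ - n).toNat, by omega⟩
      have e : (n - (n + m : ℤ)).natAbs = m := by omega
      have h2 : σ ^ (p - 1) * y ≤ a ^ p := by linarith
      have h3 : a * 2⁻¹ * 2 ^ (m : ℝ) ≤ σ := by
        rw [hσ, zpow_add₀ two_ne_zero, zpow_natCast, Real.rpow_natCast]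
        rw [zpow_add_one₀ two_ne_zero] at hn2
        have : (0 : ℝ) < 2 ^ m := by positivity
        nlinarith
      have h4 : (a * 2⁻¹ * 2 ^ (m : ℝ)) ^ (p - 1) * y ≤ a ^ p :=
        le_trans (mul_le_mul_of_nonneg_right (Real.rpow_le_rpow (by positivity) h3 (by linarith))
          hy0) h2
      rw [Real.mul_rpow (by positivity) (by positivity), Real.mul_rpow (by positivity)
          (by positivity),
        ← Real.rpow_mul zero_le_two] at h4
      rw [e]
      have h5 : ((2 : ℝ) ^ (-(p - 1))) ^ m ≤ ρ ^ m := by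
        gcongr
        exact le_max_left _ _
      rw [← Real.rpow_natCast, ← Real.rpow_mul zero_le_two] at h5
      have h6 : a ^ p = a ^ (p - 1) * a := by
        rw [← Real.rpow_add_one ha0.ne', sub_add_cancel]
      have h7 : (2⁻¹ : ℝ) ≤ 2⁻¹ ^ (p - 1) := by
        have := Real.rpow_le_rpow_of_exponent_ge (show (0 : ℝ) < 2⁻¹ by norm_num) (by norm_num)
          (show p - 1 ≤ 1 by linarith)
        rwa [Real.rpow_one] at this
      have h8 : 2⁻¹ * 2 ^ ((m : ℝ) * (p - 1)) * y ≤ a := by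
        have hap1 : 0 < a ^ (p - 1) := by positivity
        rw [h6] at h4
        refine le_of_mul_le_mul_left (le_trans ?_ h4) hap1
        have : 0 ≤ 2 ^ ((m : ℝ) * (p - 1)) * y := mul_nonneg (by positivity) hy0
        have h9 := mul_le_mul_of_nonneg_right h7 (mul_nonneg hap1.le this)
        linarith
      have h10 : (2 : ℝ) ^ (-(p - 1) * m) * 2 ^ ((m : ℝ) * (p - 1)) = 1 := by
        rw [← Real.rpow_add two_pos]; ring_nf; exact Real.rpow_zero 2
      have h11 : (0 : ℝ) < 2 ^ (-(p - 1) * m) := by positivity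
      calc y = 2 * (2 ^ (-(p - 1) * m) * (2⁻¹ * 2 ^ ((m : ℝ) * (p - 1)) * y)) := by
            linear_combination (-y) * h10
        _ ≤ 2 * (2 ^ (-(p - 1) * m) * a) := by gcongr
        _ ≤ 2 * (ρ ^ m * a) := by gcongr
        _ = _ := by ring
    · obtain ⟨m, rfl⟩ : ∃ m : ℕ, n = μ + m := ⟨(n - μ).toNat, by omega⟩
      have e : (μ + m - μ : ℤ).natAbs = m := by omega
      have h2 : σ ^ (p - 2) * y ^ 2 ≤ a ^ p := by linarith
      have h3 : σ ≤ a * 2 ^ (-(m : ℝ)) := by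
        rw [zpow_add₀ two_ne_zero, zpow_natCast] at hn1
        rw [Real.rpow_neg zero_le_two, Real.rpow_natCast, ← div_eq_mul_inv,
          le_div_iff₀ (by positivity)]
        linarith
      have h4 : y ^ 2 ≤ a ^ p * (a * 2 ^ (-(m : ℝ))) ^ (2 - p) := by
        have e1 : σ ^ (2 - p) * σ ^ (p - 2) = 1 := by
          rw [← Real.rpow_add hσ0]; ring_nf; exact Real.rpow_zero _
        have e2 : σ ^ (2 - p) ≤ (a * 2 ^ (-(m : ℝ))) ^ (2 - p) :=
          Real.rpow_le_rpow hσ0.le h3 (by linarith)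
        calc y ^ 2 = σ ^ (2 - p) * (σ ^ (p - 2) * y ^ 2) := by
              rw [← mul_assoc, e1, one_mul]
          _ ≤ σ ^ (2 - p) * a ^ p := by gcongr
          _ ≤ (a * 2 ^ (-(m : ℝ))) ^ (2 - p) * a ^ p := by gcongr
          _ = _ := mul_comm _ _
      have h5 : a ^ p * (a * 2 ^ (-(m : ℝ))) ^ (2 - p) = (a * 2 ^ (-((2 - p) / 2) * m)) ^ 2 := by
        rw [Real.mul_rpow ha0.le (by positivity), ← mul_assoc, ← Real.rpow_add ha0, mul_pow,
          ← Real.rpow_mul zero_le_two, ← Real.rpow_natCast (2 ^ _), ← Real.rpow_mul zero_le_two]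
        congr 1
        · rw [← Real.rpow_natCast]; congr 1; push_cast; ring
        · congr 1; push_cast; ring
      rw [h5] at h4
      have h6 := (abs_le_of_sq_le_sq' h4 (by positivity)).2
      have h7 : ((2 : ℝ) ^ (-((2 - p) / 2))) ^ m ≤ ρ ^ m := by
        gcongr
        exact le_max_right _ _
      rw [← Real.rpow_natCast, ← Real.rpow_mul zero_le_two] at h7
      rw [e]
      have h8 : 0 < a * ρ ^ m := by positivity
      calc y ≤ a * ρ ^ m := h6.trans (by gcongr)
        _ ≤ _ := by linarith
  have hsum : ∑' μ, F μ ≤ ENNReal.ofReal (2 * a) * G₀ := by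
    refine (ENNReal.tsum_le_tsum hFle).trans (le_of_eq ?_)
    rw [ENNReal.tsum_mul_left, hG]
    congr 1
    exact (Equiv.subLeft n).tsum_eq fun z => ENNReal.ofReal (ρ ^ z.natAbs)
  refine (ENNReal.rpow_le_rpow hsum hp0.le).trans (le_of_eq ?_)
  rw [ENNReal.ofReal_mul zero_le_two, ENNReal.ofReal_ofNat, mul_right_comm,
    ENNReal.mul_rpow_of_nonneg _ _ hp0.le, ENNReal.ofReal_rpow_of_pos ha0, hap, hTτ]

end

section

open scoped Function FourierTransform

/-! ### Summation over levels -/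

lemma ofReal_mul_two_zpow_rpow {s : ℝ} (hs : 0 < s) (μ : ℤ) (q : ℝ) :
    ENNReal.ofReal ((s * 2 ^ μ) ^ q) = ENNReal.ofReal (s ^ q) * ENNReal.ofReal (2 ^ μ) ^ q := by
  have h : (0 : ℝ) < 2 ^ μ := by positivity
  rw [Real.mul_rpow hs.le h.le, ENNReal.ofReal_mul (by positivity), ENNReal.ofReal_rpow_of_pos h]

lemma exists_lintegral_tsum_rpow_le {p : ℝ} (hp : 1 < p) (hp2 : p < 2) :
    ∃ C : ℝ≥0∞, C ≠ ∞ ∧ ∀ (d : ℕ) (F : ℤ → Ed d → ℝ≥0∞), (∀ μ, Measurable (F μ)) →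
      ∀ (s : ℝ), 0 < s → ∀ (a b e : ℝ≥0∞) (V : ℤ → ℝ≥0∞),
      ENNReal.ofReal (s ^ (p - 1)) * a ≤ e → ENNReal.ofReal (s ^ (p - 2)) * b ≤ e →
      (∀ μ : ℤ, ∫⁻ x, F μ x ≤ a * (ENNReal.ofReal (2 ^ μ) * V μ)) →
      (∀ μ : ℤ, ∫⁻ x, F μ x ^ 2 ≤ b * (ENNReal.ofReal (2 ^ μ) ^ 2 * V μ)) →
      ∫⁻ x, (∑' μ, F μ x) ^ p ≤ C * e * ∑' μ : ℤ, ENNReal.ofReal (2 ^ μ) ^ p * V μ := by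
  obtain ⟨C, hC, hCb⟩ := exists_tsum_rpow_le_interp hp hp2
  refine ⟨C * 2, by finiteness, fun d F hF s hs a b e V ha hb h1 h2 => ?_⟩
  have hpow : ∀ (μ : ℤ) (q : ℝ), ENNReal.ofReal (2 ^ μ) ^ (p - q) * ENNReal.ofReal (2 ^ μ) ^ q =
      ENNReal.ofReal (2 ^ μ) ^ p := fun μ q => by
    have h : (0 : ℝ) < 2 ^ μ := by positivity
    rw [← ENNReal.rpow_add _ _ (ENNReal.ofReal_pos.2 h).ne' ENNReal.ofReal_ne_top, sub_add_cancel]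
  calc ∫⁻ x, (∑' μ, F μ x) ^ p
      ≤ ∫⁻ x, C * ∑' μ : ℤ, (ENNReal.ofReal ((s * 2 ^ μ) ^ (p - 1)) * F μ x +
        ENNReal.ofReal ((s * 2 ^ μ) ^ (p - 2)) * F μ x ^ 2) := lintegral_mono fun x => hCb s hs _
    _ = C * ∑' μ : ℤ, (ENNReal.ofReal ((s * 2 ^ μ) ^ (p - 1)) * (∫⁻ x, F μ x) +
        ENNReal.ofReal ((s * 2 ^ μ) ^ (p - 2)) * ∫⁻ x, F μ x ^ 2) := by
      rw [lintegral_const_mul' _ _ hC, lintegral_tsum fun μ => by fun_prop]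
      congr 2 with μ
      rw [lintegral_add_left (by fun_prop), lintegral_const_mul _ (hF μ),
        lintegral_const_mul _ (by fun_prop)]
    _ ≤ C * ∑' μ : ℤ, 2 * e * (ENNReal.ofReal (2 ^ μ) ^ p * V μ) := by
      refine mul_le_mul_right (ENNReal.tsum_le_tsum fun μ => ?_) _
      rw [mul_assoc, two_mul]
      refine add_le_add ?_ ?_
      · rw [ofReal_mul_two_zpow_rpow hs]
        calc _ ≤ ENNReal.ofReal (s ^ (p - 1)) * ENNReal.ofReal (2 ^ μ) ^ (p - 1) *
              (a * (ENNReal.ofReal (2 ^ μ) * V μ)) := by gcongr; exact h1 μ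
          _ = (ENNReal.ofReal (s ^ (p - 1)) * a) * ((ENNReal.ofReal (2 ^ μ) ^ (p - 1) *
              ENNReal.ofReal (2 ^ μ) ^ (1 : ℝ)) * V μ) := by rw [ENNReal.rpow_one]; ring
          _ ≤ _ := by rw [hpow]; gcongr
      · rw [ofReal_mul_two_zpow_rpow hs]
        calc _ ≤ ENNReal.ofReal (s ^ (p - 2)) * ENNReal.ofReal (2 ^ μ) ^ (p - 2) *
              (b * (ENNReal.ofReal (2 ^ μ) ^ 2 * V μ)) := by gcongr; exact h2 μ
          _ = (ENNReal.ofReal (s ^ (p - 2)) * b) * ((ENNReal.ofReal (2 ^ μ) ^ (p - 2) *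
              ENNReal.ofReal (2 ^ μ) ^ (2 : ℝ)) * V μ) := by rw [ENNReal.rpow_two]; ring
          _ ≤ _ := by rw [hpow]; gcongr
    _ = _ := by rw [ENNReal.tsum_mul_left]; ring

/-! ### Atoms at a fixed distance from the scale of the kernel -/

lemma window_ratio (n : ℤ) (j e : ℕ) :
    ((2 : ℝ) ^ n / 2 ^ (n + j)) ^ e = 2 ^ (-(j : ℝ) * e) := by
  rw [← zpow_sub₀ two_ne_zero, sub_add_cancel_left, ← zpow_natCast, ← zpow_mul,
    ← Real.rpow_intCast]
  push_cast
  rfl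

lemma exists_lintegral_atom_rpow_le {d : ℕ} (hd : 2 ≤ d) {ψ : Ed d → ℂ} (hψ : IsTest ψ) {B : ℝ}
    (hB : ∀ ξ, ξ ≠ 0 → (1 + ‖ξ‖ ^ 2) * ‖𝓕 ψ ξ‖ ^ 2 ≤ B ^ 2 * (‖ξ‖ ^ (d - 1) * band ‖ξ‖ ^ 2))
    {p : ℝ} (hp : 1 < p) (hp2 : p < 2) :
    ∃ C : ℝ≥0∞, C ≠ ∞ ∧ ∃ r : ℝ, 0 < r ∧ r < 1 ∧ ∀ f : Ed d → ℂ, Continuous f →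
      HasCompactSupport f → ∀ (n m : ℤ) (j : ℕ), m < j → ∀ t : ℕ → ℝ,
      RadiiWindow t (2 ^ (n + j)) (2 ^ n) → t 0 ≤ 2 * 2 ^ (n + j) → ∀ N : ℕ,
      ∫⁻ x, (∑' μ, vop N t (dil (2 ^ n) ψ)
        ((stopSet f μ (n + m)).indicator (goodDiff f μ)) x) ^ p ≤
        C * ENNReal.ofReal (2 ^ (-(j : ℝ) * ((d : ℝ) - 1) * (p - 1))) *
          ENNReal.ofReal (r ^ m.natAbs) *
          ∑' μ : ℤ, ENNReal.ofReal (2 ^ μ) ^ p * volume (stopSet f μ (n + m)) := by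
  obtain ⟨C0, hC0, h0⟩ := exists_lintegral_tsum_rpow_le hp hp2
  obtain ⟨C1, hC1, h1⟩ := exists_lintegral_vop_atom_le hd hψ hB
  obtain ⟨C2, hC2, h2⟩ := exists_lintegral_vop_sq_le hd hψ hB
  obtain ⟨C3, hC3, h3⟩ := exists_tsum_bandEnergy_le d
  have hδ := decayRate_pos
  have hd0 : 0 < d := by omega
  set M : ℝ≥0∞ := 3 * 2 ^ d with hM
  have hMt : M ≠ ∞ := by finiteness
  set r : ℝ := decayRate ^ ((2 - p) / 2) with hr
  refine ⟨C0 * (C1 * M + C2 * C3 * M ^ 2), by finiteness, r, by positivity,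
    Real.rpow_lt_one hδ.le decayRate_lt_one (by linarith),
    fun f hc hs n m j hmj t ht ht0 N => ?_⟩
  set D : ℝ := 2 ^ (-(j : ℝ) * (d - 1 : ℕ)) with hD
  have hD0 : 0 < D := by positivity
  have hd1 : ((d - 1 : ℕ) : ℝ) = (d : ℝ) - 1 := by rw [Nat.cast_sub (by omega)]; simp
  set δ : ℝ := decayRate ^ m.natAbs with hδm
  have hδ0 : 0 < δ := by positivity
  have hDp : (2 : ℝ) ^ (-(j : ℝ) * ((d : ℝ) - 1) * (p - 1)) = D ^ (p - 1) := by
    rw [hD, ← Real.rpow_mul zero_le_two, hd1]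
  have hrm : r ^ m.natAbs = δ ^ ((2 - p) / 2) := by
    rw [hr, hδm, ← Real.rpow_natCast, ← Real.rpow_natCast, ← Real.rpow_mul hδ.le,
      ← Real.rpow_mul hδ.le, mul_comm]
  have hδ1 : δ ≤ 1 := pow_le_one₀ hδ.le decayRate_lt_one.le
  set e' : ℝ := D ^ (p - 1) * δ ^ ((2 - p) / 2)
  rw [hDp, hrm, mul_assoc (C0 * _), ← ENNReal.ofReal_mul (by positivity), mul_assoc C0]
  have hat : ∀ μ, IsCubeAtom (n + m) (stopSet f μ (n + m)) (M * ENNReal.ofReal (2 ^ μ))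
      ((stopSet f μ (n + m)).indicator (goodDiff f μ)) := fun μ => by
    simpa only [hM] using isCubeAtom_goodDiff hd0 hc hs μ (n + m)
  refine h0 d _ (fun μ => measurable_vop hd (hψ.dilate (by positivity)) ht (hat μ).bdd N)
    (D * δ ^ (-(1 / 2) : ℝ)) (by positivity)
    (C1 * ENNReal.ofReal δ * M) (C2 * C3 * ENNReal.ofReal D * M ^ 2) _ _ ?_ ?_
    (fun μ => ?_) (fun μ => ?_)
  · calc _ = C1 * M * (ENNReal.ofReal ((D * δ ^ (-(1 / 2) : ℝ)) ^ (p - 1)) * ENNReal.ofReal δ) := by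
          ring
      _ = C1 * M * ENNReal.ofReal (D ^ (p - 1) * δ ^ ((3 - p) / 2)) := by
          rw [← ENNReal.ofReal_mul (by positivity), Real.mul_rpow hD0.le (by positivity),
            ← Real.rpow_mul hδ0.le, mul_assoc (D ^ (p - 1)), ← Real.rpow_add_one hδ0.ne']
          congr 4; ring
      _ ≤ C1 * M * ENNReal.ofReal e' := by
          gcongr
          refine mul_le_mul_of_nonneg_left ?_ (by positivity)
          exact Real.rpow_le_rpow_of_exponent_ge hδ0 hδ1 (by linarith)
      _ ≤ _ := by gcongr; exact le_self_add
  · calc _ = C2 * C3 * M ^ 2 *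
          (ENNReal.ofReal ((D * δ ^ (-(1 / 2) : ℝ)) ^ (p - 2)) * ENNReal.ofReal D) := by ring
      _ = C2 * C3 * M ^ 2 * ENNReal.ofReal e' := by
          rw [← ENNReal.ofReal_mul (by positivity), Real.mul_rpow hD0.le (by positivity),
            ← Real.rpow_mul hδ0.le, mul_right_comm (D ^ (p - 2)), ← Real.rpow_add_one hD0.ne']
          rw [show p - 2 + 1 = p - 1 by ring, show -(1 / 2) * (p - 2) = (2 - p) / 2 by ring]
      _ ≤ _ := by gcongr; exact le_add_self
  · refine (h1 n (n + m) (n + j) (by omega) _ _ _ (hat μ) t ht ht0 N).trans (le_of_eq ?_)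
    rw [add_sub_cancel_left]
    ring
  · refine (h2 n t _ ht N _ (hat μ).bdd).trans ?_
    rw [window_ratio]
    calc _ ≤ C2 * ENNReal.ofReal D * (C3 * ((M * ENNReal.ofReal (2 ^ μ)) ^ 2 *
          volume (stopSet f μ (n + m)))) := by
          gcongr
          refine (ENNReal.le_tsum n).trans ((h3 _ (hat μ).bdd).trans ?_)
          gcongr
          exact (hat μ).lintegral_sq_le
      _ = _ := by ring

/-! ### Families of windows -/

/-- The families of windows used to linearize the maximal operator. -/
structure WindowFamily (ν : ℤ → ℕ → ℕ) (W : ∀ n j, Fin (ν n j) → ℕ → ℝ) : Prop where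
  window : ∀ n j i, RadiiWindow (W n j i) (2 ^ (n + j : ℤ)) (2 ^ n)
  start_le : ∀ n j i, W n j i 0 ≤ 2 * 2 ^ (n + j : ℤ)

/-- The entropy condition on the number of windows. -/
def EntropyBound (d : ℕ) (p : ℝ) (ω : ℕ → ℝ) (A : ℝ) (ν : ℤ → ℕ → ℕ) : Prop :=
  ∀ n, ∑' j : ℕ, ENNReal.ofReal (ω j ^ p) * (ν n j : ℝ≥0∞) *
    ENNReal.ofReal (2 ^ (-(j : ℝ) * ((d : ℝ) - 1) * (p - 1))) ≤ ENNReal.ofReal (A ^ p)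

/-- The contribution of the atoms whose scale is at distance `m` from that of the kernel. -/
def atomPart {d : ℕ} (f ψ : Ed d → ℂ) (N : ℕ) (n : ℤ) (j : ℕ) (t : ℕ → ℝ) (m : ℤ) (x : Ed d) :
    ℝ≥0∞ :=
  if m < j then ∑' μ, vop N t (dil (2 ^ n) ψ) ((stopSet f μ (n + m)).indicator
      (goodDiff f μ)) x else 0

lemma measurable_atomPart {d : ℕ} (hd : 2 ≤ d) {f ψ : Ed d → ℂ} (hψ : IsTest ψ) (hc : Continuous f)
    (hs : HasCompactSupport f) {N : ℕ} {n : ℤ} {j : ℕ} {t : ℕ → ℝ}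
    (ht : RadiiWindow t (2 ^ (n + j : ℤ)) (2 ^ n)) (m : ℤ) :
    Measurable (atomPart f ψ N n j t m) := by
  unfold atomPart
  split_ifs
  · exact Measurable.tsum fun μ => measurable_vop hd (hψ.dilate (by positivity)) ht
      (isCubeAtom_goodDiff (by omega) hc hs μ (n + m)).bdd N
  · exact measurable_const

lemma tsum_measure_stopSet {d : ℕ} (f : Ed d → ℂ) (μ : ℤ) :
    ∑' l, volume (stopSet f μ l) = volume (big f μ) :=
  (measure_iUnion (pairwise_disjoint_stopSet f μ) fun l => measurableSet_stopSet f μ l).symm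

lemma exists_lintegral_tsum_atomPart_le {d : ℕ} (hd : 2 ≤ d) {ψ : Ed d → ℂ} (hψ : IsTest ψ) {B : ℝ}
    (hB : ∀ ξ, ξ ≠ 0 → (1 + ‖ξ‖ ^ 2) * ‖𝓕 ψ ξ‖ ^ 2 ≤ B ^ 2 * (‖ξ‖ ^ (d - 1) * band ‖ξ‖ ^ 2))
    {p : ℝ} (hp : 1 < p) (hp2 : p < 2) :
    ∃ C : ℝ≥0∞, C ≠ ∞ ∧ ∀ f : Ed d → ℂ, Continuous f → HasCompactSupport f →
      ∀ ω A ν W, EntropyBound d p ω A ν → WindowFamily ν W → ∀ N : ℕ,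
      ∑' n : ℤ, ∑' j : ℕ, ENNReal.ofReal (ω j ^ p) *
        ∑ i, ∫⁻ x, (∑' m, atomPart f ψ N n j (W n j i) m x) ^ p ≤
      C * ENNReal.ofReal (A ^ p) * ∑' μ : ℤ, ENNReal.ofReal (2 ^ μ) ^ p * volume (big f μ) := by
  obtain ⟨C, hC, r, hr0, hr1, h⟩ := exists_lintegral_atom_rpow_le hd hψ hB hp hp2
  have hp0 : 0 < p := by linarith
  have hρ0 : 0 < √r := Real.sqrt_pos.2 hr0
  have hρ1 : √r < 1 := (Real.sqrt_lt' one_pos).2 (by simpa using hr1)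
  obtain ⟨C', hC', h'⟩ := exists_tsum_rpow_le_geometric hp hρ0 hρ1
  set G := ∑' m : ℤ, ENNReal.ofReal (√r ^ m.natAbs) with hG
  have hGt : G ≠ ∞ := (tsum_ofReal_pow_natAbs_lt_top hρ0.le hρ1).ne
  refine ⟨C' * C * G, by finiteness, fun f hc hs ω A ν W hA hW N => ?_⟩
  set V : ℤ → ℝ≥0∞ := fun l => ∑' μ : ℤ, ENNReal.ofReal (2 ^ μ) ^ p * volume (stopSet f μ l) with hV
  have hVsum : ∑' l, V l = ∑' μ : ℤ, ENNReal.ofReal (2 ^ μ) ^ p * volume (big f μ) := by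
    rw [hV, ENNReal.tsum_comm]
    refine tsum_congr fun μ => ?_
    rw [ENNReal.tsum_mul_left, tsum_measure_stopSet]
  set D : ℕ → ℝ≥0∞ := fun j => ENNReal.ofReal (2 ^ (-(j : ℝ) * ((d : ℝ) - 1) * (p - 1))) with hD
  set U : ℤ → ℝ≥0∞ := fun n => ∑' m : ℤ, ENNReal.ofReal (√r ^ m.natAbs) * V (n + m) with hU
  have hUsum : ∑' n, U n = G * ∑' l, V l := by
    rw [hU, ENNReal.tsum_comm, hG, ← ENNReal.tsum_mul_right]
    refine tsum_congr fun m => ?_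
    rw [ENNReal.tsum_mul_left]
    congr 1
    exact (Equiv.addRight m).tsum_eq V
  have hone : ∀ n j i, ∫⁻ x, (∑' m, atomPart f ψ N n j (W n j i) m x) ^ p ≤
      C' * C * D j * U n := by
    intro n j i
    calc _ ≤ ∫⁻ x, C' * ∑' m : ℤ, ENNReal.ofReal ((√r ^ m.natAbs)⁻¹) *
          atomPart f ψ N n j (W n j i) m x ^ p := lintegral_mono fun x => h' _
      _ = C' * ∑' m : ℤ, ENNReal.ofReal ((√r ^ m.natAbs)⁻¹) *
          ∫⁻ x, atomPart f ψ N n j (W n j i) m x ^ p := by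
        have hm := fun m => measurable_atomPart (N := N) hd hψ hc hs (hW.window n j i) m
        rw [lintegral_const_mul' _ _ hC', lintegral_tsum fun m => by
          have := hm m; fun_prop]
        congr 2 with m
        rw [lintegral_const_mul' _ _ ENNReal.ofReal_ne_top]
      _ ≤ C' * ∑' m : ℤ, ENNReal.ofReal ((√r ^ m.natAbs)⁻¹) *
          (C * D j * ENNReal.ofReal (r ^ m.natAbs) * V (n + m)) := by
        gcongr with m
        unfold atomPart
        split_ifs with hmj
        · exact h f hc hs n m j hmj _ (hW.window n j i) (hW.start_le n j i) N
        · simp [ENNReal.zero_rpow_of_pos hp0]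
      _ = _ := by
        rw [hU, ← ENNReal.tsum_mul_left, ← ENNReal.tsum_mul_left]
        refine tsum_congr fun m => ?_
        have e : ENNReal.ofReal ((√r ^ m.natAbs)⁻¹) * ENNReal.ofReal (r ^ m.natAbs) =
            ENNReal.ofReal (√r ^ m.natAbs) := by
          rw [← ENNReal.ofReal_mul (by positivity)]
          congr 1
          have h2 : r ^ m.natAbs = √r ^ m.natAbs * √r ^ m.natAbs := by
            rw [← mul_pow, Real.mul_self_sqrt hr0.le]
          rw [h2, inv_mul_cancel_left₀ (by positivity)]
        rw [← e]
        ring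
  calc _ ≤ ∑' n : ℤ, ∑' j : ℕ, C' * C * U n * (ENNReal.ofReal (ω j ^ p) *
      (ν n j : ℝ≥0∞) * D j) := by
        refine ENNReal.tsum_le_tsum fun n => ENNReal.tsum_le_tsum fun j => ?_
        calc _ ≤ ENNReal.ofReal (ω j ^ p) * ∑ i : Fin (ν n j), C' * C * D j * U n := by
              gcongr with i; exact hone n j i
          _ = _ := by
            rw [Finset.sum_const, Finset.card_univ, Fintype.card_fin, nsmul_eq_mul]
            ring
    _ ≤ ∑' n : ℤ, C' * C * U n * ENNReal.ofReal (A ^ p) := by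
        refine ENNReal.tsum_le_tsum fun n => ?_
        rw [ENNReal.tsum_mul_left]
        gcongr
        exact hA n
    _ = _ := by
        rw [ENNReal.tsum_mul_right, ENNReal.tsum_mul_left, hUsum, hVsum]
        ring

/-! ### The enlarged exceptional set -/

/-- The square function of the operators on the enlarged exceptional set. -/
def starPart {d : ℕ} (f ψ : Ed d → ℂ) (M N : ℕ) (ν : ℤ → ℕ → ℕ)
    (W : ∀ n j, Fin (ν n j) → ℕ → ℝ) (j : ℕ) (μ : ℤ) (x : Ed d) : ℝ≥0∞ :=
  (∑' n : ℤ, ∑ i, (bigStar M f μ).indicator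
    (fun y => vop N (W n j i) (dil (2 ^ n) ψ) (goodDiff f μ) y ^ 2) x) ^ (1 / 2 : ℝ)

lemma ENNReal.sq_rpow_half (a : ℝ≥0∞) : (a ^ (1 / 2 : ℝ)) ^ 2 = a := by
  rw [← ENNReal.rpow_natCast, ← ENNReal.rpow_mul]
  norm_num

lemma WindowFamily.vop_le_starPart {d : ℕ} {f ψ : Ed d → ℂ} {M N : ℕ} {ν : ℤ → ℕ → ℕ}
    {W : ∀ n j, Fin (ν n j) → ℕ → ℝ} {μ : ℤ} {x : Ed d} (hx : x ∈ bigStar M f μ)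
    (n : ℤ) (j : ℕ) (i : Fin (ν n j)) :
    vop N (W n j i) (dil (2 ^ n) ψ) (goodDiff f μ) x ≤ starPart f ψ M N ν W j μ x := by
  have h : vop N (W n j i) (dil (2 ^ n) ψ) (goodDiff f μ) x =
      (vop N (W n j i) (dil (2 ^ n) ψ) (goodDiff f μ) x ^ 2) ^ (1 / 2 : ℝ) := by
    rw [← ENNReal.rpow_natCast, ← ENNReal.rpow_mul]
    norm_num
  rw [h, starPart]
  refine ENNReal.rpow_le_rpow (le_trans ?_ (ENNReal.le_tsum n)) (by norm_num)
  refine le_trans (le_of_eq ?_) (Finset.single_le_sum (fun _ _ => zero_le) (Finset.mem_univ i))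
  rw [indicator_of_mem hx]

section

variable {d : ℕ} (hd : 2 ≤ d) {f ψ : Ed d → ℂ} (hψ : IsTest ψ) (hc : Continuous f)
  (hs : HasCompactSupport f) {ν : ℤ → ℕ → ℕ} {W : ∀ n j, Fin (ν n j) → ℕ → ℝ}
  (hW : WindowFamily ν W)

include hd hψ hc hs hW

lemma WindowFamily.measurable_vop_goodDiff (N : ℕ) (n : ℤ) (j : ℕ) (i : Fin (ν n j)) (μ : ℤ) :
    Measurable (vop N (W n j i) (dil (2 ^ n) ψ) (goodDiff f μ)) :=
  measurable_vop hd (hψ.dilate (by positivity)) (hW.window n j i)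
    (isBddCompact_goodDiff (by omega) hc hs μ) N

lemma WindowFamily.measurable_starPart (M N j : ℕ) (μ : ℤ) :
    Measurable (starPart f ψ M N ν W j μ) := by
  unfold starPart
  refine Measurable.pow_const (Measurable.tsum fun n => Finset.measurable_fun_sum _ fun i _ => ?_) _
  exact ((hW.measurable_vop_goodDiff hd hψ hc hs N n j i μ).pow_const 2).indicator
    (measurableSet_bigStar M f μ)

end

lemma sq_lintegral_le_of_support {d : ℕ} {g : Ed d → ℝ≥0∞} (hg : Measurable g) {S : Set (Ed d)}
    (hS : MeasurableSet S) (h : ∀ x ∉ S, g x = 0) :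
    (∫⁻ x, g x) ^ 2 ≤ volume S * ∫⁻ x, g x ^ 2 := by
  have e : ∀ x, S.indicator (fun _ => (1 : ℝ≥0∞)) x * g x = g x := fun x => by
    by_cases hx : x ∈ S
    · simp [hx]
    · simp [hx, h x hx]
  have := sq_lintegral_mul_le (volume : Measure (Ed d)) (f := S.indicator fun _ => 1) (g := g)
    (measurable_const.indicator hS).aemeasurable hg.aemeasurable
  simp only [e] at this
  refine this.trans (mul_le_mul_left (le_of_eq ?_) _)
  rw [← lintegral_indicator_one hS]
  refine lintegral_congr fun x => ?_
  by_cases hx : x ∈ S <;> simp [hx]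

lemma EntropyBound.card_mul_le {d : ℕ} {p : ℝ} {ω : ℕ → ℝ} {A : ℝ} {ν : ℤ → ℕ → ℕ}
    (h : EntropyBound d p ω A ν) (hω : ∀ j, 1 ≤ ω j) (hp0 : 0 < p) (n : ℤ) (j : ℕ) :
    (ν n j : ℝ≥0∞) * ENNReal.ofReal (2 ^ (-(j : ℝ) * ((d : ℝ) - 1) * (p - 1))) ≤
      ENNReal.ofReal (A ^ p) := by
  refine le_trans ?_ ((ENNReal.le_tsum j).trans (h n))
  gcongr
  exact le_mul_of_one_le_left' (ENNReal.one_le_ofReal.2 (Real.one_le_rpow (hω j) hp0.le))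

lemma exists_lintegral_starPart_sq_le {d : ℕ} (hd : 2 ≤ d) {ψ : Ed d → ℂ} (hψ : IsTest ψ) {B : ℝ}
    (hB : ∀ ξ, ξ ≠ 0 → (1 + ‖ξ‖ ^ 2) * ‖𝓕 ψ ξ‖ ^ 2 ≤ B ^ 2 * (‖ξ‖ ^ (d - 1) * band ‖ξ‖ ^ 2))
    {p : ℝ} (hp : 1 < p) (hp2 : p < 2) :
    ∃ C : ℝ≥0∞, C ≠ ∞ ∧ ∀ f : Ed d → ℂ, Continuous f → HasCompactSupport f →
      ∀ ω A ν W, 1 ≤ A → (∀ j, 1 ≤ ω j) → EntropyBound d p ω A ν → WindowFamily ν W →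
      ∀ (M N j : ℕ) (μ : ℤ), ∫⁻ x, starPart f ψ M N ν W j μ x ^ 2 ≤
        C * ENNReal.ofReal ((A * (2 ^ (-(((d : ℝ) - 1) * (2 - p) / 2))) ^ j) ^ 2) *
          (ENNReal.ofReal (2 ^ μ) ^ 2 * volume (big f μ)) := by
  obtain ⟨C2, hC2, h2⟩ := exists_lintegral_vop_sq_le hd hψ hB
  obtain ⟨C3, hC3, h3⟩ := exists_tsum_bandEnergy_le d
  have hd0 : 0 < d := by omega
  refine ⟨C2 * C3 * (3 * 2 ^ d) ^ 2, by finiteness,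
    fun f hc hs ω A ν W hA1 hω hA hW M N j μ => ?_⟩
  set g := goodDiff f μ with hg
  have hgb : IsBddCompact g := isBddCompact_goodDiff hd0 hc hs μ
  set e := ENNReal.ofReal ((A * (2 ^ (-(((d : ℝ) - 1) * (2 - p) / 2))) ^ j) ^ 2) with he
  have hcard : ∀ n, (ν n j : ℝ≥0∞) * ENNReal.ofReal (2 ^ (-(j : ℝ) * (d - 1 : ℕ))) ≤ e := by
    intro n
    have hsplit : (2 : ℝ) ^ (-(j : ℝ) * (d - 1 : ℕ)) =
        2 ^ (-(j : ℝ) * ((d : ℝ) - 1) * (p - 1)) *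
          ((2 ^ (-(((d : ℝ) - 1) * (2 - p) / 2))) ^ j) ^ 2 := by
      rw [← Real.rpow_natCast, ← Real.rpow_natCast, ← Real.rpow_mul zero_le_two,
        ← Real.rpow_mul zero_le_two, ← Real.rpow_add two_pos, Nat.cast_sub (by omega)]
      congr 1
      push_cast
      ring
    rw [hsplit, ENNReal.ofReal_mul (by positivity), ← mul_assoc]
    refine (mul_le_mul_left (hA.card_mul_le hω (by linarith) n j) _).trans ?_
    rw [← ENNReal.ofReal_mul (by positivity), he, mul_pow]
    gcongr
    rw [← Real.rpow_two]
    exact Real.rpow_le_rpow_of_exponent_le hA1 hp2.le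
  have hsq : ∫⁻ x, ‖g x‖ₑ ^ 2 ≤ (3 * 2 ^ d * ENNReal.ofReal (2 ^ μ)) ^ 2 * volume (big f μ) := by
    rw [← lintegral_indicator_const (measurableSet_big f μ)]
    refine lintegral_mono fun x => ?_
    by_cases hx : x ∈ big f μ
    · simp only [hx, indicator_of_mem]
      gcongr
      exact enorm_goodDiff_le hd0 hc (hc.integrable_of_hasCompactSupport hs).2.ne μ x
    · rw [hg, goodDiff_eq_zero hd0 (hc.integrable_of_hasCompactSupport hs).2.ne hx]
      simp
  simp only [starPart, ENNReal.sq_rpow_half]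
  calc _ = ∑' n : ℤ, ∑ i, ∫⁻ x, (bigStar M f μ).indicator
        (fun y => vop N (W n j i) (dil (2 ^ n) ψ) g y ^ 2) x := by
        have hm := fun n i => ((hW.measurable_vop_goodDiff hd hψ hc hs N n j i μ).pow_const
          2).indicator (measurableSet_bigStar M f μ)
        rw [lintegral_tsum fun n => (Finset.measurable_fun_sum _ fun i _ => hm n i).aemeasurable]
        congr 1 with n
        exact lintegral_finsetSum _ fun i _ => hm n i
    _ ≤ ∑' n : ℤ, ∑ i : Fin (ν n j),
        C2 * ENNReal.ofReal (2 ^ (-(j : ℝ) * (d - 1 : ℕ))) * bandEnergy n g := by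
        refine ENNReal.tsum_le_tsum fun n => Finset.sum_le_sum fun i _ => ?_
        rw [← window_ratio n]
        exact (lintegral_mono fun x => indicator_le_self _ _ x).trans
          (h2 n _ _ (hW.window n j i) N g hgb)
    _ ≤ ∑' n : ℤ, C2 * e * bandEnergy n g := by
        refine ENNReal.tsum_le_tsum fun n => ?_
        rw [Finset.sum_const, Finset.card_univ, Fintype.card_fin, nsmul_eq_mul, ← mul_assoc,
          mul_left_comm]
        gcongr
        exact hcard n
    _ ≤ C2 * e * (C3 * ((3 * 2 ^ d * ENNReal.ofReal (2 ^ μ)) ^ 2 * volume (big f μ))) := by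
        rw [ENNReal.tsum_mul_left]
        gcongr
        exact (h3 g hgb).trans (by gcongr)
    _ = _ := by ring

lemma exists_lintegral_tsum_starPart_le {d : ℕ} (hd : 2 ≤ d) {ψ : Ed d → ℂ} (hψ : IsTest ψ) {B : ℝ}
    (hB : ∀ ξ, ξ ≠ 0 → (1 + ‖ξ‖ ^ 2) * ‖𝓕 ψ ξ‖ ^ 2 ≤ B ^ 2 * (‖ξ‖ ^ (d - 1) * band ‖ξ‖ ^ 2))
    {p : ℝ} (hp : 1 < p) (hp2 : p < 2) (M : ℕ) :
    ∃ C : ℝ≥0∞, C ≠ ∞ ∧ ∀ f : Ed d → ℂ, Continuous f → HasCompactSupport f →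
      ∀ ω A ν W, 1 ≤ A → (∀ j, 1 ≤ ω j) → EntropyBound d p ω A ν → WindowFamily ν W → ∀ N : ℕ,
      ∫⁻ x, (∑' j, ∑' μ, starPart f ψ M N ν W j μ x) ^ p ≤
      C * ENNReal.ofReal (A ^ p) * ∑' μ : ℤ, ENNReal.ofReal (2 ^ μ) ^ p * volume (big f μ) := by
  obtain ⟨C0, hC0, h0⟩ := exists_lintegral_tsum_rpow_le hp hp2
  obtain ⟨C1, hC1, h1⟩ := exists_lintegral_starPart_sq_le hd hψ hB hp hp2
  set r : ℝ := 2 ^ (-(((d : ℝ) - 1) * (2 - p) / 2)) with hr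
  have hd1 : (1 : ℝ) < d := by exact_mod_cast hd
  have hr0 : 0 < r := by positivity
  have hr1 : r < 1 := Real.rpow_lt_one_of_one_lt_of_neg one_lt_two (by
    have := mul_pos (sub_pos.2 hd1) (sub_pos.2 hp2); linarith)
  obtain ⟨C4, hC4, h4⟩ := exists_tsum_nat_rpow_le_geometric hp hr0 hr1
  set K : ℝ≥0∞ := (((2 * M + 1) ^ d : ℕ) : ℝ≥0∞) with hK
  set L : ℝ≥0∞ := C1 + (K * C1) ^ (1 / 2 : ℝ) with hL
  have hLt : L ≠ ∞ := by
    have : (K * C1) ^ (1 / 2 : ℝ) ≠ ∞ := ENNReal.rpow_ne_top_of_nonneg (by norm_num) (by finiteness)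
    finiteness
  set ρ := r ^ (p - 1) with hρ
  have hρ1 : ρ < 1 := Real.rpow_lt_one hr0.le hr1 (by linarith)
  set G := ∑' j : ℕ, ENNReal.ofReal (ρ ^ j) with hG
  have hGt : G ≠ ∞ := by
    rw [hG, ← ENNReal.ofReal_tsum_of_nonneg (fun j => by positivity)
      (summable_geometric_of_lt_one (by positivity) hρ1)]
    exact ENNReal.ofReal_ne_top
  refine ⟨C4 * G * (C0 * L), by finiteness, fun f hc hs ω A ν W hA1 hω hA hW N => ?_⟩
  have hA0 : 0 < A := by linarith
  set V := ∑' μ : ℤ, ENNReal.ofReal (2 ^ μ) ^ p * volume (big f μ) with hV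
  have hmeas := fun j μ => hW.measurable_starPart hd hψ hc hs M N j μ
  have hone : ∀ j : ℕ, ∫⁻ x, (∑' μ, starPart f ψ M N ν W j μ x) ^ p ≤
      C0 * (L * ENNReal.ofReal ((A * r ^ j) ^ p)) * V := by
    intro j
    set s := A * r ^ j with hs'
    have hs0 : 0 < s := by positivity
    have hsq := fun μ => h1 f hc hs ω A ν W hA1 hω hA hW M N j μ
    refine h0 d _ (hmeas j) s hs0 ((K * C1) ^ (1 / 2 : ℝ) * ENNReal.ofReal s)
      (C1 * ENNReal.ofReal (s ^ 2)) _ _ ?_ ?_ (fun μ => ?_) hsq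
    · rw [mul_left_comm, ← ENNReal.ofReal_mul (by positivity), ← Real.rpow_add_one hs0.ne',
        sub_add_cancel]
      gcongr
      exact le_add_self
    · rw [mul_left_comm, ← ENNReal.ofReal_mul (by positivity), ← Real.rpow_two,
        ← Real.rpow_add hs0, sub_add_cancel]
      gcongr
      exact le_self_add
    · refine (ENNReal.pow_le_pow_left_iff two_ne_zero).1 ?_
      refine (sq_lintegral_le_of_support (hmeas j μ) (measurableSet_bigStar M f μ)
        fun x hx => ?_).trans ?_
      · simp [starPart, hx]
      · refine (mul_le_mul' (measure_bigStar_le M f μ) (hsq μ)).trans (le_of_eq ?_)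
        rw [mul_pow ((K * C1) ^ (1 / 2 : ℝ) * _), mul_pow ((K * C1) ^ (1 / 2 : ℝ)),
          ENNReal.sq_rpow_half, ← ENNReal.ofReal_pow hs0.le]
        ring
  calc _ ≤ ∫⁻ x, C4 * ∑' j : ℕ, ENNReal.ofReal ((r ^ j)⁻¹) *
        (∑' μ, starPart f ψ M N ν W j μ x) ^ p := lintegral_mono fun x => h4 _
    _ = C4 * ∑' j : ℕ, ENNReal.ofReal ((r ^ j)⁻¹) *
        ∫⁻ x, (∑' μ, starPart f ψ M N ν W j μ x) ^ p := by
      rw [lintegral_const_mul' _ _ hC4, lintegral_tsum fun j =>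
        (((Measurable.tsum (hmeas j)).pow_const p).const_mul _).aemeasurable]
      congr 2 with j
      rw [lintegral_const_mul' _ _ ENNReal.ofReal_ne_top]
    _ ≤ C4 * ∑' j : ℕ, ENNReal.ofReal (ρ ^ j) * (C0 * L * ENNReal.ofReal (A ^ p) * V) := by
      refine mul_le_mul_right (ENNReal.tsum_le_tsum fun j => ?_) _
      refine (mul_le_mul_right (hone j) _).trans (le_of_eq ?_)
      have e : ENNReal.ofReal ((r ^ j)⁻¹) * ENNReal.ofReal ((A * r ^ j) ^ p) =
          ENNReal.ofReal (ρ ^ j) * ENNReal.ofReal (A ^ p) := by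
        rw [← ENNReal.ofReal_mul (by positivity), ← ENNReal.ofReal_mul (by positivity),
          Real.mul_rpow hA0.le (by positivity), hρ, ← Real.rpow_natCast (r ^ (p - 1)),
          ← Real.rpow_mul hr0.le, mul_comm (p - 1), Real.rpow_mul hr0.le, Real.rpow_natCast,
          Real.rpow_sub_one (by positivity)]
        congr 1
        field_simp
      calc _ = (ENNReal.ofReal ((r ^ j)⁻¹) * ENNReal.ofReal ((A * r ^ j) ^ p)) * (C0 * L * V) := by
            ring
        _ = _ := by rw [e]; ring
    _ = _ := by rw [ENNReal.tsum_mul_right]; ring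

/-! ### The low frequencies -/

/-- The majorant of the low frequency part. -/
def lowMajorant {d : ℕ} (p : ℝ) (M : ℕ) (f : Ed d → ℂ) (x : Ed d) : ℝ≥0∞ :=
  ∑' μ : ℤ, (bigStar M f μ).indicator (fun _ => ENNReal.ofReal (2 ^ μ) ^ p) x

lemma measurable_lowMajorant {d : ℕ} (p : ℝ) (M : ℕ) (f : Ed d → ℂ) :
    Measurable (lowMajorant p M f) :=
  Measurable.tsum fun μ => measurable_const.indicator (measurableSet_bigStar M f μ)

lemma exists_lintegral_lowMajorant_le (d : ℕ) {p : ℝ} (hp : 1 < p) (M : ℕ) :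
    ∃ C : ℝ≥0∞, C ≠ ∞ ∧ ∀ f : Ed d → ℂ, Continuous f →
      ∫⁻ x, lowMajorant p M f x ≤ C * ∫⁻ x, ‖f x‖ₑ ^ p := by
  obtain ⟨C, hC, h⟩ := exists_tsum_measure_big_le hp
  refine ⟨((2 * M + 1) ^ d : ℕ) * C, by finiteness, fun f hf => ?_⟩
  unfold lowMajorant
  rw [lintegral_tsum fun μ =>
    (measurable_const.indicator (measurableSet_bigStar M f μ)).aemeasurable, mul_assoc]
  refine le_trans ?_ (mul_le_mul_right (h d f hf) _)
  rw [← ENNReal.tsum_mul_left]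
  refine ENNReal.tsum_le_tsum fun μ => ?_
  rw [lintegral_indicator_const (measurableSet_bigStar M f μ), mul_left_comm]
  gcongr
  exact measure_bigStar_le M f μ

lemma exists_low_rpow_le {d : ℕ} (hd : 2 ≤ d) {Φ : Ed d → ℂ} (hΦ : IsTest Φ) {p : ℝ} (hp : 1 < p)
    {R : ℝ} {m : ℕ} (hR : ∀ x, R < ‖x‖ → Φ x = 0) (hm : R + 2 ≤ m) :
    ∃ C : ℝ≥0∞, C ≠ ∞ ∧ ∀ f : Ed d → ℂ, Continuous f → HasCompactSupport f →
      ∀ (k : ℤ) (t : ℝ), 0 ≤ t → t ≤ 2 * 2 ^ k → ∀ x,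
      ‖cv (sphMean d t (dil (2 ^ k) Φ)) f x‖ₑ ^ p ≤ C * lowMajorant p (m + 1) f x := by
  obtain ⟨C, hC, h⟩ := exists_low_le hd hΦ hR hm
  have hp0 : 0 < p := by linarith
  set c : ℝ := C.toReal + 1 with hc'
  have hc0 : 0 < c := by positivity
  have hCc : C ≤ ENNReal.ofReal c := by
    rw [← ENNReal.ofReal_toReal hC]
    exact ENNReal.ofReal_le_ofReal (by simp [hc'])
  refine ⟨ENNReal.ofReal (c * 2) ^ p, by finiteness, fun f hc hs k t ht0 ht x => ?_⟩
  set z := cv (sphMean d t (dil (2 ^ k) Φ)) f x with hz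
  rcases eq_or_ne z 0 with hz0 | hz0
  · simp [hz0, hp0]
  obtain ⟨μ, hμ1, hμ2⟩ := exists_mem_Ioc_zpow (show 0 < ‖z‖ / c by positivity)
    (one_lt_two : (1 : ℝ) < 2)
  rw [lt_div_iff₀ hc0] at hμ1
  rw [div_le_iff₀ hc0, zpow_add_one₀ two_ne_zero] at hμ2
  have hx : x ∈ bigStar (m + 1) f μ := by
    by_contra hx
    have h1 := (h f hc hs k μ t ht0 ht x hx).trans (mul_le_mul_left hCc _)
    rw [← ENNReal.ofReal_mul hc0.le, ← hz, ← ofReal_norm,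
      ENNReal.ofReal_le_ofReal_iff (by positivity)] at h1
    linarith
  have h2 : ENNReal.ofReal (2 ^ μ) ^ p ≤ lowMajorant p (m + 1) f x := by
    refine le_trans (le_of_eq ?_) (ENNReal.le_tsum μ)
    rw [indicator_of_mem hx]
  refine le_trans ?_ (mul_le_mul_right h2 _)
  rw [← ENNReal.mul_rpow_of_nonneg _ _ hp0.le, ← ENNReal.ofReal_mul (by positivity),
    ← ofReal_norm]
  gcongr
  linarith

/-! ### The high frequencies -/

lemma vop_le_tsum_goodDiff {d : ℕ} (hd : 2 ≤ d) {f ψ : Ed d → ℂ} (hψ : IsTest ψ)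
    (hc : Continuous f) (hs : HasCompactSupport f) {t : ℕ → ℝ} {T r : ℝ} (ht : RadiiWindow t T r)
    (N : ℕ) (x : Ed d) : vop N t ψ f x ≤ ∑' μ, vop N t ψ (goodDiff f μ) x := by
  simp only [vop]
  rw [Summable.tsum_finsetSum fun _ _ => ENNReal.summable]
  exact Finset.sum_le_sum fun m _ =>
    enorm_cv_le_tsum_goodDiff (by omega) hc hs (isTest_incr hd hψ ht m) x

lemma vop_le_star_add_atom {d : ℕ} (hd : 2 ≤ d) {f ψ : Ed d → ℂ} (hψ : IsTest ψ) (hc : Continuous f)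
    (hs : HasCompactSupport f) {R : ℝ} {M : ℕ} (hR0 : 0 ≤ R) (hR : ∀ x, R < ‖x‖ → ψ x = 0)
    (hM : R + 3 ≤ M) {ν : ℤ → ℕ → ℕ} {W : ∀ n j, Fin (ν n j) → ℕ → ℝ} (hW : WindowFamily ν W)
    (N : ℕ) (n : ℤ) (j : ℕ) (i : Fin (ν n j)) (x : Ed d) :
    vop N (W n j i) (dil (2 ^ n) ψ) f x ≤
      ∑' μ, starPart f ψ (M + 1) N ν W j μ x + ∑' m, atomPart f ψ N n j (W n j i) m x := by
  have hwin := hW.window n j i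
  have e : ∑' m, atomPart f ψ N n j (W n j i) m x = ∑' μ, ∑' l, if l < n + j then
      vop N (W n j i) (dil (2 ^ n) ψ) ((stopSet f μ l).indicator (goodDiff f μ)) x else 0 := by
    rw [ENNReal.tsum_comm]
    refine Eq.trans (tsum_congr fun m => ?_) ((Equiv.addLeft n).tsum_eq _)
    have hiff : n + m < n + j ↔ m < j := by omega
    simp only [atomPart, Equiv.coe_addLeft, hiff]
    split_ifs
    · rfl
    · exact tsum_zero.symm
  refine (vop_le_tsum_goodDiff hd (hψ.dilate (by positivity)) hc hs hwin N x).trans ?_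
  rw [e, ← ENNReal.tsum_add]
  refine ENNReal.tsum_le_tsum fun μ => ?_
  by_cases hx : x ∈ bigStar (M + 1) f μ
  · exact (WindowFamily.vop_le_starPart hx n j i).trans le_self_add
  · exact (vop_goodDiff_le hd hc hs hψ hR0 hR hM (by omega) hwin (hW.start_le n j i) N hx).trans
      le_add_self

lemma tsum_diagonal_le (g : ℤ → ℕ → ℝ≥0∞) (k : ℤ) :
    ∑' j : ℕ, g (k - j) j ≤ ∑' n, ∑' j, g n j := by
  rw [ENNReal.tsum_comm]
  exact ENNReal.tsum_le_tsum fun j => ENNReal.le_tsum (f := fun n => g n j) _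

lemma exists_high_majorant_lt_two {d : ℕ} (hd : 2 ≤ d) {ψ : Ed d → ℂ} (hψ : IsTest ψ) {B : ℝ}
    (hB : ∀ ξ, ξ ≠ 0 → (1 + ‖ξ‖ ^ 2) * ‖𝓕 ψ ξ‖ ^ 2 ≤ B ^ 2 * (‖ξ‖ ^ (d - 1) * band ‖ξ‖ ^ 2))
    {p : ℝ} (hp : 1 < p) (hp2 : p < 2) :
    ∃ C : ℝ≥0∞, C ≠ ∞ ∧ ∀ f : Ed d → ℂ, Continuous f → HasCompactSupport f →
      ∀ ω A ν W, 1 ≤ A → (∀ j, 1 ≤ ω j) → ∑' j, ENNReal.ofReal (ω j ^ (-(p / (p - 1)))) ≤ 1 →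
      EntropyBound d p ω A ν → WindowFamily ν W → ∀ N : ℕ,
      ∃ Q : Ed d → ℝ≥0∞, ∫⁻ x, Q x ≤ C * ENNReal.ofReal (A ^ p) * ∫⁻ x, ‖f x‖ₑ ^ p ∧
        ∀ (x : Ed d) (k : ℤ) (i : ∀ j : ℕ, Fin (ν (k - j) j)),
          (∑' j : ℕ, vop N (W (k - j) j (i j)) (dil (2 ^ (k - j)) ψ) f x) ^ p ≤ Q x := by
  obtain ⟨R, hR1, hR⟩ := hψ.compact.exists_radius
  obtain ⟨M, hM⟩ := exists_nat_ge (R + 3)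
  obtain ⟨C1, hC1, h1⟩ := exists_lintegral_tsum_starPart_le hd hψ hB hp hp2 (M + 1)
  obtain ⟨C2, hC2, h2⟩ := exists_lintegral_tsum_atomPart_le hd hψ hB hp hp2
  obtain ⟨C3, hC3, h3⟩ := exists_tsum_measure_big_le hp
  have hp0 : 0 < p := by linarith
  refine ⟨2 ^ (p - 1) * (C1 + C2) * C3, by finiteness, fun f hc hs ω A ν W hA1 hω hω1 hA hW N => ?_⟩
  set X : Ed d → ℝ≥0∞ := fun x => (∑' j, ∑' μ, starPart f ψ (M + 1) N ν W j μ x) ^ p with hX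
  set g : ℤ → ℕ → Ed d → ℝ≥0∞ := fun n j x => ENNReal.ofReal (ω j ^ p) *
    ∑ i, (∑' m, atomPart f ψ N n j (W n j i) m x) ^ p with hg
  have hXm : Measurable X := (Measurable.tsum fun j => Measurable.tsum fun μ =>
    hW.measurable_starPart hd hψ hc hs (M + 1) N j μ).pow_const p
  have hgm : ∀ n j i, Measurable fun x => (∑' m, atomPart f ψ N n j (W n j i) m x) ^ p :=
    fun n j i => (Measurable.tsum fun m =>
      measurable_atomPart hd hψ hc hs (hW.window n j i) m).pow_const p
  have hgm' : ∀ n j, Measurable (g n j) := fun n j =>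
    (Finset.measurable_fun_sum _ fun i _ => hgm n j i).const_mul _
  refine ⟨fun x => 2 ^ (p - 1) * (X x + ∑' n, ∑' j, g n j x), ?_, fun x k i => ?_⟩
  · have hY : ∫⁻ x, ∑' n, ∑' j, g n j x ≤ C2 * ENNReal.ofReal (A ^ p) *
        ∑' μ : ℤ, ENNReal.ofReal (2 ^ μ) ^ p * volume (big f μ) := by
      refine le_trans (le_of_eq ?_) (h2 f hc hs ω A ν W hA hW N)
      rw [lintegral_tsum fun n => (Measurable.tsum fun j => hgm' n j).aemeasurable]
      refine tsum_congr fun n => ?_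
      rw [lintegral_tsum fun j => (hgm' n j).aemeasurable]
      refine tsum_congr fun j => ?_
      rw [lintegral_const_mul' _ _ ENNReal.ofReal_ne_top,
        lintegral_finsetSum _ fun i _ => hgm n j i]
    rw [lintegral_const_mul' _ _ (by finiteness), lintegral_add_left hXm]
    calc _ ≤ 2 ^ (p - 1) * (C1 * ENNReal.ofReal (A ^ p) * (C3 * ∫⁻ x, ‖f x‖ₑ ^ p) +
          C2 * ENNReal.ofReal (A ^ p) * (C3 * ∫⁻ x, ‖f x‖ₑ ^ p)) := by
          refine mul_le_mul_right (add_le_add ?_ ?_) _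
          · exact (h1 f hc hs ω A ν W hA1 hω hA hW N).trans (mul_le_mul_right (h3 d f hc) _)
          · exact hY.trans (mul_le_mul_right (h3 d f hc) _)
      _ = _ := by ring
  · calc _ ≤ (∑' j : ℕ, ∑' μ, starPart f ψ (M + 1) N ν W j μ x +
          ∑' j : ℕ, ∑' m, atomPart f ψ N (k - j) j (W (k - j) j (i j)) m x) ^ p := by
          rw [← ENNReal.tsum_add]
          exact ENNReal.rpow_le_rpow (ENNReal.tsum_le_tsum fun j =>
            vop_le_star_add_atom hd hψ hc hs (by linarith) hR hM hW N _ j (i j) x) hp0.le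
      _ ≤ 2 ^ (p - 1) * (X x +
          (∑' j : ℕ, ∑' m, atomPart f ψ N (k - j) j (W (k - j) j (i j)) m x) ^ p) :=
          ENNReal.rpow_add_le_mul_rpow_add_rpow _ _ hp.le
      _ ≤ _ := by
          refine mul_le_mul_right (add_le_add le_rfl ?_) _
          refine (tsum_rpow_le_of_tsum_weight_le_one hp
              (fun j => by linarith [hω j]) hω1 _).trans ?_
          refine le_trans ?_ (tsum_diagonal_le (fun n j => g n j x) k)
          refine ENNReal.tsum_le_tsum fun j => mul_le_mul_right ?_ _
          exact Finset.single_le_sum (f := fun i =>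
            (∑' m, atomPart f ψ N (k - j) j (W (k - j) j i) m x) ^ p)
            (fun _ _ => zero_le) (Finset.mem_univ (i j))

lemma exists_high_majorant_two {d : ℕ} (hd : 2 ≤ d) {ψ : Ed d → ℂ} (hψ : IsTest ψ) {B : ℝ}
    (hB : ∀ ξ, ξ ≠ 0 → (1 + ‖ξ‖ ^ 2) * ‖𝓕 ψ ξ‖ ^ 2 ≤ B ^ 2 * (‖ξ‖ ^ (d - 1) * band ‖ξ‖ ^ 2)) :
    ∃ C : ℝ≥0∞, C ≠ ∞ ∧ ∀ f : Ed d → ℂ, Continuous f → HasCompactSupport f →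
      ∀ ω A ν W, (∀ j, 1 ≤ ω j) → ∑' j, ENNReal.ofReal (ω j ^ (-((2 : ℝ) / (2 - 1)))) ≤ 1 →
      EntropyBound d 2 ω A ν → WindowFamily ν W → ∀ N : ℕ,
      ∃ Q : Ed d → ℝ≥0∞,
        ∫⁻ x, Q x ≤ C * ENNReal.ofReal (A ^ (2 : ℝ)) * ∫⁻ x, ‖f x‖ₑ ^ (2 : ℝ) ∧
        ∀ (x : Ed d) (k : ℤ) (i : ∀ j : ℕ, Fin (ν (k - j) j)),
          (∑' j : ℕ, vop N (W (k - j) j (i j)) (dil (2 ^ (k - j)) ψ) f x) ^ (2 : ℝ) ≤ Q x := by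
  obtain ⟨C2, hC2, h2⟩ := exists_lintegral_vop_sq_le hd hψ hB
  obtain ⟨C3, hC3, h3⟩ := exists_tsum_bandEnergy_le d
  refine ⟨C2 * C3, by finiteness, fun f hc hs ω A ν W hω hω1 hA hW N => ?_⟩
  have hfb : IsBddCompact f := by
    obtain ⟨H, hH⟩ := hs.exists_bound_of_continuous hc
    exact ⟨hc.measurable, ⟨H, hH⟩, hs⟩
  set g : ℤ → ℕ → Ed d → ℝ≥0∞ := fun n j x => ENNReal.ofReal (ω j ^ (2 : ℝ)) *
    ∑ i, vop N (W n j i) (dil (2 ^ n) ψ) f x ^ (2 : ℝ) with hg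
  have hgm : ∀ n j i, Measurable fun x => vop N (W n j i) (dil (2 ^ n) ψ) f x ^ (2 : ℝ) :=
    fun n j i => (measurable_vop hd (hψ.dilate (by positivity)) (hW.window n j i) hfb N).pow_const _
  have hgm' : ∀ n j, Measurable (g n j) := fun n j =>
    (Finset.measurable_fun_sum _ fun i _ => hgm n j i).const_mul _
  refine ⟨fun x => ∑' n, ∑' j, g n j x, ?_, fun x k i => ?_⟩
  · rw [lintegral_tsum fun n => (Measurable.tsum fun j => hgm' n j).aemeasurable]
    calc _ ≤ ∑' n : ℤ, ∑' j : ℕ, C2 * bandEnergy n f * (ENNReal.ofReal (ω j ^ (2 : ℝ)) *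
          (ν n j : ℝ≥0∞) * ENNReal.ofReal (2 ^ (-(j : ℝ) * ((d : ℝ) - 1) * (2 - 1)))) := by
          refine ENNReal.tsum_le_tsum fun n => ?_
          rw [lintegral_tsum fun j => (hgm' n j).aemeasurable]
          refine ENNReal.tsum_le_tsum fun j => ?_
          rw [lintegral_const_mul' _ _ ENNReal.ofReal_ne_top,
            lintegral_finsetSum _ fun i _ => hgm n j i]
          have hone : ∀ i, ∫⁻ x, vop N (W n j i) (dil (2 ^ n) ψ) f x ^ (2 : ℝ) ≤
              C2 * ENNReal.ofReal (2 ^ (-(j : ℝ) * ((d : ℝ) - 1) * (2 - 1))) *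
                bandEnergy n f := fun i => by
            have := h2 n _ _ (hW.window n j i) N f hfb
            rw [window_ratio, Nat.cast_sub (by omega), Nat.cast_one] at this
            norm_num at this ⊢
            exact this
          refine (mul_le_mul_right (Finset.sum_le_sum fun i _ => hone i) _).trans (le_of_eq ?_)
          rw [Finset.sum_const, Finset.card_univ, Fintype.card_fin, nsmul_eq_mul]
          ring
      _ ≤ ∑' n : ℤ, C2 * bandEnergy n f * ENNReal.ofReal (A ^ (2 : ℝ)) := by
          refine ENNReal.tsum_le_tsum fun n => ?_
          rw [ENNReal.tsum_mul_left]
          gcongr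
          exact hA n
      _ ≤ C2 * (C3 * ∫⁻ x, ‖f x‖ₑ ^ 2) * ENNReal.ofReal (A ^ (2 : ℝ)) := by
          rw [ENNReal.tsum_mul_right, ENNReal.tsum_mul_left]
          gcongr
          exact h3 f hfb
      _ = _ := by
          simp only [ENNReal.rpow_two]
          ring
  · refine (tsum_rpow_le_of_tsum_weight_le_one one_lt_two (fun j => by linarith [hω j]) hω1 _).trans
      ?_
    refine le_trans ?_ (tsum_diagonal_le (fun n j => g n j x) k)
    refine ENNReal.tsum_le_tsum fun j => mul_le_mul_right ?_ _
    exact Finset.single_le_sum (f := fun i =>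
      vop N (W (k - j) j i) (dil (2 ^ (k - j)) ψ) f x ^ (2 : ℝ))
      (fun _ _ => zero_le) (Finset.mem_univ (i j))

end

/-! ### The decomposition into frequency bands -/

lemma cv_dil {d : ℕ} {r : ℝ} (hr : 0 < r) (Φ f : Ed d → ℂ) (y : Ed d) :
    cv (dil r Φ) f y = ∫ z, Φ z * f (y - r • z) := by
  rw [← integral_dil hr fun a b => Φ b * f (y - a), cv,
    ← integral_sub_left_eq_self (fun z => dil r Φ (y - z) * f z) volume y]
  simp only [dil, sub_sub_cancel, mul_assoc]

lemma tendsto_cv_dil {d : ℕ} {Φ : Ed d → ℂ} (hΦ : IsTest Φ) (h1 : ∫ x, Φ x = 1)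
    {f : Ed d → ℂ} (hc : Continuous f) (hs : HasCompactSupport f) {r : ℕ → ℝ} (hr : ∀ n, 0 < r n)
    (hr0 : Tendsto r atTop (𝓝 0)) (y : Ed d) :
    Tendsto (fun n => cv (dil (r n) Φ) f y) atTop (𝓝 (f y)) := by
  obtain ⟨M, hM⟩ := hs.exists_bound_of_continuous hc
  have hΦc := hΦ.continuous
  simp_rw [cv_dil (hr _)]
  have : f y = ∫ z, Φ z * f y := by rw [integral_mul_const, h1, one_mul]
  rw [this]
  refine tendsto_integral_of_dominated_convergence (fun z => ‖Φ z‖ * M)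
    (fun n => Continuous.aestronglyMeasurable (by fun_prop)) (hΦ.integrable.norm.mul_const M)
    (fun n => .of_forall fun z => ?_) (.of_forall fun z => ?_)
  · rw [norm_mul]
    gcongr
    exact hM _
  · refine Tendsto.const_mul _ ?_
    have h := (hr0.smul_const z).const_sub y
    rw [zero_smul, sub_zero] at h
    exact (hc.tendsto y).comp h

lemma tendsto_cv_sphMean_dil {d : ℕ} (hd : 2 ≤ d) {Φ : Ed d → ℂ} (hΦ : IsTest Φ)
    (h1 : ∫ x, Φ x = 1) {f : Ed d → ℂ} (hc : Continuous f) (hs : HasCompactSupport f) {r : ℕ → ℝ}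
    (hr : ∀ n, 0 < r n) (hr0 : Tendsto r atTop (𝓝 0)) (t : ℝ) (x : Ed d) :
    Tendsto (fun n => cv (sphMean d t (dil (r n) Φ)) f x) atTop (𝓝 (sphMean d t f x)) := by
  have := isProbabilityMeasure_sphMeas hd
  obtain ⟨M, hM⟩ := hs.exists_bound_of_continuous hc
  have hf := hc.integrable_of_hasCompactSupport (μ := volume) hs
  have hcv : ∀ n, Continuous (cv (dil (r n) Φ) f) := fun n =>
    ((hΦ.dilate (hr n)).convolution hf.locallyIntegrable hs).continuous
  simp_rw [← sphMean_cv hd (hΦ.dilate (hr _)) hf t, sphMean_eq_integral]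
  refine tendsto_integral_of_dominated_convergence (fun _ => ∫ z, ‖Φ z‖ * M)
    (fun n => Continuous.aestronglyMeasurable (by fun_prop)) (integrable_const _)
    (fun n => .of_forall fun y => ?_) (.of_forall fun y => tendsto_cv_dil hΦ h1 hc hs hr hr0 _)
  rw [cv_dil (hr n)]
  refine norm_integral_le_of_norm_le (hΦ.integrable.norm.mul_const M) (.of_forall fun z => ?_)
  rw [norm_mul]
  gcongr
  exact hM _

lemma sphMean_sub {d : ℕ} (hd : 2 ≤ d) {f g : Ed d → ℂ} (hf : IsTest f) (hg : IsTest g) (t : ℝ) :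
    sphMean d t (f - g) = sphMean d t f - sphMean d t g := by
  have := isProbabilityMeasure_sphMeas hd
  have key : ∀ {h : Ed d → ℂ}, IsTest h → ∀ x, Integrable (fun y => h (x - t • y)) (sphMeas d) := by
    intro h hh x
    obtain ⟨M, hM⟩ := hh.norm_le
    have := hh.continuous
    exact .of_bound (Continuous.aestronglyMeasurable (by fun_prop)) M (.of_forall fun y => hM _)
  ext x
  simp only [sphMean_eq_integral, Pi.sub_apply]
  exact integral_sub (key hf x) (key hg x)

lemma enorm_sphMean_le_low_add_high {d : ℕ} (hd : 2 ≤ d) {Φ : Ed d → ℂ} (hΦ : IsTest Φ)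
    (h1 : ∫ x, Φ x = 1) {f : Ed d → ℂ} (hc : Continuous f) (hs : HasCompactSupport f) {t : ℝ}
    (ht : 0 ≤ t) (k : ℤ) (x : Ed d) :
    ‖sphMean d t f x‖ₑ ≤ ‖cv (sphMean d t (dil (2 ^ k) Φ)) f x‖ₑ +
      ∑' j : ℕ, ‖cv (sphMean d t (dil (2 ^ (k - j)) (dil (1 / 2) Φ - Φ))) f x‖ₑ := by
  have hf := hc.integrable_of_hasCompactSupport (μ := volume) hs
  have hpos : ∀ n : ℤ, (0 : ℝ) < 2 ^ n := fun n => by positivity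
  have step : ∀ j : ℕ, cv (sphMean d t (dil (2 ^ (k - j)) (dil (1 / 2) Φ - Φ))) f x =
      cv (sphMean d t (dil (2 ^ (k - (j + 1 : ℕ))) Φ)) f x -
        cv (sphMean d t (dil (2 ^ (k - j)) Φ)) f x := by
    intro j
    have h2 : (2 : ℝ) ^ (k - j) * (1 / 2) = 2 ^ (k - (j + 1 : ℕ)) := by
      rw [Nat.cast_add_one, ← sub_sub, zpow_sub_one₀ two_ne_zero]; ring
    have ha := hΦ.dilate (hpos (k - (j + 1 : ℕ)))
    have hb := hΦ.dilate (hpos (k - j))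
    rw [dil_sub, dil_dil, h2, sphMean_sub hd ha hb,
      cv_sub_left (ha.spherical hd ht) (hb.spherical hd ht) hf]
  have partialSum : ∀ J : ℕ, ‖cv (sphMean d t (dil (2 ^ (k - J)) Φ)) f x‖ₑ ≤
      ‖cv (sphMean d t (dil (2 ^ k) Φ)) f x‖ₑ +
      ∑' j : ℕ, ‖cv (sphMean d t (dil (2 ^ (k - j)) (dil (1 / 2) Φ - Φ))) f x‖ₑ := by
    intro J
    refine le_trans ?_ (add_le_add le_rfl (ENNReal.sum_le_tsum (Finset.range J)))
    have h := Finset.sum_range_sub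
      (fun j : ℕ => cv (sphMean d t (dil (2 ^ (k - j)) Φ)) f x) J
    rw [Nat.cast_zero, sub_zero, eq_sub_iff_add_eq'] at h
    rw [← h]
    refine (enorm_add_le _ _).trans (add_le_add le_rfl ?_)
    refine (enorm_sum_le _ _).trans (Finset.sum_le_sum fun j _ => ?_)
    rw [step]
  have h0 : Tendsto (fun J : ℕ => (2 : ℝ) ^ (k - J)) atTop (𝓝 0) := by
    have h := (tendsto_pow_atTop_nhds_zero_of_lt_one (r := (1 / 2 : ℝ)) (by norm_num)
      (by norm_num)).const_mul ((2 : ℝ) ^ k)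
    rw [mul_zero] at h
    refine h.congr fun J => ?_
    rw [zpow_sub₀ two_ne_zero, zpow_natCast, one_div, inv_pow]; rfl
  exact le_of_tendsto (tendsto_cv_sphMean_dil hd hΦ h1 hc hs (fun J => hpos _) h0 t x).enorm
    (.of_forall partialSum)

/-! ### Covering the radii by windows -/

lemma exists_cover {S : Set ℝ} {δ : ℝ} (hδ : 0 < δ) (hb : BddBelow S) (ha : BddAbove S) :
    ∃ c : ℕ → ℝ, ∀ t ∈ S, ∃ i < covN S δ, t ∈ Icc (c i) (c i + δ) := by
  have hne : {n : ℕ | ∃ c : Fin n → ℝ, S ⊆ ⋃ i, Icc (c i) (c i + δ)}.Nonempty := by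
    obtain ⟨a, ha'⟩ := hb
    obtain ⟨b, hb'⟩ := ha
    obtain ⟨n, hn⟩ := exists_nat_gt ((b - a) / δ)
    refine ⟨n, fun i => a + i * δ, fun t ht => mem_iUnion.2 ?_⟩
    have hat : 0 ≤ (t - a) / δ := div_nonneg (sub_nonneg.2 (ha' ht)) hδ.le
    have hlt : ⌊(t - a) / δ⌋₊ < n := by
      refine (Nat.floor_lt hat).2 (lt_of_le_of_lt ?_ hn)
      gcongr
      exact hb' ht
    have h1 := (le_div_iff₀ hδ).1 (Nat.floor_le hat)
    have h2 := (div_lt_iff₀ hδ).1 (Nat.lt_floor_add_one ((t - a) / δ))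
    exact ⟨⟨_, hlt⟩, by dsimp only; linarith, by dsimp only; linarith⟩
  obtain ⟨c, hc⟩ := Nat.sInf_mem hne
  refine ⟨fun i => if h : i < _ then c ⟨i, h⟩ else 0, fun t ht => ?_⟩
  obtain ⟨i, hi⟩ := mem_iUnion.1 (hc ht)
  refine ⟨i, lt_of_lt_of_le i.2 (le_max_right _ _), ?_⟩
  simpa only [i.2, dite_true] using hi

lemma exists_window (G : Finset ℝ) {T r c : ℝ} (hT : 0 < T) (hr : 0 < r)
    (hG : ∀ t ∈ G, t ∈ Ico T (2 * T)) (hc : ∀ t ∈ G, t ∈ Icc c (c + r)) :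
    ∃ w : ℕ → ℝ, RadiiWindow w T r ∧ w 0 ≤ 2 * T ∧ ∀ t ∈ G, ∃ m ≤ G.card, w m = t := by
  rcases G.eq_empty_or_nonempty with rfl | hne
  · exact ⟨fun _ => T, ⟨hT, monotone_const, le_rfl, fun _ => by linarith⟩, by linarith, by simp⟩
  have hcard : 0 < G.card := hne.card_pos
  have hlt : ∀ m, min m (G.card - 1) < G.card := fun m => by omega
  have hmem : ∀ m, G.orderEmbOfFin rfl ⟨_, hlt m⟩ ∈ G := fun m => G.orderEmbOfFin_mem rfl _
  refine ⟨fun m => G.orderEmbOfFin rfl ⟨_, hlt m⟩, ⟨hT, fun a b hab => ?_, (hG _ (hmem 0)).1,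
    fun m => ?_⟩, (hG _ (hmem 0)).2.le, fun t ht => ?_⟩
  · exact (G.orderEmbOfFin rfl).monotone (Fin.mk_le_mk.2 (min_le_min_right _ hab))
  · have h1 := (hc _ (hmem m)).2
    have h2 := (hc _ (hmem 0)).1
    linarith
  · have h : t ∈ Set.range (G.orderEmbOfFin rfl) := by rwa [G.range_orderEmbOfFin]
    obtain ⟨i, rfl⟩ := h
    refine ⟨i, i.2.le, ?_⟩
    exact congrArg _ (Fin.ext (min_eq_left (Nat.le_sub_one_of_lt i.2)))

lemma exists_windowFamily (E : Set ℝ) (F : Finset ℝ) :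
    ∃ W, WindowFamily (fun n j => covN (Ek E (n + j)) (2 ^ n)) W ∧
      ∀ (n : ℤ) (j : ℕ), ∀ t ∈ F, t ∈ Ek E (n + j) → ∃ i, ∃ m ≤ F.card, W n j i m = t := by
  classical
  have hcov : ∀ (n : ℤ) (j : ℕ), ∃ c : ℕ → ℝ, ∀ t ∈ Ek E (n + j),
      ∃ i < covN (Ek E (n + j)) (2 ^ n), t ∈ Icc (c i) (c i + 2 ^ n) := fun n j =>
    exists_cover (by positivity) (bddBelow_Ico.mono inter_subset_right)
      (bddAbove_Ico.mono inter_subset_right)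
  choose c hc using hcov
  have hwin : ∀ (n : ℤ) (j : ℕ) (i : Fin (covN (Ek E (n + j)) (2 ^ n))), ∃ w : ℕ → ℝ,
      RadiiWindow w (2 ^ (n + j : ℤ)) (2 ^ n) ∧ w 0 ≤ 2 * 2 ^ (n + j : ℤ) ∧
      ∀ t ∈ F.filter (fun t => t ∈ Ek E (n + j) ∧ t ∈ Icc (c n j i) (c n j i + 2 ^ n)),
        ∃ m ≤ F.card, w m = t := by
    intro n j i
    obtain ⟨w, h1, h2, h3⟩ := exists_window
      (F.filter fun t => t ∈ Ek E (n + j) ∧ t ∈ Icc (c n j i) (c n j i + 2 ^ n))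
      (T := 2 ^ (n + j : ℤ)) (r := 2 ^ n) (c := c n j i) (by positivity) (by positivity)
      (fun t ht => by
        have h := (Finset.mem_filter.1 ht).2.1.2
        rwa [zpow_add_one₀ two_ne_zero, mul_comm _ (2 : ℝ)] at h)
      (fun t ht => (Finset.mem_filter.1 ht).2.2)
    refine ⟨w, h1, h2, fun t ht => ?_⟩
    obtain ⟨m, hm, h⟩ := h3 t ht
    exact ⟨m, hm.trans (Finset.card_filter_le _ _), h⟩
  choose W hW1 hW2 hW3 using hwin
  refine ⟨W, ⟨hW1, hW2⟩, fun n j t ht hE => ?_⟩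
  obtain ⟨i, hi, hti⟩ := hc n j t hE
  exact ⟨⟨i, hi⟩, hW3 n j ⟨i, hi⟩ t (Finset.mem_filter.2 ⟨ht, hE, hti⟩)⟩

section

open scoped FourierTransform

/-! ### The maximal function over a finite set of radii -/

lemma exists_high_majorant {d : ℕ} (hd : 2 ≤ d) {ψ : Ed d → ℂ} (hψ : IsTest ψ) {B : ℝ}
    (hB : ∀ ξ, ξ ≠ 0 → (1 + ‖ξ‖ ^ 2) * ‖𝓕 ψ ξ‖ ^ 2 ≤ B ^ 2 * (‖ξ‖ ^ (d - 1) * band ‖ξ‖ ^ 2))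
    {p : ℝ} (hp : 1 < p) (hp2 : p ≤ 2) :
    ∃ C : ℝ≥0∞, C ≠ ∞ ∧ ∀ f : Ed d → ℂ, Continuous f → HasCompactSupport f →
      ∀ ω A ν W, 1 ≤ A → (∀ j, 1 ≤ ω j) → ∑' j, ENNReal.ofReal (ω j ^ (-(p / (p - 1)))) ≤ 1 →
      EntropyBound d p ω A ν → WindowFamily ν W → ∀ N : ℕ,
      ∃ Q : Ed d → ℝ≥0∞, ∫⁻ x, Q x ≤ C * ENNReal.ofReal (A ^ p) * ∫⁻ x, ‖f x‖ₑ ^ p ∧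
        ∀ (x : Ed d) (k : ℤ) (i : ∀ j : ℕ, Fin (ν (k - j) j)),
          (∑' j : ℕ, vop N (W (k - j) j (i j)) (dil (2 ^ (k - j)) ψ) f x) ^ p ≤ Q x := by
  rcases hp2.lt_or_eq with h | rfl
  · exact exists_high_majorant_lt_two hd hψ hB hp h
  · obtain ⟨C, hC, h⟩ := exists_high_majorant_two hd hψ hB
    exact ⟨C, hC, fun f hc hs ω A ν W _ => h f hc hs ω A ν W⟩

lemma one_le_of_tsum_rpow_le_one {p : ℝ} (hp : 1 < p) {ω : ℕ → ℝ} (hω : ∀ j, 0 < ω j)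
    (h : ∑' j, ENNReal.ofReal (ω j ^ (-(p / (p - 1)))) ≤ 1) (j : ℕ) : 1 ≤ ω j := by
  have h1 := ENNReal.ofReal_le_one.1 ((ENNReal.le_tsum j).trans h)
  by_contra! h2
  have hq : -(p / (p - 1)) < 0 := neg_neg_of_pos (div_pos (by linarith) (by linarith))
  exact absurd h1 (not_le.2 (Real.one_lt_rpow_of_pos_of_lt_one_of_neg (hω j) h2 hq))

lemma EntropyBound.one_le {d : ℕ} {p : ℝ} (hp : 1 < p) {ω : ℕ → ℝ} (hω : ∀ j, 1 ≤ ω j) {A : ℝ}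
    (hA : 0 < A) {ν : ℤ → ℕ → ℕ} (hν : ∀ n j, 1 ≤ ν n j) (h : EntropyBound d p ω A ν) : 1 ≤ A := by
  have h1 := (ENNReal.le_tsum 0).trans (h 0)
  have h2 : 1 ≤ ENNReal.ofReal (ω 0 ^ p) * (ν 0 0 : ℝ≥0∞) :=
    one_le_mul (ENNReal.one_le_ofReal.2 (Real.one_le_rpow (hω 0) (by linarith)))
      (by exact_mod_cast hν 0 0)
  rw [Nat.cast_zero, neg_zero, zero_mul, zero_mul, Real.rpow_zero, ENNReal.ofReal_one,
    mul_one] at h1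
  have h3 := ENNReal.one_le_ofReal.1 (h2.trans h1)
  by_contra! h4
  exact absurd h3 (not_le.2 (Real.rpow_lt_one hA.le h4 (by linarith)))

lemma exists_lintegral_finite_maxFn_le {d : ℕ} (hd : 2 ≤ d) {p : ℝ} (hp : 1 < p) (hp2 : p ≤ 2) :
    ∃ C : ℝ≥0∞, C ≠ ∞ ∧ ∀ E : Set ℝ, E ⊆ Ioi 0 → ∀ ω : ℕ → ℝ, (∀ j, 0 < ω j) →
      ∑' j, ENNReal.ofReal (ω j ^ (-(p / (p - 1)))) ≤ 1 → ∀ A : ℝ, 0 < A →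
      EntropyBound d p ω A (fun n j => covN (Ek E (n + j)) (2 ^ n)) →
      ∀ f : Ed d → ℂ, Continuous f → HasCompactSupport f → ∀ F : Finset ℝ, (F : Set ℝ) ⊆ E →
      ∫⁻ x, (⨆ t ∈ F, ‖sphMean d t f x‖ₑ) ^ p ≤
        C * ENNReal.ofReal (A ^ p) * ∫⁻ x, ‖f x‖ₑ ^ p := by
  obtain ⟨Φ, hΦ, hΦ1, B, -, hB⟩ := exists_lp_kernel hd
  have hp0 : 0 < p := by linarith
  obtain ⟨R, -, hR⟩ := hΦ.compact.exists_radius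
  obtain ⟨m, hm⟩ := exists_nat_ge (R + 2)
  obtain ⟨C1, hC1, low⟩ := exists_low_rpow_le hd hΦ hp hR hm
  obtain ⟨C2, hC2, lowInt⟩ := exists_lintegral_lowMajorant_le d hp (m + 1)
  have hψ : IsTest (dil (1 / 2) Φ - Φ) := (hΦ.dilate (by norm_num)).sub hΦ
  obtain ⟨C3, hC3, high⟩ := exists_high_majorant hd hψ hB hp hp2
  refine ⟨2 ^ (p - 1) * (C1 * C2 + C3), by finiteness, ?_⟩
  intro E hE ω hω hω1 A hA hent f hc hs F hF
  have hω' := one_le_of_tsum_rpow_le_one hp hω hω1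
  have hA1 : 1 ≤ A := hent.one_le hp hω' hA fun n j => le_max_left _ _
  have hAp : 1 ≤ ENNReal.ofReal (A ^ p) := ENNReal.one_le_ofReal.2 (Real.one_le_rpow hA1 hp0.le)
  obtain ⟨W, hW, hWF⟩ := exists_windowFamily E F
  obtain ⟨Q, hQ, hQ'⟩ := high f hc hs ω A _ W hA1 hω' hω1 hent hW F.card
  have hf := hc.integrable_of_hasCompactSupport (μ := volume) hs
  have pointwise : ∀ x, (⨆ t ∈ F, ‖sphMean d t f x‖ₑ) ^ p ≤
      2 ^ (p - 1) * (C1 * lowMajorant p (m + 1) f x + Q x) := by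
    intro x
    rw [← ENNReal.le_rpow_inv_iff hp0]
    refine iSup₂_le fun t ht => ?_
    rw [ENNReal.le_rpow_inv_iff hp0]
    have ht0 : 0 < t := hE (hF ht)
    obtain ⟨k, hk⟩ := exists_mem_Ico_zpow ht0 (one_lt_two : (1 : ℝ) < 2)
    have hi : ∀ j : ℕ, ∃ i, ∃ m ≤ F.card, W (k - j) j i m = t := fun j =>
      hWF (k - j) j t ht ⟨hF ht, by rwa [sub_add_cancel]⟩
    choose i a ha hai using hi
    refine (ENNReal.rpow_le_rpow ((enorm_sphMean_le_low_add_high hd hΦ hΦ1 hc hs ht0.le k x).trans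
      (add_le_add le_rfl (ENNReal.tsum_le_tsum fun j => ?_))) hp0.le).trans
      ((ENNReal.rpow_add_le_mul_rpow_add_rpow _ _ hp.le).trans
      (mul_le_mul_right (add_le_add (low f hc hs k t ht0.le ?_ x) (hQ' x k i)) _))
    · have h := enorm_cv_sphMean_le_vop hd (hψ.dilate (r := 2 ^ (k - j : ℤ)) (by positivity)) hf
        (hW.window (k - j) j (i j)) (ha j) x
      rwa [hai] at h
    · rw [← zpow_one_add₀ two_ne_zero, add_comm]
      exact hk.2.le
  refine (lintegral_mono pointwise).trans ?_
  rw [lintegral_const_mul' _ _ (by finiteness),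
    lintegral_add_left ((measurable_lowMajorant _ _ _).const_mul _),
    lintegral_const_mul' _ _ hC1, mul_assoc (2 ^ (p - 1)),
    mul_assoc (2 ^ (p - 1)), add_mul, add_mul]
  refine mul_le_mul_right (add_le_add ?_ hQ) _
  calc C1 * ∫⁻ x, lowMajorant p (m + 1) f x ≤ C1 * (C2 * ∫⁻ x, ‖f x‖ₑ ^ p) :=
        mul_le_mul_right (lowInt f hc) _
    _ = C1 * C2 * 1 * ∫⁻ x, ‖f x‖ₑ ^ p := by rw [mul_one, mul_assoc]
    _ ≤ _ := mul_le_mul_left (mul_le_mul_right hAp _) _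

end

/-! ### General sets of radii -/

lemma continuous_sphMean {d : ℕ} (hd : 2 ≤ d) {f : Ed d → ℂ} (hc : Continuous f)
    (hs : HasCompactSupport f) : Continuous fun q : ℝ × Ed d => sphMean d q.1 f q.2 := by
  have := isProbabilityMeasure_sphMeas hd
  obtain ⟨M, hM⟩ := hs.exists_bound_of_continuous hc
  simp_rw [sphMean_eq_integral]
  exact continuous_of_dominated (bound := fun _ => M)
    (fun q => Continuous.aestronglyMeasurable (by fun_prop)) (fun q => .of_forall fun y => hM _)
    (integrable_const _) (.of_forall fun y => by fun_prop)

lemma lintegral_maxFn_le_of_finite {d : ℕ} (hd : 2 ≤ d) {p : ℝ} (hp : 0 < p) {E : Set ℝ}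
    {f : Ed d → ℂ} (hc : Continuous f) (hs : HasCompactSupport f) {B : ℝ≥0∞}
    (h : ∀ F : Finset ℝ, (F : Set ℝ) ⊆ E → ∫⁻ x, (⨆ t ∈ F, ‖sphMean d t f x‖ₑ) ^ p ≤ B) :
    ∫⁻ x, maxFn d E f x ^ p ≤ B := by
  have hcont := continuous_sphMean hd hc hs
  obtain ⟨D, hDE, hD, hED⟩ :=
    (TopologicalSpace.IsSeparable.of_separableSpace E).exists_countable_dense_subset
  have := hD.to_subtype
  set g : Finset D → Ed d → ℝ≥0∞ := fun F x => (⨆ t ∈ F, ‖sphMean d t f x‖ₑ) ^ p with hg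
  have hgm : ∀ F, Measurable (g F) := fun F => by
    refine Measurable.pow_const (.biSup _ F.countable_toSet fun t _ => ?_) _
    exact (Continuous.measurable (by fun_prop)).enorm
  have hdir : Directed (· ≤ ·) g := by
    refine Monotone.directed_le fun F G hFG x => ENNReal.rpow_le_rpow ?_ hp.le
    exact biSup_mono fun t ht => hFG ht
  have hle : ∀ x, maxFn d E f x ^ p ≤ ⨆ F, g F x := by
    intro x
    rw [← ENNReal.le_rpow_inv_iff hp]
    refine iSup₂_le fun t ht => ?_
    have hcl : IsClosed {t : ℝ | ‖sphMean d t f x‖ₑ ≤ (⨆ F, g F x) ^ p⁻¹} :=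
      isClosed_le (Continuous.enorm (by fun_prop)) continuous_const
    refine hcl.closure_subset_iff.2 (fun s hs => ?_) (hED ht)
    rw [mem_ofPred_eq, ENNReal.le_rpow_inv_iff hp]
    refine le_trans ?_ (le_iSup _ {⟨s, hs⟩})
    simp [hg]
  refine (lintegral_mono hle).trans ?_
  rw [lintegral_iSup_directed (fun F => (hgm F).aemeasurable) hdir]
  refine iSup_le fun F => ?_
  refine le_trans (le_of_eq ?_) (h (F.map (.subtype _)) fun t ht => ?_)
  · simp only [hg, Finset.mem_map, iSup_exists, iSup_and]
    refine lintegral_congr fun x => ?_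
    congr 1
    refine le_antisymm (iSup₂_le fun t ht => ?_) (iSup_le fun s => iSup_le fun t => iSup₂_le ?_)
    · exact le_iSup_of_le t.1 (le_iSup_of_le t (le_iSup₂_of_le ht rfl le_rfl))
    · rintro ht rfl
      exact le_iSup₂_of_le t ht le_rfl
  · obtain ⟨s, -, rfl⟩ := Finset.mem_map.1 ht
    exact hDE s.2

/-- Proposition 1.2: an `L^p` bound for the spherical maximal operator under an
entropy-weight condition. Here `p' = p/(p-1)`, so `p/p' = p-1`. -/
theorem spherical_maximal_Lp_entropy_bound (d : ℕ) (hd : 2 ≤ d)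
    (p : ℝ) (hp1 : 1 < p) (hp2 : p ≤ (d:ℝ) / ((d:ℝ) - 1)) :
    ∃ C : ℝ, 0 < C ∧
      ∀ (E : Set ℝ), E ⊆ Set.Ioi (0:ℝ) →
      ∀ (ω : ℕ → ℝ), (∀ j, 0 < ω j) →
      (∑' j : ℕ, ENNReal.ofReal ((ω j) ^ (-(p / (p - 1))))) ≤ 1 →
      ∀ A0 : ℝ, 0 < A0 →
      (∀ k : ℤ,
        (∑' j : ℕ, ENNReal.ofReal ((ω j) ^ p) * (covN (Ek E (k + j)) ((2:ℝ) ^ k) : ℝ≥0∞) *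
            ENNReal.ofReal ((2:ℝ) ^ (-(j:ℝ) * ((d:ℝ) - 1) * (p - 1)))) ≤
          ENNReal.ofReal (A0 ^ p)) →
      ∀ f : Ed d → ℂ, Continuous f → HasCompactSupport f →
        (∫⁻ x, (maxFn d E f x) ^ p) ^ (1 / p) ≤
          ENNReal.ofReal (C * A0) * eLpNorm f (ENNReal.ofReal p) volume := by
  have hp0 : 0 < p := by linarith
  have hp2' : p ≤ 2 := by
    have hd' : (2 : ℝ) ≤ d := by exact_mod_cast hd
    refine hp2.trans ((div_le_iff₀ (by linarith)).2 (by linarith))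
  obtain ⟨C, hC, h⟩ := exists_lintegral_finite_maxFn_le hd hp1 hp2'
  have hC' : C ^ (1 / p) ≠ ∞ := by finiteness
  refine ⟨(C ^ (1 / p)).toReal + 1, by positivity, ?_⟩
  intro E hE ω hω hω1 A hA hent f hc hs
  have key := lintegral_maxFn_le_of_finite hd hp0 hc hs (h E hE ω hω hω1 A hA hent f hc hs)
  have hnorm : eLpNorm f (ENNReal.ofReal p) volume = (∫⁻ x, ‖f x‖ₑ ^ p) ^ (1 / p) := by
    rw [eLpNorm_eq_lintegral_rpow_enorm_toReal (by simpa using hp0) ENNReal.ofReal_ne_top,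
      ENNReal.toReal_ofReal hp0.le]
  have hp' : 0 ≤ 1 / p := by positivity
  refine (ENNReal.rpow_le_rpow key hp').trans ?_
  rw [ENNReal.mul_rpow_of_nonneg _ _ hp', ENNReal.mul_rpow_of_nonneg _ _ hp', hnorm,
    ← ENNReal.ofReal_rpow_of_pos hA, ← ENNReal.rpow_mul, mul_one_div_cancel hp0.ne',
    ENNReal.rpow_one, ENNReal.ofReal_mul (by positivity)]
  gcongr
  rw [← ENNReal.ofReal_toReal hC']
  exact ENNReal.ofReal_le_ofReal (by rw [ENNReal.toReal_ofReal ENNReal.toReal_nonneg]; linarith)
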